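/- arXiv:1609.03710 — 4 statements merged into one kernel-verified Lean document; each statement's English description precedes it below -/
import Mathlib

section
/- Let J ⊆ K[x_1,…,x_m] be an ideal generated by binomials containing no binomial of the form x^u − 1 with u ≠ 0. Suppose there exists a finite minimal generating set S of J (no proper subset of S generates J) such that every element of S is a difference of two squarefree monomials, and S consists precisely of the indispensable binomials of J up to sign: every element of S is an indispensable binomial of J, and every indispensable binomial of J equals B or −B for some B ∈ S. Then bar(J) = card(S). -/
open MvPolynomial

noncomputable section

/-- A binomial is a difference of two monomials `x^u − x^v`. -/
def IsBinomial {K : Type*} [Field K] {m : ℕ} (f : MvPolynomial (Fin m) K) : Prop :=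
  ∃ u v : Fin m →₀ ℕ, f = monomial u (1 : K) - monomial v 1

/-- A monomial `x^u` is an indispensable monomial of `J` if every set of binomials
generating `J` contains a binomial having `x^u` as one of its two monomials. -/
def IsIndispensableMonomial {K : Type*} [Field K] {m : ℕ}
    (J : Ideal (MvPolynomial (Fin m) K)) (u : Fin m →₀ ℕ) : Prop :=
  ∀ S : Set (MvPolynomial (Fin m) K), (∀ f ∈ S, IsBinomial f) → Ideal.span S = J →
    ∃ v : Fin m →₀ ℕ,
      (monomial u (1 : K) - monomial v 1) ∈ S ∨ (monomial v (1 : K) - monomial u 1) ∈ S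

/-- The binomial arithmetical rank: the smallest `s` such that there are `s` binomials
in `I` generating `I` up to radical. -/
def bar {K : Type*} [Field K] {m : ℕ} (I : Ideal (MvPolynomial (Fin m) K)) : ℕ :=
  sInf {s | ∃ B : Fin s → MvPolynomial (Fin m) K,
    (∀ i, IsBinomial (B i)) ∧ (∀ i, B i ∈ I) ∧
    (Ideal.span (Set.range B)).radical = I.radical}

/-- A binomial `B ∈ J` is an indispensable binomial of `J` if every set of binomials
generating `J` contains `B` or `−B`. -/
def IsIndispensableBinomial {K : Type*} [Field K] {m : ℕ}
    (J : Ideal (MvPolynomial (Fin m) K)) (B : MvPolynomial (Fin m) K) : Prop :=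
  IsBinomial B ∧ B ∈ J ∧
  ∀ S : Set (MvPolynomial (Fin m) K), (∀ f ∈ S, IsBinomial f) → Ideal.span S = J →
    (B ∈ S ∨ -B ∈ S)

section helpers
variable {K : Type*} [Field K] {m : ℕ}

theorem aux_pair {u v a b : Fin m →₀ ℕ} (huv : u ≠ v)
    (h : (monomial u (1 : K) - monomial v 1) = monomial a (1 : K) - monomial b 1 ∨
      (monomial u (1 : K) - monomial v 1) = -(monomial a (1 : K) - monomial b 1)) :
    (a = u ∧ b = v) ∨ (a = v ∧ b = u) := by
  have key : ∀ w, (w = u ∨ w = v) → (w = a ∨ w = b) := by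
    intro w hw
    by_contra hc
    push Not at hc
    have h0 : coeff w (monomial u (1 : K) - monomial v 1) = 0 := by
      rcases h with h | h <;> rw [h] <;>
        simp [coeff_monomial, Ne.symm hc.1, Ne.symm hc.2]
    rcases hw with rfl | rfl
    · simp [coeff_monomial, Ne.symm huv] at h0
    · simp [coeff_monomial, huv] at h0
  have h1 := key u (Or.inl rfl)
  have h2 := key v (Or.inr rfl)
  rcases h1 with rfl | rfl <;> rcases h2 with rfl | rfl <;> simp_all

theorem aux_coeff (G : Set (MvPolynomial (Fin m) K)) (hG : ∀ f ∈ G, IsBinomial f)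
    (w : Fin m →₀ ℕ)
    (hw : ∀ a ≤ w, ∀ b, a ≠ b → (monomial a (1 : K) - monomial b 1) ∉ G ∧
      (monomial b (1 : K) - monomial a 1) ∉ G)
    (f : MvPolynomial (Fin m) K) (hf : f ∈ Ideal.span G) :
    ∀ w' ≤ w, coeff w' f = 0 := by
  induction hf using Submodule.span_induction with
  | mem x hx =>
    intro w' hw'
    obtain ⟨u, v, rfl⟩ := hG x hx
    by_cases huv : u = v
    · simp [huv]
    have h1 : u ≠ w' := by
      rintro rfl
      exact (hw _ hw' v huv).1 hx
    have h2 : v ≠ w' := by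
      rintro rfl
      exact (hw _ hw' u (Ne.symm huv)).2 hx
    simp [coeff_monomial, h1, h2]
  | zero => simp
  | add x y _ _ hx hy =>
    intro w' hw'
    simp [hx w' hw', hy w' hw']
  | smul r x _ hx =>
    intro w' hw'
    rw [smul_eq_mul, coeff_mul]
    apply Finset.sum_eq_zero
    intro p hp
    have : p.1 + p.2 = w' := by simpa using hp
    have h2 : p.2 ≤ w' := by rw [← this]; exact le_add_self
    rw [hx _ (h2.trans hw'), mul_zero]

theorem aux_replace {J : Ideal (MvPolynomial (Fin m) K)} {B : MvPolynomial (Fin m) K}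
    (hB : IsIndispensableBinomial J B)
    (S₀ : Set (MvPolynomial (Fin m) K)) (hS₀ : ∀ f ∈ S₀, IsBinomial f)
    (hJ : J = Ideal.span S₀)
    (T : Set (MvPolynomial (Fin m) K)) (hT : ∀ f ∈ T, IsBinomial f)
    (hTJ : ∀ f ∈ T, f ∈ J) (hBT : B ∈ Ideal.span T) : B ∈ T ∨ -B ∈ T := by
  have := hB.2.2 ((S₀ \ {B, -B}) ∪ T) ?_ ?_
  · rcases this with (h | h) | (h | h)
    · simp at h
    · exact Or.inl h
    · simp at h
    · exact Or.inr h
  · rintro f (hf | hf)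
    · exact hS₀ f hf.1
    · exact hT f hf
  · apply le_antisymm
    · rw [Ideal.span_le]
      rintro f (hf | hf)
      · rw [hJ]; exact Ideal.subset_span hf.1
      · exact hTJ f hf
    · conv_lhs => rw [hJ]
      rw [Ideal.span_le]
      intro f hf
      have hB' : B ∈ Ideal.span ((S₀ \ {B, -B}) ∪ T) :=
        Ideal.span_mono Set.subset_union_right hBT
      by_cases hfB : f ∈ ({B, -B} : Set (MvPolynomial (Fin m) K))
      · rcases hfB with rfl | rfl
        · exact hB'
        · exact neg_mem hB'
      · exact Ideal.subset_span (Or.inl ⟨hf, hfB⟩)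

theorem aux_symm {J : Ideal (MvPolynomial (Fin m) K)} {u v : Fin m →₀ ℕ}
    (hB : IsIndispensableBinomial J (monomial u (1 : K) - monomial v 1)) :
    IsIndispensableBinomial J (monomial v (1 : K) - monomial u 1) := by
  refine ⟨⟨v, u, rfl⟩, ?_, ?_⟩
  · rw [← neg_sub]; exact neg_mem hB.2.1
  · intro S h1 h2
    have := hB.2.2 S h1 h2
    rw [neg_sub] at this ⊢
    exact this.symm

variable {J : Ideal (MvPolynomial (Fin m) K)} {u v : Fin m →₀ ℕ}
    (S₀ : Set (MvPolynomial (Fin m) K))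

theorem aux_ne (hS₀ : ∀ f ∈ S₀, IsBinomial f) (hJ : J = Ideal.span S₀)
    (hB : IsIndispensableBinomial J (monomial u (1 : K) - monomial v 1)) : u ≠ v := by
  rintro rfl
  have := aux_replace hB S₀ hS₀ hJ ∅ (by simp) (by simp) (by simp)
  simp at this

theorem aux_class (hS₀ : ∀ f ∈ S₀, IsBinomial f) (hJ : J = Ideal.span S₀)
    (hB : IsIndispensableBinomial J (monomial u (1 : K) - monomial v 1))
    (w : Fin m →₀ ℕ) (hw : (monomial u (1 : K) - monomial w 1) ∈ J) : w = u ∨ w = v := by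
  have huv := aux_ne S₀ hS₀ hJ hB
  by_contra hc
  push Not at hc
  have hw2 : (monomial w (1 : K) - monomial v 1) ∈ J := by
    have := sub_mem hB.2.1 hw
    simpa using this
  have := aux_replace hB S₀ hS₀ hJ
    {monomial u (1 : K) - monomial w 1, monomial w (1 : K) - monomial v 1} ?_ ?_ ?_
  · simp only [Set.mem_insert_iff, Set.mem_singleton_iff] at this
    have h2 : ∀ a b : Fin m →₀ ℕ,
      ((monomial u (1 : K) - monomial v 1) = monomial a (1 : K) - monomial b 1 ∨
      -(monomial u (1 : K) - monomial v 1) = (monomial a (1 : K) - monomial b 1)) →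
      (a = u ∧ b = v) ∨ (a = v ∧ b = u) := by
      intro a b h
      apply aux_pair (K := K) huv
      rcases h with h | h
      · exact Or.inl h
      · right; rw [← h, neg_neg]
    have h3 := h2 u w
    have h4 := h2 w v
    tauto
  · rintro f (rfl | rfl)
    · exact ⟨_, _, rfl⟩
    · exact ⟨_, _, rfl⟩
  · rintro f (rfl | rfl)
    · exact hw
    · exact hw2
  · have h1 : (monomial u (1 : K) - monomial v 1) =
      (monomial u (1 : K) - monomial w 1) + (monomial w (1 : K) - monomial v 1) := by ring
    rw [h1]
    exact add_mem (Ideal.subset_span (by simp)) (Ideal.subset_span (by simp))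

theorem aux_min (hS₀ : ∀ f ∈ S₀, IsBinomial f) (hJ : J = Ideal.span S₀)
    (hB : IsIndispensableBinomial J (monomial u (1 : K) - monomial v 1))
    (a b : Fin m →₀ ℕ) (hab : a ≠ b) (hJab : (monomial a (1 : K) - monomial b 1) ∈ J)
    (hau : a ≤ u) : a = u := by
  have huv := aux_ne S₀ hS₀ hJ hB
  obtain ⟨c, rfl⟩ := exists_add_of_le hau
  have e : monomial (a + c) (1 : K) - monomial (b + c) 1 =
      monomial c 1 * (monomial a (1 : K) - monomial b 1) := by
    simp [mul_sub, monomial_mul, add_comm]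
  have hv : v = b + c := by
    have := aux_class S₀ hS₀ hJ hB (b + c) (by rw [e]; exact Ideal.mul_mem_left _ _ hJab)
    rcases this with h | h
    · exact absurd (add_right_cancel h).symm hab
    · exact h.symm
  subst hv
  have := aux_replace hB S₀ hS₀ hJ {monomial a (1 : K) - monomial b 1}
    (by rintro f rfl; exact ⟨_, _, rfl⟩) (by rintro f rfl; exact hJab)
    (by rw [e]; exact Ideal.mul_mem_left _ _ (Ideal.subset_span rfl))
  have h2 := aux_pair (K := K) (a := a) (b := b) huv (by
    rcases this with h | h
    · exact Or.inl h
    · right; rw [← Set.mem_singleton_iff.1 h, neg_neg])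
  rcases h2 with h | h
  · exact h.1
  · obtain ⟨h1, h2⟩ := h
    have : c = 0 := by
      ext i
      have e1 := DFunLike.congr_fun h1 i
      have e2 := DFunLike.congr_fun h2 i
      simp at e1 e2 ⊢
      omega
    simp [this]

theorem aux_pow {u v : Fin m →₀ ℕ} (huv : u ≠ v) (N : ℕ) :
    coeff (N • u) ((monomial u (1 : K) - monomial v 1) ^ N) = 1 := by
  rw [sub_eq_add_neg, add_pow, coeff_sum, Finset.sum_eq_single N]
  · simp [monomial_pow]
  · intro k hk hkN
    have hk' : k < N := by
      have := Finset.mem_range.1 hk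
      omega
    have e : (monomial u (1 : K)) ^ k * (-(monomial v (1 : K))) ^ (N - k) * (N.choose k : MvPolynomial (Fin m) K)
       = monomial (k • u + (N - k) • v) ((-1) ^ (N - k) * (N.choose k : K)) := by
      rw [← map_neg, monomial_pow, monomial_pow, monomial_mul, ← map_natCast (C : K →+* MvPolynomial (Fin m) K),
        mul_comm _ (C _), C_mul_monomial]
      simp [mul_comm]
    rw [e, coeff_monomial, if_neg]
    intro h
    apply huv
    ext i
    have := DFunLike.congr_fun h i
    simp at this
    obtain ⟨d, rfl⟩ := Nat.exists_eq_add_of_lt hk'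
    have h3 : k + d + 1 - k = d + 1 := by omega
    rw [h3] at this
    have : (d + 1) * v i = (d + 1) * u i := by linarith
    exact (Nat.eq_of_mul_eq_mul_left (by omega) this).symm
  · simp

end helpers

theorem stmt_3 (K : Type*) [Field K] (m : ℕ) (J : Ideal (MvPolynomial (Fin m) K))
    -- `J` is generated by binomials
    (S₀ : Set (MvPolynomial (Fin m) K)) (hS₀ : ∀ f ∈ S₀, IsBinomial f)
    (hJ : J = Ideal.span S₀)
    -- `J` contains no binomial `x^u − 1` with `u ≠ 0`
    (hno : ∀ u : Fin m →₀ ℕ, u ≠ 0 → (monomial u (1 : K) - 1) ∉ J)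
    -- `S` is a minimal generating set of `J`
    (S : Finset (MvPolynomial (Fin m) K))
    (hgen : Ideal.span (S : Set (MvPolynomial (Fin m) K)) = J)
    (hmin : ∀ S' : Finset (MvPolynomial (Fin m) K), S' ⊂ S →
      Ideal.span (S' : Set (MvPolynomial (Fin m) K)) ≠ J)
    -- every element of `S` is a difference of two squarefree monomials
    (hsqf : ∀ B ∈ S, ∃ u v : Fin m →₀ ℕ, (∀ i, u i ≤ 1) ∧ (∀ i, v i ≤ 1) ∧
      B = monomial u (1 : K) - monomial v 1)
    -- `S` consists precisely of the indispensable binomials of `J`, up to sign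
    (hind : ∀ B ∈ S, IsIndispensableBinomial J B)
    (hall : ∀ B : MvPolynomial (Fin m) K, IsIndispensableBinomial J B →
      ∃ B' ∈ S, B = B' ∨ B = -B') :
    bar J = S.card := by
  classical
  have hSbin : ∀ f ∈ (S : Set (MvPolynomial (Fin m) K)), IsBinomial f :=
    fun f hf => (hind f hf).1
  have hSJ : J = Ideal.span (S : Set (MvPolynomial (Fin m) K)) := hgen.symm
  unfold bar
  have hmem : S.card ∈ {s | ∃ B : Fin s → MvPolynomial (Fin m) K,
    (∀ i, IsBinomial (B i)) ∧ (∀ i, B i ∈ J) ∧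
    (Ideal.span (Set.range B)).radical = J.radical} := by
    refine ⟨fun i => (S.equivFin.symm i : MvPolynomial (Fin m) K),
      fun i => hSbin _ (S.equivFin.symm i).2, fun i => (hind _ (S.equivFin.symm i).2).2.1, ?_⟩
    rw [← hgen]
    congr 2
    ext f
    constructor
    · rintro ⟨i, rfl⟩
      exact (S.equivFin.symm i).2
    · intro hf
      exact ⟨S.equivFin ⟨f, hf⟩, by simp⟩
  apply le_antisymm (Nat.sInf_le hmem)
  refine le_csInf ⟨_, hmem⟩ ?_
  rintro s ⟨B, hBbin, hBJ, hrad⟩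
  choose a b hab using hBbin
  choose! p q hp hq hpq using hsqf
  -- vertices
  let φ : S × Bool → (Fin m →₀ ℕ) := fun x => if x.2 then p x.1 else q x.1
  let c : Fin s × Bool → (Fin m →₀ ℕ) := fun x => if x.2 then a x.1 else b x.1
  have hφ : ∀ x : S × Bool,
      IsIndispensableBinomial J (monomial (φ x) (1 : K) - monomial (φ (x.1, !x.2)) 1) := by
    rintro ⟨⟨f, hf⟩, t⟩
    have h1 := hind f hf
    rw [hpq f hf] at h1
    cases t
    · simpa [φ] using aux_symm h1
    · simpa [φ] using h1
  have hφsq : ∀ x i, φ x i ≤ 1 := by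
    rintro ⟨⟨f, hf⟩, t⟩ i
    cases t
    · simpa [φ] using hq f hf i
    · simpa [φ] using hp f hf i
  have hφinj : Function.Injective φ := by
    rintro x y hxy
    have hx := hφ x
    have hy := hφ y
    have hnx := aux_ne _ hSbin hSJ hx
    have hny := aux_ne _ hSbin hSJ hy
    have h2 : φ (y.1, !y.2) = φ (x.1, !x.2) := by
      have := aux_class _ hSbin hSJ hx (φ (y.1, !y.2)) (by rw [hxy]; exact hy.2.1)
      rcases this with h | h
      · exact absurd (hxy.symm.trans h.symm) hny
      · exact h
    obtain ⟨⟨f, hf⟩, t⟩ := x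
    obtain ⟨⟨g, hg⟩, t'⟩ := y
    have hfg : f = g ∨ f = -g := by
      rw [hpq f hf, hpq g hg, neg_sub]
      cases t <;> cases t' <;> simp [φ] at hxy h2 <;> simp [hxy, h2]
    have hfg' : f = g := by
      rcases hfg with h | h
      · exact h
      by_contra hne
      apply hmin (S.erase f) (Finset.erase_ssubset hf)
      apply le_antisymm
      · rw [← hgen]
        exact Ideal.span_mono (by simp)
      · rw [← hgen, Ideal.span_le]
        intro k hk
        by_cases hkf : k = f
        · subst hkf
          have hg' : g ∈ Ideal.span ((S.erase k : Finset _) : Set (MvPolynomial (Fin m) K)) := by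
            refine Ideal.subset_span ?_
            simp only [Finset.coe_erase]
            exact ⟨hg, fun h' => hne h'.symm⟩
          have hg2 := neg_mem hg'
          rwa [← h] at hg2
        · refine Ideal.subset_span ?_
          simp only [Finset.coe_erase]
          exact ⟨hk, hkf⟩
    subst hfg'
    cases t <;> cases t' <;> simp [φ] at hxy hnx ⊢
    · exact hnx hxy
    · exact hnx hxy
  have hψ : ∀ x, ∃ y, ∃ N : ℕ, φ x ≤ c y ∧ c y ≤ N • φ x := by
    intro x
    have hx := hφ x
    have hnx := aux_ne _ hSbin hSJ hx
    have h1 : (monomial (φ x) (1 : K) - monomial (φ (x.1, !x.2)) 1) ∈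
        (Ideal.span (Set.range B)).radical := by
      rw [hrad]; exact Ideal.le_radical hx.2.1
    obtain ⟨N, hN⟩ := h1
    have h2 : ∃ y, c y ≤ N • φ x ∧ c y ≠ c (y.1, !y.2) := by
      by_contra hc
      push Not at hc
      have := aux_coeff (Set.range B) (by rintro _ ⟨i, rfl⟩; exact ⟨_, _, hab i⟩)
        (N • φ x) ?_ _ hN _ le_rfl
      · rw [aux_pow hnx] at this
        exact one_ne_zero this
      · intro a' ha' b' hne
        have key : ∀ i, (monomial a' (1 : K) - monomial b' 1 = B i ∨
            monomial a' (1 : K) - monomial b' 1 = -B i) → False := by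
          intro i hi
          rw [hab i] at hi
          rcases aux_pair hne hi with ⟨h3, h4⟩ | ⟨h3, h4⟩
          · have := hc (i, true) (by simpa [c, h3] using ha')
            simp [c, h3, h4] at this
            exact hne this
          · have := hc (i, false) (by simpa [c, h4] using ha')
            simp [c, h3, h4] at this
            exact hne this
        constructor
        · rintro ⟨i, hi⟩
          exact key i (Or.inl hi.symm)
        · rintro ⟨i, hi⟩
          exact key i (Or.inr (by rw [hi, neg_sub]))
    obtain ⟨y, hy, hyne⟩ := h2
    refine ⟨y, N, ?_, hy⟩
    have hyJ : monomial (c y) (1 : K) - monomial (c (y.1, !y.2)) 1 ∈ J := by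
      obtain ⟨i, t⟩ := y
      have h3 := hBJ i
      rw [hab i] at h3
      cases t
      · simp only [c]
        rw [← neg_sub]
        simpa using neg_mem h3
      · simpa [c] using h3
    have h4 : ∃ z, φ z ≤ c y := by
      by_contra hc
      push Not at hc
      have := aux_coeff (S : Set (MvPolynomial (Fin m) K)) hSbin (c y) ?_ _
        (hSJ ▸ hyJ) _ le_rfl
      · simp [coeff_monomial, hyne.symm] at this
      · intro a' ha' b' hne
        have key : ∀ f ∈ S, (monomial a' (1 : K) - monomial b' 1 = f ∨
            monomial a' (1 : K) - monomial b' 1 = -f) → False := by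
          intro f hf hi
          rw [hpq f hf] at hi
          rcases aux_pair hne hi with ⟨h3, h4⟩ | ⟨h3, h4⟩
          · exact hc (⟨f, hf⟩, true) (by simpa [φ, h3] using ha')
          · exact hc (⟨f, hf⟩, false) (by simpa [φ, h4] using ha')
        constructor
        · intro hi
          exact key _ hi (Or.inl rfl)
        · intro hi
          exact key _ hi (Or.inr (by rw [neg_sub]))
    obtain ⟨z, hz⟩ := h4
    have hzx : φ z ≤ φ x := by
      intro i
      have h5 := (hz.trans hy) i
      have h6 := hφsq z i
      by_cases h0 : φ x i = 0
      · simp [h0] at h5 ⊢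
        exact h5
      · omega
    have hz' := hφ z
    have := aux_min _ hSbin hSJ hx _ _ (aux_ne _ hSbin hSJ hz') hz'.2.1 hzx
    rw [← this]
    exact hz
  choose ψ N h1 h2 using hψ
  have hle : ∀ x y, ψ x = ψ y → φ x ≤ φ y := by
    intro x y hxy i
    have h5 := h1 x i
    have h6 := h2 y i
    rw [← hxy] at h6
    have h7 := hφsq x i
    by_cases h0 : φ y i = 0
    · simp [h0] at h6
      omega
    · omega
  have hψinj : Function.Injective ψ := fun x y hxy =>
    hφinj (le_antisymm (hle x y hxy) (hle y x hxy.symm))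
  have := Fintype.card_le_of_injective ψ hψinj
  simp at this
  exact this
end
end

section
/- Let G be a connected finite simple graph on the vertex set {1,…,n} and let l be a positive integer with l < n such that G is l-vertex-connected, i.e., for every subset S of {1,…,n} with card(S) < l, the induced subgraph of G on the complement of S is connected. Then ara(J_G) ≥ n + l − 2. -/
open MvPolynomial

noncomputable section

/-- `f_{pq} = x_p · x_{n+q} − x_q · x_{n+p}` in `K[x_1,…,x_{2n}]`, where the first `n`
variables are indexed by `Fin.castAdd n` and the last `n` variables by `Fin.natAdd n`. -/
def edgeBinomial (K : Type*) [Field K] (n : ℕ) (p q : Fin n) :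
    MvPolynomial (Fin (n + n)) K :=
  X (Fin.castAdd n p) * X (Fin.natAdd n q) - X (Fin.castAdd n q) * X (Fin.natAdd n p)

/-- The binomial edge ideal `J_G` of a graph `G` on the vertex set `{1,…,n}`. -/
def binomialEdgeIdeal (K : Type*) [Field K] {n : ℕ} (G : SimpleGraph (Fin n)) :
    Ideal (MvPolynomial (Fin (n + n)) K) :=
  Ideal.span {f | ∃ p q : Fin n, p < q ∧ G.Adj p q ∧ f = edgeBinomial K n p q}

/-- The arithmetical rank: the smallest `s` such that there are `s` polynomials in `I`
generating `I` up to radical. -/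
def ara {K : Type*} [Field K] {m : ℕ} (I : Ideal (MvPolynomial (Fin m) K)) : ℕ :=
  sInf {s | ∃ F : Fin s → MvPolynomial (Fin m) K,
    (∀ i, F i ∈ I) ∧ (Ideal.span (Set.range F)).radical = I.radical}

section MatrixLemma

theorem ara_det_mul_eq_zero {Q ι : Type*} [CommRing Q] [Fintype ι] [DecidableEq ι] {r : ℕ}
    (hr : r < Fintype.card ι) (A : Matrix ι (Fin r) Q) (B : Matrix (Fin r) ι Q) :
    (A * B).det = 0 := by
  obtain ⟨f⟩ : Nonempty (Fin r ↪ ι) := by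
    apply Function.Embedding.nonempty_of_card_le
    simpa using hr.le
  have hns : ¬ Function.Surjective f := by
    intro h
    have := Fintype.card_le_of_surjective f h
    simp at this
    omega
  obtain ⟨i0, hi0⟩ := not_forall.mp hns
  let A' : Matrix ι ι Q := Matrix.of fun i k => ∑ j, if f j = k then A i j else 0
  let B' : Matrix ι ι Q := Matrix.of fun k l => ∑ j, if f j = k then B j l else 0
  have h1 : A * B = A' * B' := by
    ext i l
    simp only [Matrix.mul_apply, A', B', Matrix.of_apply]
    simp only [Finset.sum_mul_sum]
    rw [Finset.sum_comm]
    refine Finset.sum_congr rfl fun j _ => ?_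
    rw [Finset.sum_comm]
    rw [Finset.sum_eq_single j]
    · simp
    · intro b _ hb
      apply Finset.sum_eq_zero
      intro x _
      by_cases h : f j = x
      · have : f b ≠ x := by
          rintro rfl
          exact hb (f.injective h.symm)
        simp [this]
      · simp [h]
    · simp
  rw [h1, Matrix.det_mul, Matrix.det_eq_zero_of_column_eq_zero i0, zero_mul]
  intro i
  simp only [A', Matrix.of_apply]
  apply Finset.sum_eq_zero
  intro j _
  rw [if_neg]
  intro h
  exact hi0 ⟨j, h⟩

theorem ara_matrix_lemma {Q ι : Type*} [CommRing Q] [Fintype ι] [DecidableEq ι] {r : ℕ}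
    (hr : r < Fintype.card ι) (g : ι → Q) (H : Fin r → Q)
    (hH : ∀ j, H j ∈ Ideal.span (Set.range g)) (m : ℕ) (hm : 0 < m)
    (hg : ∀ i, g i ^ m ∈ Ideal.span (Set.range H)) :
    (∏ i, g i) ^ m ∈ Ideal.span (Set.range fun i => g i ^ (m + 1)) := by
  set I := Ideal.span (Set.range fun i => g i ^ (m + 1)) with hI
  have hA : ∀ i, ∃ a : Fin r → Q, ∑ j, a j * H j = g i ^ m := fun i => by
    simpa using (Ideal.mem_span_range_iff_exists_fun.mp (hg i))
  have hB : ∀ j, ∃ b : ι → Q, ∑ l, b l * g l = H j := fun j => by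
    simpa using (Ideal.mem_span_range_iff_exists_fun.mp (hH j))
  choose A hA using hA
  choose B hB using hB
  let P : Matrix ι ι Q := (Matrix.of A) * (Matrix.of B)
  have hP0 : P.det = 0 := ara_det_mul_eq_zero hr _ _
  have hPg : P.mulVec g = fun i => g i ^ m := by
    have : (Matrix.of B).mulVec g = H := by
      ext j; simp [Matrix.mulVec, dotProduct, hB]
    simp only [P]
    rw [← Matrix.mulVec_mulVec, this]
    ext i; simp [Matrix.mulVec, dotProduct, hA]
  let D : Matrix ι ι Q := Matrix.diagonal fun i => g i ^ (m - 1)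
  have hDg : D.mulVec g = fun i => g i ^ m := by
    ext i
    simp only [D, Matrix.mulVec_diagonal]
    rw [← pow_succ]; congr 1; omega
  let M : Finset ι → Matrix ι ι Q := fun T => Matrix.of fun i j => if i ∈ T then P i j else D i j
  have hMg : ∀ T, (M T).mulVec g = fun i => g i ^ m := by
    intro T
    ext i
    by_cases h : i ∈ T
    · have := congrFun hPg i
      simpa [Matrix.mulVec, M, h] using this
    · have := congrFun hDg i
      simpa [Matrix.mulVec, M, h] using this
  have key : ∀ T, (∏ i, g i) * ((M T).det - D.det) ∈ I := by
    intro T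
    induction T using Finset.induction_on with
    | empty =>
      have : M ∅ = D := by ext i j; simp [M]
      simp [this]
    | insert i T hi ih =>
      have e1 : M (insert i T) = Matrix.updateRow (M T) i (fun b => P i b) := by
        ext a b
        by_cases h : a = i
        · subst h; rw [Matrix.updateRow_self]; simp [M]
        · rw [Matrix.updateRow_ne h]; simp [M, h]
      have e2 : M T = Matrix.updateRow (M T) i (fun b => D i b) := by
        ext a b
        by_cases h : a = i
        · subst h; rw [Matrix.updateRow_self]; simp [M, hi]
        · rw [Matrix.updateRow_ne h]
      let N := Matrix.updateRow (M T) i ((fun b => P i b) - (fun b => D i b))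
      have e3 : (M (insert i T)).det = N.det + (M T).det := by
        rw [e1]
        conv_rhs => rw [e2]
        rw [← Matrix.det_updateRow_add, sub_add_cancel]
      have hN : ∀ a, (N.mulVec g) a = if a = i then 0 else g a ^ m := by
        intro a
        by_cases h : a = i
        · subst h
          have h1 := congrFun hPg a
          have h2 := congrFun hDg a
          simp only [Matrix.mulVec] at h1 h2 ⊢
          simp only [N, Matrix.updateRow_self, sub_dotProduct, h1, h2]
          simp
        · have := congrFun (hMg T) a
          simp only [Matrix.mulVec] at this ⊢
          simp only [N, Matrix.updateRow_ne h, this, h, if_false]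
      have hc : N.det * g i = ∑ a, N.adjugate i a * (if a = i then 0 else g a ^ m) := by
        have : (N.adjugate * N).mulVec g = N.det • g := by
          rw [Matrix.adjugate_mul, Matrix.smul_mulVec, Matrix.one_mulVec]
        have := congrFun this i
        rw [← Matrix.mulVec_mulVec] at this
        simp only [Pi.smul_apply, smul_eq_mul] at this
        rw [← this]
        simp only [Matrix.mulVec] at hN ⊢
        simp only [dotProduct]
        refine Finset.sum_congr rfl fun a _ => ?_
        rw [← hN]
        rfl
      have h4 : (∏ i, g i) * N.det ∈ I := by
        rw [← Finset.mul_prod_erase Finset.univ g (Finset.mem_univ i)]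
        have : g i * (∏ x ∈ Finset.univ.erase i, g x) * N.det =
          (∏ x ∈ Finset.univ.erase i, g x) * (N.det * g i) := by ring
        rw [this, hc, Finset.mul_sum]
        refine Ideal.sum_mem _ fun a _ => ?_
        by_cases h : a = i
        · simp [h]
        · rw [if_neg h]
          rw [← Finset.mul_prod_erase (Finset.univ.erase i) g (a := a) (by simp [h])]
          have : g a * (∏ x ∈ (Finset.univ.erase i).erase a, g x) * (N.adjugate i a * g a ^ m) =
            ((∏ x ∈ (Finset.univ.erase i).erase a, g x) * N.adjugate i a) * g a ^ (m + 1) := by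
              ring
          rw [this]
          exact Ideal.mul_mem_left _ _ (Ideal.subset_span ⟨a, rfl⟩)
      rw [e3]
      have : (∏ i, g i) * (N.det + (M T).det - D.det) =
        (∏ i, g i) * N.det + (∏ i, g i) * ((M T).det - D.det) := by ring
      rw [this]
      exact I.add_mem h4 ih
  have h5 := key Finset.univ
  have e5 : M Finset.univ = P := by ext i j; simp [M]
  rw [e5, hP0, zero_sub, mul_neg, neg_mem_iff] at h5
  have e6 : (∏ i, g i) * D.det = (∏ i, g i) ^ m := by
    simp only [D, Matrix.det_diagonal, Finset.prod_pow]
    rw [← pow_succ']; congr 1; omega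
  rwa [e6] at h5

end MatrixLemma

section TraceLemma

theorem ara_trace {B Ω τ : Type*} [CommRing B] [IsDomain B] [IsIntegrallyClosed B] [CharZero B]
    [Field Ω] [Algebra B Ω] [FaithfulSMul B Ω] [Finite τ] (t : τ → Ω)
    (ht : ∀ i, IsIntegral B (t i)) :
    ∃ D0 : ℕ, D0 ≠ 0 ∧ ∃ T : Ω →ₗ[B] FractionRing B, T 1 = (D0 : FractionRing B) ∧
      ∀ z : Ω, IsIntegral B z →
        (∀ L : Subfield Ω, (∀ b : B, algebraMap B Ω b ∈ L) → (∀ i, t i ∈ L) → z ∈ L) →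
        ∃ b : B, T z = algebraMap B (FractionRing B) b := by
  let := FractionRing.liftAlgebra B Ω
  have := FractionRing.isScalarTower_liftAlgebra B Ω
  let F := FractionRing B
  let E := IntermediateField.adjoin F (Set.range t)
  have : FiniteDimensional F E := by
    refine IntermediateField.finiteDimensional_adjoin ?_
    rintro _ ⟨i, rfl⟩
    exact (ht i).tower_top
  obtain ⟨T, hT⟩ := LinearMap.exists_extend (p := Subalgebra.toSubmodule E.toSubalgebra)
    (Algebra.trace F E : E →ₗ[F] F)
  have hT' : ∀ x : E, T (x : Ω) = Algebra.trace F E x := fun x => by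
    rw [← hT]; rfl
  refine ⟨Module.finrank F E, Module.finrank_pos.ne', T.restrictScalars B, ?_, ?_⟩
  · have := hT' 1
    have h1 : Algebra.trace F E 1 = (Module.finrank F E : F) := by
      have := Algebra.trace_algebraMap (R := F) (S := E) 1
      simpa using this
    rw [h1] at this
    exact this
  · intro z hz hL
    have hzE : z ∈ E := by
      apply hL E.toSubfield
      · intro b
        rw [IsScalarTower.algebraMap_apply B F Ω]
        exact E.algebraMap_mem _
      · intro i
        exact IntermediateField.subset_adjoin _ _ ⟨i, rfl⟩
    have : IsScalarTower B E Ω := IsScalarTower.of_algebraMap_eq fun b => by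
      rw [IsScalarTower.algebraMap_apply B F Ω, IsScalarTower.algebraMap_apply F E Ω,
        IsScalarTower.algebraMap_apply B F E]
    have hzi : IsIntegral B (⟨z, hzE⟩ : E) := by
      rw [← isIntegral_algebraMap_iff (A := E) (B := Ω) (FaithfulSMul.algebraMap_injective E Ω)]
      exact hz
    have h2 : IsIntegral B (Algebra.trace F E ⟨z, hzE⟩) := Algebra.isIntegral_trace hzi
    obtain ⟨b, hb⟩ := IsIntegrallyClosed.isIntegral_iff.mp h2
    refine ⟨b, ?_⟩
    rw [LinearMap.restrictScalars_apply]
    rw [hb, ← hT' ⟨z, hzE⟩]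

end TraceLemma

section IntegralLemmas

theorem ara_integral_of_val {B Ω : Type*} [CommRing B] [Field Ω] [Algebra B Ω] (z : Ω)
    (hz : ∀ V : ValuationSubring Ω, (∀ b : B, algebraMap B Ω b ∈ V) → z ∈ V) :
    IsIntegral B z := by
  have h1 : z ∈ (⨅ V : {V : ValuationSubring Ω // (Set.range (algebraMap B Ω)) ⊆ V.toSubring},
      V.1.toSubring) := by
    rw [Subring.mem_iInf]
    rintro ⟨V, hV⟩
    exact hz V fun b => hV ⟨b, rfl⟩
  rw [iInf_valuationSubring_superset] at h1
  have h2 : IsIntegral (Subring.closure (Set.range (algebraMap B Ω))) z := h1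
  have hc : ∀ b : B, algebraMap B Ω b ∈ Subring.closure (Set.range (algebraMap B Ω)) :=
    fun b => Subring.subset_closure ⟨b, rfl⟩
  let φ : B →+* Subring.closure (Set.range (algebraMap B Ω)) := (algebraMap B Ω).codRestrict _ hc
  have hφ : Function.Surjective φ := by
    rintro ⟨x, hx⟩
    have : Subring.closure (Set.range (algebraMap B Ω)) ≤ (algebraMap B Ω).range :=
      Subring.closure_le.mpr (by rintro _ ⟨b, rfl⟩; exact ⟨b, rfl⟩)
    obtain ⟨b, hb⟩ := this hx
    exact ⟨b, Subtype.ext hb⟩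
  let _ := φ.toAlgebra
  have : IsScalarTower B (Subring.closure (Set.range (algebraMap B Ω))) Ω :=
    IsScalarTower.of_algebraMap_eq fun b => rfl
  have : Algebra.IsIntegral B (Subring.closure (Set.range (algebraMap B Ω))) :=
    ⟨fun x => by
      obtain ⟨b, rfl⟩ := hφ x
      exact isIntegral_algebraMap⟩
  exact isIntegral_trans z h2

theorem ara_algInd {O σ ι ε τ : Type*} [CommRing O] [IsDomain O] [Fintype σ] [Fintype ι] [Fintype ε]
    (g : ι → MvPolynomial σ O) (e : ε → MvPolynomial σ O) (t : τ → MvPolynomial σ O)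
    (hcard : Fintype.card ι + Fintype.card ε = Fintype.card σ)
    (ht : ∀ i, ∀ V : ValuationSubring (FractionRing (MvPolynomial σ O)),
      (∀ a : O, algebraMap _ _ a ∈ V) →
      (∀ k, algebraMap _ _ (g k) ∈ V) → algebraMap _ _ (t i) ∈ V)
    (hX : ∀ L : Subfield (FractionRing (MvPolynomial σ O)),
      (∀ a : O, algebraMap _ _ a ∈ L) → (∀ i, algebraMap _ _ (t i) ∈ L) →
      (∀ i, algebraMap _ _ (e i) ∈ L) → ∀ v, algebraMap _ _ (X v : MvPolynomial σ O) ∈ L) :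
    AlgebraicIndependent O g := by
  let R := MvPolynomial σ O
  let Ω := FractionRing R
  let A := Algebra.adjoin O (Set.range (Sum.elim g e))
  have hgA : ∀ k, g k ∈ A := fun k => Algebra.subset_adjoin ⟨Sum.inl k, rfl⟩
  have heA : ∀ k, e k ∈ A := fun k => Algebra.subset_adjoin ⟨Sum.inr k, rfl⟩
  have hmap : ∀ x : A, algebraMap A Ω x = algebraMap R Ω x := fun x => rfl
  let L : Subfield Ω :=
    { (Subalgebra.algebraicClosure A Ω).toSubring with
      inv_mem' := fun x hx => IsAlgebraic.inv hx }
  have hL : ∀ x, x ∈ L ↔ IsAlgebraic A x := fun x => Iff.rfl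
  have hinj : Function.Injective (algebraMap R Ω) := IsFractionRing.injective R Ω
  have halg : ∀ x : R, IsAlgebraic A x := by
    intro x
    have hv : ∀ v, (X v : R) ∈ Subalgebra.algebraicClosure A R := by
      intro v
      have := hX L (fun a => by
        rw [hL]
        have := isAlgebraic_algebraMap (R := A) (A := Ω) (algebraMap O A a)
        rwa [← IsScalarTower.algebraMap_apply] at this)
        (fun i => by
          rw [hL]
          apply IsIntegral.isAlgebraic
          apply ara_integral_of_val
          intro V hV
          apply ht i V
          · intro a
            have := hV (algebraMap O A a)
            rwa [← IsScalarTower.algebraMap_apply] at this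
          · intro k
            exact hV ⟨g k, hgA k⟩)
        (fun i => by
          rw [hL]
          exact isAlgebraic_algebraMap (R := A) (A := Ω) ⟨e i, heA i⟩) v
      rw [hL] at this
      exact (isAlgebraic_algebraMap_iff hinj).mp this
    change x ∈ Subalgebra.algebraicClosure A R
    induction x using MvPolynomial.induction_on with
    | C a => exact isAlgebraic_algebraMap (R := A) (A := R) (algebraMap O A a)
    | add p q hp hq => exact add_mem hp hq
    | mul_X p v hp => exact mul_mem hp (hv v)
  have : Algebra.IsAlgebraic A R := ⟨halg⟩
  have hbas : IsTranscendenceBasis O (Sum.elim g e) := by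
    apply Algebra.IsAlgebraic.isTranscendenceBasis_of_lift_le_trdeg_of_finite
    simp only [MvPolynomial.trdeg_of_isDomain]
    simp only [Cardinal.mk_fintype, Cardinal.lift_natCast, Nat.cast_le, Fintype.card_sum]
    omega
  have := hbas.1.comp Sum.inl Sum.inl_injective
  simpa using this

end IntegralLemmas

section Identity

theorem ara_homComp_mul {O σ : Type*} [CommRing O] (N d : ℕ) (c q : MvPolynomial σ O)
    (hq : q.IsHomogeneous d) :
    ∃ c' : MvPolynomial σ O, c'.totalDegree ≤ N ∧
      homogeneousComponent N (c * q) = c' * q := by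
  have h' : homogeneousComponent N (c * q) =
      if d ≤ N then homogeneousComponent (N - d) c * q else 0 := by
    conv_lhs => rw [← sum_homogeneousComponent c, Finset.sum_mul, map_sum]
    have h1 : ∀ j, homogeneousComponent N (homogeneousComponent j c * q) =
        if N = j + d then homogeneousComponent j c * q else 0 := fun j =>
      homogeneousComponent_of_mem ((homogeneousComponent_isHomogeneous j c).mul hq)
    simp_rw [h1]
    by_cases hd : d ≤ N
    · rw [if_pos hd, Finset.sum_eq_single (N - d)]
      · rw [if_pos (by omega)]
      · intro j _ hj
        rw [if_neg (by omega)]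
      · intro hj
        rw [homogeneousComponent_eq_zero, zero_mul, ite_self]
        simp at hj
        omega
    · rw [if_neg hd]
      apply Finset.sum_eq_zero
      intro j _
      rw [if_neg (by omega)]
  by_cases hd : d ≤ N
  · refine ⟨homogeneousComponent (N - d) c, ?_, by rw [h', if_pos hd]⟩
    exact (homogeneousComponent_isHomogeneous _ _).totalDegree_le.trans (Nat.sub_le _ _)
  · exact ⟨0, by simp, by rw [h', if_neg hd, zero_mul]⟩

theorem ara_identity {O κ σ ι : Type*} [CommRing O] [Field κ] [Fintype ι]
    (φ : O →+* κ) (hφ : Function.Surjective φ) (π : O)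
    (hker : ∀ a, φ a = 0 → π ∣ a)
    (g : ι → MvPolynomial σ O) (d : ι → ℕ) (hg : ∀ i, (g i).IsHomogeneous (d i))
    {r : ℕ} (F : Fin r → MvPolynomial σ κ)
    (hF1 : ∀ k, map φ (g k) ∈ (Ideal.span (Set.range F)).radical)
    (hF2 : ∀ j, F j ∈ (Ideal.span (Set.range fun k => map φ (g k))).radical)
    (hr : r < Fintype.card ι) :
    ∃ Cb : ℕ, ∀ k : ℕ, 0 < k → ∃ (m : ℕ) (c : ι → MvPolynomial σ O) (h : MvPolynomial σ O),
      (∀ i, (c i).totalDegree ≤ Cb * k) ∧ h.totalDegree ≤ Cb * k ∧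
      (∏ i, g i) ^ m = ∑ i, c i * g i ^ (m + 1) + C (π ^ k) * h := by
  classical
  have hms : Function.Surjective (map φ : MvPolynomial σ O →+* MvPolynomial σ κ) :=
    map_surjective φ hφ
  have hkm : ∀ p : MvPolynomial σ O, map φ p = 0 → ∃ q, p = C π * q := by
    intro p hp
    have : C π ∣ p := by
      rw [C_dvd_iff_dvd_coeff]
      intro i
      apply hker
      rw [← coeff_map, hp, coeff_zero]
    exact this
  -- powers of F in span of g
  choose ne hne using hF2
  let H : Fin r → MvPolynomial σ κ := fun j => F j ^ ne j
  have hH : ∀ j, ∃ b : ι → MvPolynomial σ κ, ∑ i, b i * map φ (g i) = H j := fun j =>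
    Ideal.mem_span_range_iff_exists_fun.mp (hne j)
  have hH' : ∀ j, ∃ b : ι → MvPolynomial σ O, map φ (∑ i, b i * g i) = H j := by
    intro j
    obtain ⟨b, hb⟩ := hH j
    choose b' hb' using fun i => hms (b i)
    exact ⟨b', by simp [map_sum, hb', hb]⟩
  choose b hb using hH'
  let Ht : Fin r → MvPolynomial σ O := fun j => ∑ i, b j i * g i
  have hrad : (Ideal.span (Set.range F)).radical ≤ (Ideal.span (Set.range H)).radical := by
    rw [Ideal.radical_le_radical_iff, Ideal.span_le]
    rintro _ ⟨j, rfl⟩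
    exact ⟨ne j, Ideal.subset_span ⟨j, rfl⟩⟩
  have hM0 : ∀ i, ∃ M, map φ (g i) ^ M ∈ Ideal.span (Set.range H) := fun i => hrad (hF1 i)
  choose M0 hM0 using hM0
  let M := (∑ i, M0 i) + 1
  have hM : ∀ i, map φ (g i) ^ M ∈ Ideal.span (Set.range H) := fun i =>
    Ideal.pow_mem_of_pow_mem _ (hM0 i)
      ((Finset.single_le_sum (f := M0) (fun _ _ => Nat.zero_le _) (Finset.mem_univ i)).trans
        (Nat.le_succ _))
  have hlift : ∀ i, ∃ e : MvPolynomial σ O, g i ^ M - C π * e ∈ Ideal.span (Set.range Ht) := by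
    intro i
    obtain ⟨a, ha⟩ := Ideal.mem_span_range_iff_exists_fun.mp (hM i)
    choose a' ha' using fun j => hms (a j)
    obtain ⟨q, hq⟩ := hkm (g i ^ M - ∑ j, a' j * Ht j) (by
      simp only [map_sub, map_pow, map_sum, map_mul, ha']
      rw [← ha]
      simp only [Ht]
      simp_rw [hb]
      simp)
    refine ⟨q, ?_⟩
    rw [← hq]
    have : g i ^ M - (g i ^ M - ∑ j, a' j * Ht j) = ∑ j, a' j * Ht j := by ring
    rw [this]
    exact Ideal.sum_mem _ fun j _ => Ideal.mul_mem_left _ _ (Ideal.subset_span ⟨j, rfl⟩)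
  choose e he using hlift
  refine ⟨M * ∑ i, d i, fun k hk => ?_⟩
  let m := M * k
  let Q := MvPolynomial σ O ⧸ Ideal.span {(C (π ^ k) : MvPolynomial σ O)}
  let q : MvPolynomial σ O →+* Q := Ideal.Quotient.mk _
  have hqs : Function.Surjective q := Ideal.Quotient.mk_surjective
  have hq0 : q (C (π ^ k)) = 0 :=
    Ideal.Quotient.eq_zero_iff_mem.mpr (Ideal.subset_span rfl)
  have key := ara_matrix_lemma (Q := Q) hr (fun i => q (g i)) (fun j => q (Ht j))
    (fun j => by
      simp only [Ht, map_sum, map_mul]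
      exact Ideal.sum_mem _ fun i _ => Ideal.mul_mem_left _ _ (Ideal.subset_span ⟨i, rfl⟩))
    m (by positivity)
    (fun i => by
      have h1 : g i ^ m - (C π * e i) ^ k ∈ Ideal.span (Set.range Ht) := by
        have := sub_dvd_pow_sub_pow (g i ^ M) (C π * e i) k
        rw [← pow_mul] at this
        exact Ideal.mem_of_dvd _ this (he i)
      have h2 := Ideal.mem_map_of_mem q h1
      rw [Ideal.map_span, ← Set.range_comp] at h2
      have h3 : q (g i ^ m - (C π * e i) ^ k) = q (g i) ^ m := by
        rw [map_sub, mul_pow, map_mul, ← map_pow (f := C), hq0, zero_mul, sub_zero, map_pow]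
      rw [h3] at h2
      exact h2)
  obtain ⟨c, hc⟩ := Ideal.mem_span_range_iff_exists_fun.mp key
  choose c' hc' using fun i => hqs (c i)
  have h4 : (∏ i, g i) ^ m - ∑ i, c' i * g i ^ (m + 1) ∈
      Ideal.span {(C (π ^ k) : MvPolynomial σ O)} := by
    rw [← Ideal.Quotient.eq_zero_iff_mem]
    change q _ = 0
    rw [map_sub, RingHom.map_pow q, map_prod q, ← hc, map_sum q]
    simp only [map_mul, hc', map_pow, sub_self]
  obtain ⟨h, hh⟩ := Ideal.mem_span_singleton'.mp h4
  have hprod : ((∏ i, g i) ^ m).IsHomogeneous ((∑ i, d i) * m) :=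
    (IsHomogeneous.prod Finset.univ g d (fun i _ => hg i)).pow m
  let N := (∑ i, d i) * m
  have hN : N ≤ (M * ∑ i, d i) * k := by
    simp only [N, m]; apply le_of_eq; ring
  choose c'' hc1 hc2 using fun i => ara_homComp_mul N (d i * (m + 1)) (c' i) (g i ^ (m + 1))
    ((hg i).pow _)
  refine ⟨m, c'', homogeneousComponent N h, fun i => (hc1 i).trans hN,
    (homogeneousComponent_isHomogeneous _ _).totalDegree_le.trans hN, ?_⟩
  have h5 : (∏ i, g i) ^ m = ∑ i, c' i * g i ^ (m + 1) + C (π ^ k) * h := by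
    rw [mul_comm _ h, hh]; ring
  have h6 := congrArg (homogeneousComponent N) h5
  rw [map_add, map_sum, homogeneousComponent_C_mul] at h6
  rw [homogeneousComponent_eq_self hprod] at h6
  rw [h6]
  simp_rw [hc2]

end Identity

section Core

/-- The least common multiple of `1, …, D + 1`. -/
def araL (D : ℕ) : ℕ := (Finset.Icc 1 (D + 1)).lcm id

/-- The polynomial data used in the lower bound. -/
structure AraData (O σ ι ε τ : Type*) [CommRing O] [IsDomain O] [Fintype σ] [Fintype ι]
    [Fintype ε] where
  g : ι → MvPolynomial σ O
  e : ε → MvPolynomial σ O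
  t : τ → MvPolynomial σ O
  d : ι → ℕ
  hd : ∀ i, (g i).IsHomogeneous (d i)
  hcard : Fintype.card ι + Fintype.card ε = Fintype.card σ
  ht : ∀ i, ∀ V : ValuationSubring (FractionRing (MvPolynomial σ O)),
      (∀ a : O, algebraMap _ _ a ∈ V) →
      (∀ k, algebraMap _ _ (g k) ∈ V) → algebraMap _ _ (t i) ∈ V
  hX : ∀ L : Subfield (FractionRing (MvPolynomial σ O)),
      (∀ a : O, algebraMap _ _ a ∈ L) → (∀ i, algebraMap _ _ (t i) ∈ L) →
      (∀ i, algebraMap _ _ (e i) ∈ L) → ∀ v, algebraMap _ _ (X v : MvPolynomial σ O) ∈ L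
  ρ : ℕ → (MvPolynomial σ O →ₗ[O] FractionRing (MvPolynomial σ O))
  hρg : ∀ D k f, ρ D (g k * f) = algebraMap _ _ (g k) * ρ D f
  hρ1 : ∀ D, ρ D 1 = (araL D : FractionRing (MvPolynomial σ O))
  hρV : ∀ D f, f.totalDegree ≤ D → ∀ V : ValuationSubring (FractionRing (MvPolynomial σ O)),
      (∀ a : O, algebraMap _ _ a ∈ V) →
      (∀ k, algebraMap _ _ (g k) ∈ V) → ρ D f ∈ V
  hρL : ∀ D f, f.totalDegree ≤ D → ∀ L : Subfield (FractionRing (MvPolynomial σ O)),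
      (∀ a : O, algebraMap _ _ a ∈ L) → (∀ i, algebraMap _ _ (t i) ∈ L) → ρ D f ∈ L

theorem ara_core {O κ σ ι ε τ : Type*} [CommRing O] [IsDomain O] [CharZero O]
    [UniqueFactorizationMonoid O] [Field κ] [Fintype σ] [Fintype ι] [Fintype ε] [Finite τ]
    (φ : O →+* κ) (hφ : Function.Surjective φ) (π : O)
    (hker : ∀ a, φ a = 0 → π ∣ a)
    (hgrow : ∀ D0 Cb : ℕ, D0 ≠ 0 → ∃ k, ¬ π ^ k ∣ ((D0 * araL (Cb * k) : ℕ) : O))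
    (A : AraData O σ ι ε τ)
    {r : ℕ} (F : Fin r → MvPolynomial σ κ)
    (hF1 : ∀ k, map φ (A.g k) ∈ (Ideal.span (Set.range F)).radical)
    (hF2 : ∀ j, F j ∈ (Ideal.span (Set.range fun k => map φ (A.g k))).radical) :
    Fintype.card ι ≤ r := by
  by_contra! hr
  obtain ⟨Cb, hCb⟩ := ara_identity φ hφ π hker A.g A.d A.hd F hF1 hF2 hr
  have hind := ara_algInd A.g A.e A.t A.hcard A.ht A.hX
  let B := MvPolynomial ι O
  let R := MvPolynomial σ O
  let Ω := FractionRing R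
  let _ : Algebra B Ω := ((algebraMap R Ω).comp (aeval A.g : B →ₐ[O] R).toRingHom).toAlgebra
  have hBΩ : ∀ b : B, algebraMap B Ω b = algebraMap R Ω (aeval A.g b) := fun b => rfl
  have hinj : Function.Injective (algebraMap B Ω) := by
    intro x y h
    rw [hBΩ, hBΩ] at h
    exact hind (IsFractionRing.injective R Ω h)
  have : FaithfulSMul B Ω := (faithfulSMul_iff_algebraMap_injective B Ω).mpr hinj
  have hOB : ∀ a : O, algebraMap O Ω a = algebraMap B Ω (C a) := by
    intro a
    rw [hBΩ]
    simp only [aeval_C]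
    exact IsScalarTower.algebraMap_apply O R Ω a
  have hgB : ∀ i, algebraMap R Ω (A.g i) = algebraMap B Ω (X i) := by
    intro i
    rw [hBΩ]; simp
  have hint : ∀ z : Ω, (∀ V : ValuationSubring Ω, (∀ a : O, algebraMap O Ω a ∈ V) →
      (∀ k, algebraMap R Ω (A.g k) ∈ V) → z ∈ V) → IsIntegral B z := by
    intro z hz
    apply ara_integral_of_val
    intro V hV
    apply hz V
    · intro a; rw [hOB]; exact hV _
    · intro k; rw [hgB]; exact hV _
  obtain ⟨D0, hD0, T, hT1, hT⟩ := ara_trace (B := B) (fun i => algebraMap R Ω (A.t i))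
    (fun i => hint _ (A.ht i))
  obtain ⟨k, hk⟩ := hgrow D0 Cb hD0
  have hk0 : 0 < k := by
    rcases Nat.eq_zero_or_pos k with rfl | h
    · simp at hk
    · exact h
  obtain ⟨m, c, h, hc, hh, hid⟩ := hCb k hk0
  let D := Cb * k
  have hρB : ∀ (b : B) (f : R),
      A.ρ D (aeval A.g b * f) = algebraMap R Ω (aeval A.g b) * A.ρ D f := by
    intro b
    induction b using MvPolynomial.induction_on with
    | C a =>
      intro f
      rw [aeval_C, ← Algebra.smul_def, map_smul, Algebra.smul_def,
        IsScalarTower.algebraMap_apply O R Ω a]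
    | add p q hp hq =>
      intro f
      rw [map_add, add_mul, LinearMap.map_add, hp, hq, RingHom.map_add, add_mul]
    | mul_X p i hp =>
      intro f
      have h1 : aeval A.g (p * X i : B) = aeval A.g p * A.g i := by simp
      rw [h1, mul_assoc, hp, A.hρg, RingHom.map_mul, mul_assoc]
  have hTB : ∀ (b : B) (z : Ω),
      T (algebraMap R Ω (aeval A.g b) * z) = algebraMap B (FractionRing B) b * T z := by
    intro b z
    rw [← hBΩ, ← Algebra.smul_def, map_smul, Algebra.smul_def]
  have hTρ : ∀ f : R, f.totalDegree ≤ D → ∃ b : B, T (A.ρ D f) = algebraMap B _ b := by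
    intro f hf
    refine hT _ (hint _ (A.hρV D f hf)) ?_
    intro L hL1 hL2
    refine A.hρL D f hf L ?_ hL2
    intro a; rw [hOB]; exact hL1 _
  choose c' hc' using fun i => hTρ (c i) (hc i)
  obtain ⟨h', hh'⟩ := hTρ h hh
  have hTc : ∀ (b : B) (f : R), T (A.ρ D (aeval A.g b * f)) =
      algebraMap B (FractionRing B) b * T (A.ρ D f) := fun b f => by rw [hρB, hTB]
  have e1 : T (A.ρ D ((∏ i, A.g i) ^ m)) =
      algebraMap B (FractionRing B) ((∏ i, X i) ^ m * ((D0 * araL D : ℕ) : B)) := by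
    have h1 : (∏ i, A.g i) ^ m = aeval A.g ((∏ i, X i) ^ m : B) * 1 := by simp
    have h2 : A.ρ D 1 = algebraMap R Ω (aeval A.g ((araL D : ℕ) : B)) * 1 := by
      rw [A.hρ1, map_natCast, map_natCast, mul_one]
    rw [h1, hTc, h2, hTB, hT1, RingHom.map_mul]
    simp [mul_comm]
  have e2 : ∀ i, T (A.ρ D (c i * A.g i ^ (m + 1))) =
      algebraMap B (FractionRing B) ((X i : B) ^ (m + 1) * c' i) := by
    intro i
    have h1 : c i * A.g i ^ (m + 1) = aeval A.g ((X i : B) ^ (m + 1)) * c i := by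
      rw [mul_comm]; simp
    rw [h1, hTc, hc', RingHom.map_mul]
  have e3 : T (A.ρ D (C (π ^ k) * h)) = algebraMap B (FractionRing B) (C (π ^ k) * h') := by
    have h1 : C (π ^ k) * h = aeval A.g (C (π ^ k) : B) * h := by
      rw [aeval_C]; rfl
    rw [h1, hTc, hh', RingHom.map_mul]
  have e6 : (∏ i, X i) ^ m * ((D0 * araL D : ℕ) : B) =
      ∑ i, (X i : B) ^ (m + 1) * c' i + C (π ^ k) * h' := by
    apply IsFractionRing.injective B (FractionRing B)
    rw [← e1, hid, LinearMap.map_add, map_add, map_sum, map_sum, e3, RingHom.map_add, map_sum]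
    simp_rw [e2]
  let s : ι →₀ ℕ := Finsupp.equivFunOnFinite.symm fun _ => m
  have e7 := congrArg (coeff s) e6
  have hmon : ((∏ i, X i) ^ m : B) = monomial s 1 := by
    rw [← Finset.prod_pow, monomial_eq]
    simp [s, Finsupp.prod_fintype]
  rw [hmon, coeff_add, coeff_sum, coeff_C_mul] at e7
  have e8 : ∀ i, coeff s ((X i : B) ^ (m + 1) * c' i) = 0 := by
    intro i
    rw [X_pow_eq_monomial, mul_comm, coeff_mul_monomial', if_neg]
    intro hle
    have := hle i
    simp [s] at this
  have e9 : coeff s (monomial s (1 : O) * ((D0 * araL D : ℕ) : B)) = ((D0 * araL D : ℕ) : O) := by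
    rw [mul_comm]
    have : ((D0 * araL D : ℕ) : B) = C ((D0 * araL D : ℕ) : O) := by simp
    have h1 : coeff s (monomial s (1 : O)) = 1 := by
      classical rw [coeff_monomial, if_pos rfl]
    rw [this, coeff_C_mul]
    refine (congrArg _ h1).trans (mul_one _)
  rw [e9] at e7
  simp only [e8, Finset.sum_const_zero, zero_add] at e7
  exact hk ⟨_, e7⟩

end Core

section Growth

theorem araL_ne_zero (D : ℕ) : araL D ≠ 0 := by
  unfold araL
  rw [Ne, Finset.lcm_eq_zero_iff]
  simp

theorem dvd_araL {D i : ℕ} (h1 : 0 < i) (h2 : i ≤ D + 1) : i ∣ araL D :=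
  Finset.dvd_lcm (f := id) (Finset.mem_Icc.mpr ⟨h1, h2⟩)

theorem ara_pow_dvd_lcm {p : ℕ} (hp : p.Prime) (v : ℕ) {a b : ℕ} (ha : a ≠ 0) (hb : b ≠ 0)
    (h : p ^ v ∣ Nat.lcm a b) : p ^ v ∣ a ∨ p ^ v ∣ b := by
  rw [hp.pow_dvd_iff_le_factorization ha, hp.pow_dvd_iff_le_factorization hb]
  rw [hp.pow_dvd_iff_le_factorization (Nat.lcm_ne_zero ha hb), Nat.factorization_lcm ha hb] at h
  simpa using h

theorem ara_pow_dvd_araL {p : ℕ} (hp : p.Prime) (v D : ℕ) (h : p ^ v ∣ araL D) :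
    p ^ v ≤ D + 1 := by
  have : ∀ s : Finset ℕ, (∀ i ∈ s, 0 < i ∧ i ≤ D + 1) → p ^ v ∣ s.lcm id → p ^ v ≤ D + 1 := by
    intro s
    induction s using Finset.induction_on with
    | empty =>
      intro _ h
      simp only [Finset.lcm_empty, Nat.dvd_one] at h
      omega
    | insert a s ha ih =>
      intro hs h
      rw [Finset.lcm_insert] at h
      have h0 : s.lcm id ≠ 0 := by
        rw [Ne, Finset.lcm_eq_zero_iff]
        rintro ⟨x, hx, hx0⟩
        have := hs x (by simp [Finset.mem_coe.mp hx])
        simp at hx0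
        omega
      have ha' := hs a (by simp)
      rcases ara_pow_dvd_lcm hp v (show id a ≠ 0 by simp; omega) h0 h with h1 | h1
      · exact (Nat.le_of_dvd ha'.1 h1).trans ha'.2
      · exact ih (fun i hi => hs i (by simp [hi])) h1
  exact this _ (by simp; omega) h

theorem ara_growth_nat {p : ℕ} (hp : p.Prime) (D0 Cb : ℕ) (hD0 : D0 ≠ 0) :
    ∃ k, ¬ p ^ k ∣ D0 * araL (Cb * k) := by
  let j := D0 * (2 * Cb + 1)
  have hj : 0 < j := by positivity
  refine ⟨2 * j, fun h => ?_⟩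
  have h1 : p ^ (2 * j) ≤ D0 * (Cb * (2 * j) + 1) := by
    rw [hp.pow_dvd_iff_le_factorization (mul_ne_zero hD0 (araL_ne_zero _)),
      Nat.factorization_mul hD0 (araL_ne_zero _)] at h
    have h2 : p ^ (D0.factorization p) ≤ D0 := Nat.le_of_dvd (by omega) (Nat.ordProj_dvd _ _)
    have h3 : p ^ ((araL (Cb * (2 * j))).factorization p) ≤ Cb * (2 * j) + 1 :=
      ara_pow_dvd_araL hp _ _ (Nat.ordProj_dvd _ _)
    calc p ^ (2 * j) ≤ p ^ (D0.factorization p + (araL (Cb * (2 * j))).factorization p) :=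
          Nat.pow_le_pow_right hp.pos h
      _ ≤ _ := by rw [pow_add]; exact Nat.mul_le_mul h2 h3
  have h4 : 2 ^ (2 * j) ≤ p ^ (2 * j) := Nat.pow_le_pow_left hp.two_le _
  have h5 : j < 2 ^ j := Nat.lt_two_pow_self
  have h6 : j * j < 2 ^ (2 * j) := by
    rw [two_mul, pow_add]; exact Nat.mul_lt_mul'' h5 h5
  have h7 : D0 * (Cb * (2 * j) + 1) ≤ j * j := by
    calc D0 * (Cb * (2 * j) + 1) ≤ D0 * (Cb * (2 * j) + j) := by gcongr; omega
      _ = j * j := by simp only [j]; ring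
  omega

theorem ara_witt_nat {p : ℕ} [hp : Fact p.Prime] {k : Type*} [Field k] [CharP k p] {N : ℕ}
    (hN : N ≠ 0) : ∃ (v : ℕ) (u : WittVector p k), IsUnit u ∧ p ^ v ∣ N ∧
      (N : WittVector p k) = (p : WittVector p k) ^ v * u := by
  obtain ⟨v, u, hu, h⟩ := Nat.exists_eq_pow_mul_and_not_dvd hN p hp.out.ne_one
  refine ⟨v, (u : WittVector p k), ?_, ⟨u, h⟩, by rw [h]; push_cast; rfl⟩
  apply WittVector.isUnit_of_coeff_zero_ne_zero
  have : WittVector.constantCoeff (u : WittVector p k) = (u : k) := map_natCast _ _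
  rw [WittVector.constantCoeff_apply] at this
  rw [this]
  intro h0
  exact hu ((CharP.cast_eq_zero_iff k p u).mp h0)

theorem ara_witt_charZero {p : ℕ} [hp : Fact p.Prime] {k : Type*} [Field k] [CharP k p] :
    CharZero (WittVector p k) := by
  apply charZero_of_inj_zero
  intro N hN
  by_contra h
  obtain ⟨v, u, hu, -, h2⟩ := ara_witt_nat (p := p) (k := k) h
  rw [hN] at h2
  have := mul_ne_zero (pow_ne_zero v (WittVector.p_nonzero p k)) hu.ne_zero
  exact this h2.symm

theorem ara_witt_dvd {p : ℕ} [hp : Fact p.Prime] {κ : Type*} [Field κ] [CharP κ p] {N k : ℕ}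
    (hN : N ≠ 0) (h : (p : WittVector p κ) ^ k ∣ (N : WittVector p κ)) : p ^ k ∣ N := by
  obtain ⟨v, u, hu, h1, h2⟩ := ara_witt_nat (p := p) (k := κ) hN
  rw [h2, hu.dvd_mul_right] at h
  have hirr := WittVector.irreducible p (k := κ)
  rw [pow_dvd_pow_iff hirr.ne_zero hirr.not_isUnit] at h
  exact (pow_dvd_pow p h).trans h1

end Growth

section Bound
universe u

theorem ara_rad_map {K L σ : Type*} [Field K] [Field L] (f : K →+* L) {α : Type*}
    (F : α → MvPolynomial σ K) (x : MvPolynomial σ K)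
    (h : x ∈ (Ideal.span (Set.range F)).radical) :
    map f x ∈ (Ideal.span (Set.range fun i => map f (F i))).radical := by
  obtain ⟨m, hm⟩ := h
  refine ⟨m, ?_⟩
  have := Ideal.mem_map_of_mem (map f) hm
  rw [Ideal.map_span, ← Set.range_comp, map_pow] at this
  exact this

theorem ara_bound {K : Type u} [Field K] {σ ι ε τ : Type*} [Fintype σ] [Fintype ι] [Fintype ε]
    [Finite τ]
    (A : ∀ (O : Type u) [CommRing O] [IsDomain O] [CharZero O], AraData O σ ι ε τ)
    (gK : ι → MvPolynomial σ K)
    (hgK : ∀ (O : Type u) [CommRing O] [IsDomain O] [CharZero O] (φ : O →+* AlgebraicClosure K)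
      (k : ι), map φ ((A O).g k) = map (algebraMap K (AlgebraicClosure K)) (gK k))
    {r : ℕ} (F : Fin r → MvPolynomial σ K)
    (hF1 : ∀ k, gK k ∈ (Ideal.span (Set.range F)).radical)
    (hF2 : ∀ j, F j ∈ (Ideal.span (Set.range gK)).radical) :
    Fintype.card ι ≤ r := by
  let κ := AlgebraicClosure K
  let f := algebraMap K κ
  have h1 := fun k => ara_rad_map f F _ (hF1 k)
  have h2 := fun j => ara_rad_map f gK _ (hF2 j)
  obtain ⟨p, hp⟩ := CharP.exists κ
  rcases CharP.char_is_prime_or_zero κ p with hpp | rfl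
  · have : Fact p.Prime := ⟨hpp⟩
    have : CharZero (WittVector p κ) := ara_witt_charZero
    refine ara_core (O := WittVector p κ) WittVector.constantCoeff
      (WittVector.constantCoeff_surjective p) (p : WittVector p κ) ?_ ?_ (A (WittVector p κ))
      (fun i => map f (F i)) ?_ ?_
    · intro a ha
      have h3 : a ∈ RingHom.ker (WittVector.constantCoeff : WittVector p κ →+* κ) := ha
      rw [WittVector.ker_constantCoeff] at h3
      exact Ideal.mem_span_singleton.mp h3
    · intro D0 Cb hD0
      obtain ⟨k, hk⟩ := ara_growth_nat hpp D0 Cb hD0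
      exact ⟨k, fun h => hk (ara_witt_dvd (mul_ne_zero hD0 (araL_ne_zero _)) h)⟩
    · intro k
      rw [hgK]
      exact h1 k
    · intro j
      simp_rw [hgK]
      exact h2 j
  · have : CharZero κ := CharP.charP_to_charZero κ
    refine ara_core (O := κ) (RingHom.id κ) Function.surjective_id (0 : κ) ?_ ?_ (A κ)
      (fun i => map f (F i)) ?_ ?_
    · intro a ha
      simp at ha
      simp [ha]
    · intro D0 Cb hD0
      refine ⟨1, fun h => ?_⟩
      rw [pow_one, zero_dvd_iff, Nat.cast_eq_zero] at h
      exact mul_ne_zero hD0 (araL_ne_zero _) h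
    · intro k
      rw [hgK]
      exact h1 k
    · intro j
      simp_rw [hgK]
      exact h2 j

end Bound

section RelationLemmas

/-- quadratic straightening relations with respect to a weight. -/
def AraRel {R J : Type*} [CommRing R] (c : J → R) (wt : J → ℕ) : Prop :=
  ∀ j j', j ≠ j' → wt j = wt j' → ∃ a b a' b' : J, ∃ s : R, (s = 0 ∨ s = 1) ∧
    wt a < wt j ∧ wt a' < wt j ∧ c j * c j' = c a * c b - s * (c a' * c b')

theorem AraRel.map {R S J : Type*} [CommRing R] [CommRing S] {c : J → R} {wt : J → ℕ}
    (h : AraRel c wt) (f : R →+* S) : AraRel (fun j => f (c j)) wt := by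
  intro j j' hne hw
  obtain ⟨a, b, a', b', s, hs, h1, h2, h3⟩ := h j j' hne hw
  refine ⟨a, b, a', b', f s, ?_, h1, h2, ?_⟩
  · rcases hs with rfl | rfl <;> simp
  · simp only [← map_mul, h3, map_sub]

theorem AraRel.mem_prime {R J : Type*} [CommRing R] [Fintype J] {c : J → R} {wt : J → ℕ}
    (h : AraRel c wt) (P : Ideal R) [hP : P.IsPrime]
    (hw : ∀ k, (∑ j with wt j = k, c j) ∈ P) (j : J) : c j ∈ P := by
  classical
  induction hk : wt j using Nat.strong_induction_on generalizing j with
  | _ k ih =>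
  have h1 : c j * (∑ i with wt i = k, c i) ∈ P := P.mul_mem_left _ (hw k)
  have hj : j ∈ Finset.univ.filter (fun i => wt i = k) := by simp [hk]
  rw [← Finset.add_sum_erase _ _ hj, mul_add] at h1
  have h2 : c j * (∑ i ∈ (Finset.univ.filter (fun i => wt i = k)).erase j, c i) ∈ P := by
    rw [Finset.mul_sum]
    refine P.sum_mem fun i hi => ?_
    simp only [Finset.mem_erase, Finset.mem_filter, Finset.mem_univ, true_and] at hi
    obtain ⟨a, b, a', b', s, hs, h1, h2, h3⟩ := h j i (Ne.symm hi.1) (by rw [hk, hi.2])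
    rw [h3]
    exact P.sub_mem (P.mul_mem_right _ (ih _ (hk ▸ h1) a rfl))
      (P.mul_mem_left _ (P.mul_mem_right _ (ih _ (hk ▸ h2) a' rfl)))
  have h3 := (P.add_mem_iff_left h2).mp h1
  exact (hP.mem_or_mem h3).elim id id

theorem AraRel.mem_val {Ω J : Type*} [Field Ω] [Finite J] {c : J → Ω} {wt : J → ℕ}
    (h : AraRel c wt) (V : ValuationSubring Ω)
    (hw : ∀ k, ∀ s : Finset J, (∀ j, j ∈ s ↔ wt j = k) → (∑ j ∈ s, c j) ∈ V) (j : J) :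
    c j ∈ V := by
  classical
  have : Fintype J := Fintype.ofFinite J
  let v := V.valuation
  have : Nonempty J := ⟨j⟩
  obtain ⟨jm, hjm⟩ := Finite.exists_max (fun j => v (c j))
  obtain ⟨j0, hj0, hmin⟩ := Finset.exists_min_image
    (Finset.univ.filter fun j => v (c j) = v (c jm)) wt ⟨jm, by simp⟩
  simp only [Finset.mem_filter, Finset.mem_univ, true_and] at hj0 hmin
  rw [← V.valuation_le_one_iff]
  refine (hjm j).trans ?_
  change v (c jm) ≤ 1
  rw [← hj0]
  by_cases h0 : v (c j0) = 0
  · rw [h0]; exact zero_le_one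
  have hM : ∀ i, v (c i) ≤ v (c j0) := fun i => by rw [hj0]; exact hjm i
  have hlt : ∀ i, wt i < wt j0 → v (c i) < v (c j0) := by
    intro i hi
    refine lt_of_le_of_ne (hM i) fun he => ?_
    have := hmin i (by rw [he, hj0])
    omega
  have hpos : 0 < v (c j0) := zero_lt_iff.mpr h0
  have hother : ∀ i, i ≠ j0 → wt i = wt j0 → v (c i) < v (c j0) := by
    intro i hi hwi
    obtain ⟨a, b, a', b', s, hs, h1, h2, h3⟩ := h j0 i (Ne.symm hi) hwi.symm
    have hs1 : v s ≤ 1 := by rcases hs with rfl | rfl <;> simp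
    have key : v (c j0) * v (c i) < v (c j0) * v (c j0) := by
      rw [← map_mul, h3]
      refine lt_of_le_of_lt (v.map_sub _ _) (max_lt ?_ ?_)
      · rw [map_mul]
        exact mul_lt_mul_of_lt_of_le_of_nonneg_of_pos (hlt a h1) (hM b) zero_le hpos
      · rw [map_mul, map_mul]
        refine lt_of_le_of_lt (mul_le_of_le_one_left zero_le hs1) ?_
        exact mul_lt_mul_of_lt_of_le_of_nonneg_of_pos (hlt a' h2) (hM b') zero_le hpos
    exact lt_of_mul_lt_mul_left key zero_le
  have hsum := hw (wt j0) (Finset.univ.filter fun i => wt i = wt j0) (by simp)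
  rw [← V.valuation_le_one_iff, ← Finset.add_sum_erase _ _
    (show j0 ∈ Finset.univ.filter fun i => wt i = wt j0 by simp)] at hsum
  have h4 : v (∑ x ∈ (Finset.univ.filter fun i => wt i = wt j0).erase j0, c x) < v (c j0) := by
    apply v.map_sum_lt h0
    intro i hi
    simp only [Finset.mem_erase, Finset.mem_filter, Finset.mem_univ, true_and] at hi
    exact hother i hi.1 hi.2
  have h5 := v.map_add_eq_of_lt_left h4
  change v _ ≤ 1 at hsum
  rw [h5] at hsum
  exact hsum

end RelationLemmas

section Segre

/-- products `z_i x_j`. -/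
def segC (O α : Type*) [CommRing O] (P Q : ℕ) (ij : Fin (P + 1) × Fin (Q + 1)) :
    MvPolynomial (α ⊕ (Fin (P + 1) ⊕ Fin (Q + 1))) O :=
  X (Sum.inr (Sum.inl ij.1)) * X (Sum.inr (Sum.inr ij.2))

/-- weight. -/
def segWt (P Q : ℕ) (ij : Fin (P + 1) × Fin (Q + 1)) : ℕ := ij.1 + ij.2

/-- generators. -/
def segG (O α : Type*) [CommRing O] (P Q : ℕ) :
    α ⊕ Fin (P + Q + 1) → MvPolynomial (α ⊕ (Fin (P + 1) ⊕ Fin (Q + 1))) O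
  | Sum.inl a => X (Sum.inl a)
  | Sum.inr k => ∑ ij with segWt P Q ij = k, segC O α P Q ij

theorem segRel (O α : Type*) [CommRing O] (P Q : ℕ) : AraRel (segC O α P Q) (segWt P Q) := by
  have main : ∀ j j' : Fin (P + 1) × Fin (Q + 1), j.1 < j'.1 → segWt P Q j = segWt P Q j' →
      segWt P Q (j.1, j'.2) < segWt P Q j := by
    intro j j' h hw
    simp only [segWt, Fin.lt_def] at *
    omega
  intro j j' hne hw
  rcases lt_trichotomy j.1 j'.1 with h | h | h
  · refine ⟨(j.1, j'.2), (j'.1, j.2), (j.1, j'.2), j, 0, Or.inl rfl, main j j' h hw,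
      main j j' h hw, ?_⟩
    simp only [segC]; ring
  · exfalso
    apply hne
    refine Prod.ext h (Fin.ext ?_)
    simp only [segWt] at hw
    rw [h] at hw
    omega
  · refine ⟨(j'.1, j.2), (j.1, j'.2), (j'.1, j.2), j, 0, Or.inl rfl, hw ▸ main j' j h hw.symm,
      hw ▸ main j' j h hw.symm, ?_⟩
    simp only [segC]; ring

theorem seg_map {O O' : Type*} (α : Type*) [CommRing O] [CommRing O'] (P Q : ℕ) (φ : O →+* O')
    (k : α ⊕ Fin (P + Q + 1)) : map φ (segG O α P Q k) = segG O' α P Q k := by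
  rcases k with a | k <;> simp [segG, segC, map_sum]

theorem seg_sum_mem {O α M : Type*} [CommRing O] {P Q : ℕ} [AddCommMonoid M]
    (f : MvPolynomial (α ⊕ (Fin (P + 1) ⊕ Fin (Q + 1))) O →+ M) (S : AddSubmonoid M)
    (h : ∀ k, f (segG O α P Q k) ∈ S) (k : ℕ)
    (s : Finset (Fin (P + 1) × Fin (Q + 1))) (hs : ∀ j, j ∈ s ↔ segWt P Q j = k) :
    f (∑ j ∈ s, segC O α P Q j) ∈ S := by
  by_cases hk : k < P + Q + 1
  · have := h (Sum.inr ⟨k, hk⟩)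
    have e : s = Finset.univ.filter fun j => segWt P Q j = k := by ext; simp [hs]
    rw [e]
    exact this
  · have e : s = ∅ := by
      ext j
      rw [hs]
      have := j.1.2
      have := j.2.2
      simp only [segWt, Finset.notMem_empty, iff_false]
      omega
    simp [e, S.zero_mem]

open Classical in
/-- projection to balanced monomials. -/
def segProj (O α : Type*) [CommRing O] (P Q : ℕ) :
    MvPolynomial (α ⊕ (Fin (P + 1) ⊕ Fin (Q + 1))) O →ₗ[O]
      MvPolynomial (α ⊕ (Fin (P + 1) ⊕ Fin (Q + 1))) O :=
  (basisMonomials _ O).constr O fun s =>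
    if ∑ i, s (Sum.inr (Sum.inl i)) = ∑ j, s (Sum.inr (Sum.inr j)) then monomial s 1 else 0

theorem segProj_monomial (O α : Type*) [CommRing O] (P Q : ℕ) (s) (a : O) :
    segProj O α P Q (monomial s a) =
      if ∑ i, s (Sum.inr (Sum.inl i)) = ∑ j, s (Sum.inr (Sum.inr j)) then monomial s a else 0 := by
  have h1 : monomial s a = a • basisMonomials _ O s := by
    simp [smul_monomial]
  rw [h1, map_smul, segProj, Module.Basis.constr_basis]
  split_ifs
  · simp
  · simp

theorem segProj_mul (O α : Type*) [CommRing O] (P Q : ℕ) (s)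
    (hs : ∑ i, s (Sum.inr (Sum.inl i)) = ∑ j, s (Sum.inr (Sum.inr j))) (f) :
    segProj O α P Q (monomial s 1 * f) = monomial s 1 * segProj O α P Q f := by
  induction f using MvPolynomial.induction_on' with
  | add p q hp hq => rw [mul_add, map_add, map_add, hp, hq, mul_add]
  | monomial t a =>
    rw [monomial_mul, segProj_monomial, segProj_monomial]
    simp only [Finsupp.add_apply, Finset.sum_add_distrib, hs, add_right_inj]
    split_ifs
    · rw [monomial_mul]
    · rw [mul_zero]

theorem segC_eq (O α : Type*) [CommRing O] (P Q : ℕ) (ij) :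
    segC O α P Q ij = monomial (Finsupp.single (Sum.inr (Sum.inl ij.1)) 1 +
      Finsupp.single (Sum.inr (Sum.inr ij.2)) 1) 1 := by
  simp [segC, X, monomial_mul]

theorem segProj_g (O α : Type*) [CommRing O] (P Q : ℕ) (k) (f) :
    segProj O α P Q (segG O α P Q k * f) = segG O α P Q k * segProj O α P Q f := by
  classical
  rcases k with a | k
  · simp only [segG]
    exact segProj_mul O α P Q (Finsupp.single (Sum.inl a) 1) (by simp) f
  · simp only [segG, Finset.sum_mul, map_sum]
    refine Finset.sum_congr rfl fun ij _ => ?_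
    rw [segC_eq]
    apply segProj_mul
    simp [Finset.sum_add_distrib, Finsupp.single_apply]

theorem segProj_mem {O α Ω : Type*} [CommRing O] [CommRing Ω] {P Q : ℕ}
    (f : MvPolynomial (α ⊕ (Fin (P + 1) ⊕ Fin (Q + 1))) O →+* Ω) (S : Subring Ω)
    (hC : ∀ a, f (C a) ∈ S) (ha : ∀ a, f (X (Sum.inl a)) ∈ S)
    (hc : ∀ ij, f (segC O α P Q ij) ∈ S) (p) : f (segProj O α P Q p) ∈ S := by
  classical
  have key : ∀ N : ℕ, ∀ s : (α ⊕ (Fin (P + 1) ⊕ Fin (Q + 1))) →₀ ℕ,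
      ∑ i, s (Sum.inr (Sum.inl i)) = N → ∑ j, s (Sum.inr (Sum.inr j)) = N →
      f (monomial s 1) ∈ S := by
    intro N
    induction N with
    | zero =>
      intro s h1 h2
      rw [monomial_eq, map_one, one_mul, Finsupp.prod, map_prod]
      refine S.prod_mem fun v hv => ?_
      rw [map_pow]
      rw [Finset.sum_eq_zero_iff] at h1 h2
      rcases v with a | i | j
      · exact S.pow_mem (ha a) _
      · simp [h1 i] at hv
      · simp [h2 j] at hv
    | succ N ih =>
      intro s h1 h2
      obtain ⟨i, -, hi⟩ : ∃ i ∈ Finset.univ, s (Sum.inr (Sum.inl i)) ≠ 0 := by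
        apply Finset.exists_ne_zero_of_sum_ne_zero; omega
      obtain ⟨j, -, hj⟩ : ∃ j ∈ Finset.univ, s (Sum.inr (Sum.inr j)) ≠ 0 := by
        apply Finset.exists_ne_zero_of_sum_ne_zero; omega
      let e : (α ⊕ (Fin (P + 1) ⊕ Fin (Q + 1))) →₀ ℕ := Finsupp.single (Sum.inr (Sum.inl i)) 1 +
        Finsupp.single (Sum.inr (Sum.inr j)) 1
      have hle : e ≤ s := by
        intro v
        rcases v with a | i' | j'
        · simp [e]
        · by_cases h : i = i'
          · subst h; simp [e]; omega
          · simp [e, h]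
        · by_cases h : j = j'
          · subst h; simp [e]; omega
          · simp [e, h]
      have hs : s = e + (s - e) := (add_tsub_cancel_of_le hle).symm
      set s' := s - e
      have h3 : monomial s (1 : O) = segC O α P Q (i, j) * monomial s' 1 := by
        rw [segC_eq, monomial_mul, one_mul, hs]
      rw [h3, map_mul]
      refine S.mul_mem (hc _) (ih s' ?_ ?_)
      · rw [hs] at h1
        simp [e, Finset.sum_add_distrib, Finsupp.single_apply] at h1
        omega
      · rw [hs] at h2
        simp [e, Finset.sum_add_distrib, Finsupp.single_apply] at h2
        omega
  induction p using MvPolynomial.induction_on' with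
  | add p q hp hq => rw [map_add, map_add]; exact S.add_mem hp hq
  | monomial t a =>
    rw [segProj_monomial]
    split_ifs with h
    · have : monomial t a = C a * monomial t 1 := by rw [C_mul_monomial, mul_one]
      rw [this, map_mul]
      exact S.mul_mem (hC a) (key _ t rfl h.symm)
    · rw [map_zero]; exact S.zero_mem

/-- The t-family. -/
def segT (O α : Type*) [CommRing O] (P Q : ℕ) :
    α ⊕ (Fin (P + 1) × Fin (Q + 1)) → MvPolynomial (α ⊕ (Fin (P + 1) ⊕ Fin (Q + 1))) O
  | Sum.inl a => X (Sum.inl a)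
  | Sum.inr ij => segC O α P Q ij

theorem segT_val {O α : Type*} [CommRing O] [IsDomain O] {P Q : ℕ} (i)
    (V : ValuationSubring (FractionRing (MvPolynomial (α ⊕ (Fin (P + 1) ⊕ Fin (Q + 1))) O)))
    (hV : ∀ k, algebraMap _ _ (segG O α P Q k) ∈ V) : algebraMap _ _ (segT O α P Q i) ∈ V := by
  rcases i with a | ij
  · exact hV (Sum.inl a)
  · refine ((segRel O α P Q).map (algebraMap _ _)).mem_val V ?_ ij
    intro k s hs
    have := seg_sum_mem (algebraMap _ (FractionRing
      (MvPolynomial (α ⊕ (Fin (P + 1) ⊕ Fin (Q + 1))) O))).toAddMonoidHom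
      V.toSubring.toAddSubmonoid hV k s hs
    simp only [RingHom.toAddMonoidHom_eq_coe, map_sum] at this
    exact this

/-- The Segre data. -/
def segData (O α : Type*) [CommRing O] [IsDomain O] [Fintype α] (P Q : ℕ) :
    AraData O (α ⊕ (Fin (P + 1) ⊕ Fin (Q + 1))) (α ⊕ Fin (P + Q + 1)) Unit
      (α ⊕ (Fin (P + 1) × Fin (Q + 1))) where
  g := segG O α P Q
  e := fun _ => X (Sum.inr (Sum.inl 0))
  t := segT O α P Q
  d := Sum.elim (fun _ => 1) (fun _ => 2)
  hd := by
    rintro (a | k)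
    · exact isHomogeneous_X _ _
    · exact IsHomogeneous.sum _ _ _ fun ij _ => (isHomogeneous_X _ _).mul (isHomogeneous_X _ _)
  hcard := by simp; omega
  ht := fun i V _ hV => segT_val i V hV
  hX := by
    intro L _ ht he v
    have hz : ∀ v : α ⊕ (Fin (P + 1) ⊕ Fin (Q + 1)), algebraMap _ (FractionRing
      (MvPolynomial (α ⊕ (Fin (P + 1) ⊕ Fin (Q + 1))) O)) (X v : MvPolynomial _ O) ≠ 0 := fun v =>
      (map_ne_zero_iff _ (IsFractionRing.injective
        (MvPolynomial (α ⊕ (Fin (P + 1) ⊕ Fin (Q + 1))) O) _)).mpr (X_ne_zero v)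
    have hx : ∀ j, algebraMap _ (FractionRing
      (MvPolynomial (α ⊕ (Fin (P + 1) ⊕ Fin (Q + 1))) O))
      (X (Sum.inr (Sum.inr j)) : MvPolynomial (α ⊕ (Fin (P + 1) ⊕ Fin (Q + 1))) O) ∈ L := by
      intro j
      have h1 := L.div_mem (ht (Sum.inr (0, j))) (he ())
      simp only [segT, segC, map_mul] at h1
      rwa [mul_div_cancel_left₀ _ (hz _)] at h1
    rcases v with a | i | j
    · exact ht (Sum.inl a)
    · have h1 := L.div_mem (ht (Sum.inr (i, 0))) (hx 0)
      simp only [segT, segC, map_mul] at h1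
      rwa [mul_div_cancel_right₀ _ (hz _)] at h1
    · exact hx j
  ρ := fun D => (araL D : O) • ((Algebra.linearMap _ _).restrictScalars O ∘ₗ segProj O α P Q)
  hρg := by
    intro D k f
    simp only [LinearMap.smul_apply, LinearMap.comp_apply, segProj_g]
    simp [Algebra.smul_def]
    ring
  hρ1 := by
    intro D
    have : segProj O α P Q 1 = 1 := by
      rw [show (1 : MvPolynomial (α ⊕ (Fin (P + 1) ⊕ Fin (Q + 1))) O) = monomial 0 1 from rfl,
        segProj_monomial]
      simp
    simp [this, Algebra.smul_def]
  hρV := by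
    intro D f _ V hO hV
    simp only [LinearMap.smul_apply, LinearMap.comp_apply, Algebra.smul_def]
    refine V.mul_mem _ _ (hO _) ?_
    exact segProj_mem (algebraMap _ _) V.toSubring (fun a => hO a)
      (fun a => segT_val (Sum.inl a) V hV) (fun ij => segT_val (Sum.inr ij) V hV) f
  hρL := by
    intro D f _ L hO hL
    simp only [LinearMap.smul_apply, LinearMap.comp_apply, Algebra.smul_def]
    refine L.mul_mem (hO _) ?_
    exact segProj_mem (algebraMap _ _) L.toSubring (fun a => hO a)
      (fun a => hL (Sum.inl a)) (fun ij => hL (Sum.inr ij)) f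

end Segre

section Haar

/-- beta numbers -/
def hBeta (F : Type*) [Field F] (i j : ℕ) : F :=
  (i.factorial * j.factorial : ℕ) / ((i + j + 1).factorial : ℕ)

theorem hBeta_rec (F : Type*) [Field F] [CharZero F] (i j : ℕ) :
    hBeta F (i + 1) j + hBeta F i (j + 1) = hBeta F i j := by
  unfold hBeta
  have h1 : (i + 1 + j + 1).factorial = (i + j + 2) * (i + j + 1).factorial := by
    rw [show i + 1 + j + 1 = (i + j + 1) + 1 by ring, Nat.factorial_succ]
  have h2 : (i + (j + 1) + 1).factorial = (i + j + 2) * (i + j + 1).factorial := by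
    rw [show i + (j + 1) + 1 = (i + j + 1) + 1 by ring, Nat.factorial_succ]
  rw [h1, h2, Nat.factorial_succ i, Nat.factorial_succ j]
  have h3 : ((i + j + 1).factorial : F) ≠ 0 := by exact_mod_cast Nat.factorial_ne_zero _
  have h4 : (i + j + 2 : F) ≠ 0 := by exact_mod_cast (Nat.succ_ne_zero (i + j + 1))
  push_cast
  field_simp
  ring

theorem hBeta_int (F : Type*) [Field F] [CharZero F] (D i j : ℕ) (h : i + j ≤ D) :
    ∃ z : ℤ, (araL D : F) * hBeta F i j = z := by
  induction i generalizing j with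
  | zero =>
    obtain ⟨q, hq⟩ := dvd_araL (D := D) (i := j + 1) (by omega) (by omega)
    refine ⟨q, ?_⟩
    rw [hq, hBeta]
    have h3 : (j.factorial : F) ≠ 0 := by exact_mod_cast Nat.factorial_ne_zero _
    have h4 : (j + 1 : F) ≠ 0 := by exact_mod_cast (Nat.succ_ne_zero j)
    rw [zero_add, Nat.factorial_succ]
    push_cast
    simp only [Nat.factorial_zero, Nat.cast_one]
    field_simp
  | succ i ih =>
    obtain ⟨z1, h1⟩ := ih j (by omega)
    obtain ⟨z2, h2⟩ := ih (j + 1) (by omega)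
    refine ⟨z1 - z2, ?_⟩
    rw [← hBeta_rec F i j, mul_add, h2] at h1
    push_cast
    rw [← h1]; ring

/-- Haar functional value. -/
def hVal (F : Type*) [Field F] (i j k l : ℕ) : F :=
  if i = l ∧ j = k then (-1) ^ j * hBeta F i j else 0

/-- Haar functional. -/
def hH (F : Type*) [Field F] : MvPolynomial (Fin 4) F →ₗ[F] F :=
  (basisMonomials (Fin 4) F).constr F fun s => hVal F (s 0) (s 1) (s 2) (s 3)

theorem hH_monomial {F : Type*} [Field F] (s : Fin 4 →₀ ℕ) (a : F) :
    hH F (monomial s a) = a * hVal F (s 0) (s 1) (s 2) (s 3) := by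
  have h1 : monomial s a = a • basisMonomials _ F s := by
    simp [smul_monomial]
  rw [h1, map_smul, hH, Module.Basis.constr_basis, smul_eq_mul]

theorem hMono {F : Type*} [Field F] (s : Fin 4 →₀ ℕ) :
    monomial s (1 : F) = X 0 ^ s 0 * X 1 ^ s 1 * X 2 ^ s 2 * X 3 ^ s 3 := by
  rw [monomial_eq, Finsupp.prod_fintype _ _ (by simp), Fin.prod_univ_four]
  simp

theorem hH_apply {F : Type*} [Field F] (i j k l : ℕ) :
    hH F (X 0 ^ i * X 1 ^ j * X 2 ^ k * X 3 ^ l) = hVal F i j k l := by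
  have h := hMono (F := F) (Finsupp.equivFunOnFinite.symm ![i, j, k, l])
  simp only [Finsupp.coe_equivFunOnFinite_symm, Matrix.cons_val] at h
  rw [← h, hH_monomial]
  simp

theorem hH_C {F : Type*} [Field F] (c : F) (u : MvPolynomial (Fin 4) F) :
    hH F (C c * u) = c * hH F u := by
  rw [← smul_eq_C_mul, map_smul, smul_eq_mul]

theorem hH_ext {F : Type*} [Field F] (A : MvPolynomial (Fin 4) F →ₗ[F] MvPolynomial (Fin 4) F)
    (h : ∀ i j k l : ℕ, hH F (A (X 0 ^ i * X 1 ^ j * X 2 ^ k * X 3 ^ l)) = hVal F i j k l) (u) :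
    hH F (A u) = hH F u := by
  have : hH F ∘ₗ A = hH F := by
    apply (basisMonomials (Fin 4) F).ext
    intro s
    simp only [coe_basisMonomials]
    rw [hMono, hH_apply]
    exact h _ _ _ _
  exact congrArg (fun f : MvPolynomial (Fin 4) F →ₗ[F] F => f u) this

theorem hH_extA {F : Type*} [Field F] (v : Fin 4 → MvPolynomial (Fin 4) F)
    (h : ∀ i j k l : ℕ, hH F (v 0 ^ i * v 1 ^ j * v 2 ^ k * v 3 ^ l) = hVal F i j k l) (u) :
    hH F (aeval v u) = hH F u := by
  refine hH_ext (aeval v : MvPolynomial (Fin 4) F →ₐ[F] _).toLinearMap ?_ u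
  intro i j k l
  rw [← h]
  simp only [AlgHom.toLinearMap_apply, map_mul, map_pow, aeval_X]

theorem hH_det {F : Type*} [Field F] [CharZero F] (u : MvPolynomial (Fin 4) F) :
    hH F ((X 0 * X 3 - X 1 * X 2) * u) = hH F u := by
  refine hH_ext (LinearMap.mulLeft F (X 0 * X 3 - X 1 * X 2)) ?_ u
  intro i j k l
  rw [LinearMap.mulLeft_apply]
  have : (X 0 * X 3 - X 1 * X 2) * (X 0 ^ i * X 1 ^ j * X 2 ^ k * X 3 ^ l) =
    X 0 ^ (i + 1) * X 1 ^ j * X 2 ^ k * X 3 ^ (l + 1) -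
    (X 0 ^ i * X 1 ^ (j + 1) * X 2 ^ (k + 1) * X 3 ^ l : MvPolynomial (Fin 4) F) := by ring
  rw [this, map_sub, hH_apply, hH_apply]
  simp only [hVal, add_left_inj]
  split_ifs
  · rw [← hBeta_rec F i j]; ring
  · ring

theorem hH_torus {F : Type*} [Field F] (t : F) (ht : t ≠ 0) (u : MvPolynomial (Fin 4) F) :
    hH F (aeval ![C t * X 0, C t⁻¹ * X 1, C t * X 2, C t⁻¹ * X 3] u) = hH F u := by
  refine hH_extA _ ?_ u
  intro i j k l
  simp only [Matrix.cons_val]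
  have : (C t * X 0) ^ i * (C t⁻¹ * X 1) ^ j * (C t * X 2) ^ k * (C t⁻¹ * X 3) ^ l =
    C (t ^ i * t⁻¹ ^ j * t ^ k * t⁻¹ ^ l) *
      (X 0 ^ i * X 1 ^ j * X 2 ^ k * X 3 ^ l : MvPolynomial (Fin 4) F) := by
    simp only [map_mul, map_pow]; ring
  rw [this, hH_C, hH_apply]
  simp only [hVal]
  split_ifs with h
  · obtain ⟨rfl, rfl⟩ := h
    have : t ^ i * t⁻¹ ^ j * t ^ j * t⁻¹ ^ i = 1 := by
      rw [inv_pow, inv_pow]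
      have := pow_ne_zero i ht
      have := pow_ne_zero j ht
      field_simp
    rw [this, one_mul]
  · rw [mul_zero]

theorem hH_w {F : Type*} [Field F] (u : MvPolynomial (Fin 4) F) :
    hH F (aeval ![-X 1, X 0, -X 3, X 2] u) = hH F u := by
  refine hH_extA _ ?_ u
  intro i j k l
  simp only [Matrix.cons_val]
  have : (-X 1) ^ i * X 0 ^ j * (-X 3) ^ k * X 2 ^ l =
    C ((-1) ^ (i + k)) *
      (X 0 ^ j * X 1 ^ i * X 2 ^ l * X 3 ^ k : MvPolynomial (Fin 4) F) := by
    rw [neg_pow (X 1 : MvPolynomial (Fin 4) F), neg_pow (X 3 : MvPolynomial (Fin 4) F), pow_add]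
    simp only [map_mul, map_pow, map_neg, map_one]; ring
  rw [this, hH_C, hH_apply]
  simp only [hVal]
  by_cases h : i = l ∧ j = k
  · obtain ⟨rfl, rfl⟩ := h
    simp only [and_self, if_true]
    rw [pow_add, hBeta, hBeta, add_comm j i, mul_comm j.factorial]
    have : ((-1 : F) ^ i) * (-1) ^ i = 1 := by rw [← mul_pow]; simp
    linear_combination ((-1) ^ j * (((i.factorial * j.factorial : ℕ) : F) / ((i + j + 1).factorial : ℕ))) * this
  · rw [if_neg h, if_neg (by tauto), mul_zero]

theorem hH_shear {F : Type*} [Field F] [CharZero F] (t : F) (u : MvPolynomial (Fin 4) F) :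
    hH F (aeval ![X 0, X 1 + C t * X 0, X 2, X 3 + C t * X 2] u) = hH F u := by
  refine hH_extA _ ?_ u
  intro i j k l
  simp only [Matrix.cons_val]
  have : X 0 ^ i * (X 1 + C t * X 0) ^ j * X 2 ^ k * (X 3 + C t * X 2) ^ l =
    ∑ p ∈ Finset.range (j + 1), ∑ q ∈ Finset.range (l + 1),
      C (t ^ p * t ^ q * j.choose p * l.choose q) * (X 0 ^ (i + p) * X 1 ^ (j - p) *
        X 2 ^ (k + q) * X 3 ^ (l - q) : MvPolynomial (Fin 4) F) := by
    rw [add_comm (X 1), add_comm (X 3), add_pow, add_pow]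
    rw [mul_assoc (X 0 ^ i), mul_comm _ (X 2 ^ k), ← mul_assoc, mul_assoc, Finset.sum_mul_sum,
      Finset.mul_sum]
    refine Finset.sum_congr rfl fun p _ => ?_
    rw [Finset.mul_sum]
    refine Finset.sum_congr rfl fun q _ => ?_
    simp only [map_mul, map_pow, map_natCast]
    ring
  rw [this]
  simp only [map_sum, hH_C, hH_apply]
  by_cases hm : ∃ m, l = i + m ∧ j = k + m
  swap
  · rw [hVal, if_neg (fun h => hm ⟨0, by omega, by omega⟩)]
    refine Finset.sum_eq_zero fun p hp => Finset.sum_eq_zero fun q hq => ?_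
    simp only [Finset.mem_range] at hp hq
    rw [hVal, if_neg, mul_zero]
    intro h
    exact hm ⟨p + q, by omega, by omega⟩
  obtain ⟨m, rfl, rfl⟩ := hm
  rcases Nat.eq_zero_or_pos m with rfl | hm
  · rw [Finset.sum_eq_single 0, Finset.sum_eq_single 0]
    · simp
    · intro q _ hq
      rw [hVal, if_neg (by omega), mul_zero]
    · simp
    · intro p _ hp
      refine Finset.sum_eq_zero fun q _ => ?_
      rw [hVal, if_neg (by omega), mul_zero]
    · simp
  · rw [hVal, if_neg (by omega)]
    have h1 : ∀ p ∈ Finset.range (k + m + 1), (∑ q ∈ Finset.range (i + m + 1),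
        t ^ p * t ^ q * ((k + m).choose p : F) * ((i + m).choose q : F) *
          hVal F (i + p) (k + m - p) (k + q) (i + m - q)) =
        if p ≤ m then (t ^ m * (-1) ^ (k + m) * (k + m).factorial * (i + m).factorial /
          (m.factorial * (i + k + m + 1).factorial)) * ((-1) ^ p * (m.choose p : F)) else 0 := by
      intro p hp
      split_ifs with hpm
      · obtain ⟨q, rfl⟩ := Nat.exists_eq_add_of_le hpm
        rw [Finset.sum_eq_single q]
        · rw [hVal, if_pos (by omega), hBeta]
          rw [show k + (p + q) - p = k + q by omega]
          rw [show i + p + (k + q) + 1 = i + k + (p + q) + 1 by omega]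
          rw [show k + (p + q) = (k + q) + p by omega, show i + (p + q) = (i + p) + q by omega]
          rw [Nat.cast_choose F (show p ≤ k + q + p by omega),
            Nat.cast_choose F (show q ≤ i + p + q by omega),
            Nat.cast_choose F (show p ≤ p + q by omega)]
          rw [show k + q + p - p = k + q by omega, show i + p + q - q = i + p by omega,
            show p + q - p = q by omega]
          have hf : ∀ n : ℕ, (n.factorial : F) ≠ 0 := fun n => by
            exact_mod_cast Nat.factorial_ne_zero _
          have := hf p
          have := hf q
          have := hf (p + q)
          have := hf (k + q)
          have := hf (i + p)
          have := hf (i + k + (p + q) + 1)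
          have hs : (-1 : F) ^ (k + q + p) * (-1) ^ p = (-1) ^ (k + q) := by
            rw [pow_add, mul_assoc, ← mul_pow]; simp
          rw [← hs, pow_add t p q]
          push_cast
          field_simp
        · intro q' _ hq'
          rw [hVal, if_neg (by omega), mul_zero]
        · intro h
          simp at h
          omega
      · refine Finset.sum_eq_zero fun q _ => ?_
        rw [hVal, if_neg (by omega), mul_zero]
    rw [Finset.sum_congr rfl h1, ← Finset.sum_filter]
    have h2 : (Finset.range (k + m + 1)).filter (fun p => p ≤ m) = Finset.range (m + 1) := by
      ext p; simp; omega
    rw [h2, ← Finset.mul_sum]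
    have h3 := Int.alternating_sum_range_choose_of_ne (n := m) (by omega)
    have h4 : (∑ p ∈ Finset.range (m + 1), (-1 : F) ^ p * (m.choose p : F)) = 0 := by
      exact_mod_cast congrArg (Int.cast : ℤ → F) h3
    rw [h4, mul_zero]

end Haar

section HSub

variable {O F N : Type*} [CommRing O] [Field F] [Algebra O F]

/-- substitution by a generic 2x2 matrix. -/
def hSub (O : Type*) [CommRing O] [Algebra O F] (x y : N → F) :
    MvPolynomial (N ⊕ N) O →ₐ[O] MvPolynomial (Fin 4) F :=
  aeval (Sum.elim (fun k => C (x k) * X 0 + C (y k) * X 1)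
    (fun k => C (x k) * X 2 + C (y k) * X 3))

theorem hSub_comp (x y x' y' : N → F) (v : Fin 4 → MvPolynomial (Fin 4) F)
    (h1 : ∀ k, C (x k) * v 0 + C (y k) * v 1 = C (x' k) * X 0 + C (y' k) * X 1)
    (h2 : ∀ k, C (x k) * v 2 + C (y k) * v 3 = C (x' k) * X 2 + C (y' k) * X 3)
    (h : MvPolynomial (N ⊕ N) O) : hSub O x' y' h = aeval v (hSub O x y h) := by
  have : hSub O x' y' = ((aeval v : _ →ₐ[F] MvPolynomial (Fin 4) F).restrictScalars O).comp
      (hSub O x y) := by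
    apply MvPolynomial.algHom_ext
    rintro (k | k)
    · simp [hSub, ← h1, algebraMap_eq]
    · simp [hSub, ← h2, algebraMap_eq]
  rw [this]; rfl

theorem hF_shear [CharZero F] (x y : N → F) (t : F) (h : MvPolynomial (N ⊕ N) O) :
    hH F (hSub O (fun k => x k + t * y k) y h) = hH F (hSub O x y h) := by
  rw [hSub_comp x y (fun k => x k + t * y k) y _ _ _ h, hH_shear t]
  · intro k; simp only [Matrix.cons_val, map_add, map_mul]; ring
  · intro k; simp only [Matrix.cons_val, map_add, map_mul]; ring

theorem hF_torus (x y : N → F) (t : F) (ht : t ≠ 0) (h : MvPolynomial (N ⊕ N) O) :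
    hH F (hSub O (fun k => t * x k) (fun k => t⁻¹ * y k) h) = hH F (hSub O x y h) := by
  rw [hSub_comp x y (fun k => t * x k) (fun k => t⁻¹ * y k) _ _ _ h, hH_torus t ht]
  · intro k; simp only [Matrix.cons_val, map_mul]; ring
  · intro k; simp only [Matrix.cons_val, map_mul]; ring

theorem hF_w (x y : N → F) (h : MvPolynomial (N ⊕ N) O) :
    hH F (hSub O y (fun k => - x k) h) = hH F (hSub O x y h) := by
  rw [hSub_comp x y y (fun k => - x k) _ _ _ h, hH_w]
  · intro k; simp only [Matrix.cons_val, map_neg]; ring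
  · intro k; simp only [Matrix.cons_val, map_neg]; ring

theorem hF_shear2 [CharZero F] (x y : N → F) (t : F) (h : MvPolynomial (N ⊕ N) O) :
    hH F (hSub O x (fun k => y k + t * x k) h) = hH F (hSub O x y h) := by
  have e : (fun k => y k + t * x k) = fun k => y k + (-t) * (- x k) := by funext k; ring
  rw [← hF_w, ← hF_w x y, ← hF_shear y (fun k => - x k) (-t), e]

theorem hF_inv [CharZero F] (x y : N → F) (i j : N) (hy : y j ≠ 0)
    (hD : x i * y j - x j * y i ≠ 0) (h : MvPolynomial (N ⊕ N) O) :
    hH F (hSub O x y h) = hH F (hSub O (fun k => x k * y j - x j * y k)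
      (fun k => (x i * y k - x k * y i) / (x i * y j - x j * y i)) h) := by
  have e1 : (fun k => x k * y j - x j * y k) =
      fun k => y j * x k + (- x j * y j) * ((y j)⁻¹ * y k) := by funext k; field_simp; ring
  have e2 : (fun k => (x i * y k - x k * y i) / (x i * y j - x j * y i)) =
      fun k => (y j)⁻¹ * y k + (-(y i) / (y j * (x i * y j - x j * y i))) *
        (y j * x k + (- x j * y j) * ((y j)⁻¹ * y k)) := by
    funext k
    obtain ⟨D, hD'⟩ : ∃ D, D = x i * y j - x j * y i := ⟨_, rfl⟩
    rw [← hD'] at hD ⊢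
    field_simp
    linear_combination (- y k) * hD'
  rw [← hF_torus x y (y j) hy, ← hF_shear _ _ (- x j * y j),
    ← hF_shear2 _ _ (-(y i) / (y j * (x i * y j - x j * y i))), e1, e2]

theorem hF_det [CharZero F] (x y : N → F) (p q : N) (h : MvPolynomial (N ⊕ N) O) :
    hH F (hSub O x y ((X (Sum.inl p) * X (Sum.inr q) - X (Sum.inl q) * X (Sum.inr p)) * h)) =
      (x p * y q - x q * y p) * hH F (hSub O x y h) := by
  rw [← hH_det (hSub O x y h), ← hH_C, map_mul]
  congr 1
  rw [← mul_assoc]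
  congr 1
  simp only [hSub, map_sub, map_mul, aeval_X, Sum.elim_inl, Sum.elim_inr]
  ring

theorem hSub_totalDegree (x y : N → F) (h : MvPolynomial (N ⊕ N) O) :
    (hSub O x y h).totalDegree ≤ h.totalDegree := by
  have hlin : ∀ (a b : F) (i j : Fin 4), (C a * X i + C b * X j).totalDegree ≤ 1 := by
    intro a b i j
    refine (totalDegree_add _ _).trans (max_le ?_ ?_) <;>
    · refine (totalDegree_mul _ _).trans ?_
      rw [totalDegree_C, totalDegree_X, zero_add]
  rw [hSub, aeval_def, eval₂_eq]
  refine totalDegree_finsetSum_le fun s hs => ?_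
  refine le_trans ?_ (le_totalDegree hs)
  refine (totalDegree_mul _ _).trans ?_
  rw [MvPolynomial.algebraMap_apply, totalDegree_C, zero_add]
  refine (totalDegree_finsetProd _ _).trans (Finset.sum_le_sum fun v _ => ?_)
  refine (totalDegree_pow _ _).trans ?_
  rcases v with k | k
  · exact (Nat.mul_le_mul_left _ (hlin _ _ _ _)).trans (by simp)
  · exact (Nat.mul_le_mul_left _ (hlin _ _ _ _)).trans (by simp)

theorem hSub_range (x y : N → F) (S : Subring F) (hO : ∀ a : O, algebraMap O F a ∈ S)
    (hx : ∀ k, x k ∈ S) (hy : ∀ k, y k ∈ S) (h : MvPolynomial (N ⊕ N) O) :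
    hSub O x y h ∈ (map (σ := Fin 4) S.subtype).range := by
  have hC : ∀ a ∈ S, C a ∈ (map (σ := Fin 4) S.subtype).range := fun a ha => ⟨C ⟨a, ha⟩, by simp⟩
  have hX : ∀ i, X i ∈ (map (σ := Fin 4) S.subtype).range := fun i => ⟨X i, by simp⟩
  induction h using MvPolynomial.induction_on with
  | C a =>
    rw [hSub, aeval_C, MvPolynomial.algebraMap_apply]
    exact hC _ (hO a)
  | add p q hp hq => rw [map_add]; exact Subring.add_mem _ hp hq
  | mul_X p v hp =>
    rw [map_mul]
    refine Subring.mul_mem _ hp ?_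
    rw [hSub, aeval_X]
    rcases v with k | k
    · exact Subring.add_mem _ (Subring.mul_mem _ (hC _ (hx k)) (hX _))
        (Subring.mul_mem _ (hC _ (hy k)) (hX _))
    · exact Subring.add_mem _ (Subring.mul_mem _ (hC _ (hx k)) (hX _))
        (Subring.mul_mem _ (hC _ (hy k)) (hX _))

theorem hF_mem [CharZero F] (x y : N → F) (S : Subring F) (hO : ∀ a : O, algebraMap O F a ∈ S)
    (hx : ∀ k, x k ∈ S) (hy : ∀ k, y k ∈ S) (D : ℕ) (h : MvPolynomial (N ⊕ N) O)
    (hD : h.totalDegree ≤ D) : (araL D : F) * hH F (hSub O x y h) ∈ S := by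
  have hd := (hSub_totalDegree x y h).trans hD
  obtain ⟨w, hw⟩ := hSub_range x y S hO hx hy h
  rw [(hSub O x y h).as_sum, map_sum, Finset.mul_sum]
  refine S.sum_mem fun s hs => ?_
  have hs' := (le_totalDegree hs).trans hd
  rw [Finsupp.sum_fintype _ _ (by simp), Fin.sum_univ_four] at hs'
  rw [hH_monomial, mul_left_comm]
  refine S.mul_mem ?_ ?_
  · rw [← hw, coeff_map]
    exact (coeff s w).2
  · rw [hVal]
    split_ifs
    · obtain ⟨z, hz⟩ := hBeta_int F D (s 0) (s 1) (by omega)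
      rw [mul_left_comm, hz]
      exact S.mul_mem (S.pow_mem (S.neg_mem S.one_mem) _) (intCast_mem S z)
    · simp [S.zero_mem]

end HSub

section Pluecker

/-- Index pairs. -/
abbrev PlJ (m : ℕ) := {p : Fin (m + 2) × Fin (m + 2) // p.1 < p.2}

/-- 2-minors. -/
def plD (O : Type*) [CommRing O] {N : Type*} (p q : N) : MvPolynomial (N ⊕ N) O :=
  X (Sum.inl p) * X (Sum.inr q) - X (Sum.inl q) * X (Sum.inr p)

/-- 2-minors for increasing pairs. -/
def plC (O : Type*) [CommRing O] (m : ℕ) (j : PlJ m) :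
    MvPolynomial (Fin (m + 2) ⊕ Fin (m + 2)) O := plD O j.1.1 j.1.2

/-- weight. -/
def plWt (m : ℕ) (j : PlJ m) : ℕ := j.1.1 + j.1.2

/-- generators. -/
def plG (O : Type*) [CommRing O] (m : ℕ) (k : Fin (2 * m + 1)) :
    MvPolynomial (Fin (m + 2) ⊕ Fin (m + 2)) O := ∑ j with plWt m j = k + 1, plC O m j

theorem plRel (O : Type*) [CommRing O] (m : ℕ) : AraRel (plC O m) (plWt m) := by
  have main : ∀ j j' : PlJ m, j.1.1 < j'.1.1 → plWt m j = plWt m j' →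
      ∃ a b a' b' : PlJ m, plWt m a < plWt m j ∧ plWt m a' < plWt m j ∧
        plC O m j * plC O m j' = plC O m a * plC O m b - 1 * (plC O m a' * plC O m b') := by
    rintro ⟨⟨i, j⟩, h1⟩ ⟨⟨i', j'⟩, h2⟩ h hw
    have h1' : (i : ℕ) < j := h1
    have h2' : (i' : ℕ) < j' := h2
    have h' : (i : ℕ) < i' := h
    have hw' : (i : ℕ) + j = i' + j' := hw
    simp only [plWt]
    refine ⟨⟨(i, j'), by simp only [Fin.lt_def]; omega⟩, ⟨(i', j), by simp only [Fin.lt_def]; omega⟩,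
      ⟨(i, i'), by simp only [Fin.lt_def]; omega⟩, ⟨(j', j), by simp only [Fin.lt_def]; omega⟩,
      by dsimp only; omega, by dsimp only; omega, ?_⟩
    simp only [plC, plD]
    ring
  intro j j' hne hw
  rcases lt_trichotomy j.1.1 j'.1.1 with h | h | h
  · obtain ⟨a, b, a', b', h1, h2, h3⟩ := main j j' h hw
    exact ⟨a, b, a', b', 1, Or.inr rfl, h1, h2, h3⟩
  · exfalso
    apply hne
    refine Subtype.ext (Prod.ext h (Fin.ext ?_))
    simp only [plWt] at hw
    rw [h] at hw
    omega
  · obtain ⟨a, b, a', b', h1, h2, h3⟩ := main j' j h hw.symm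
    exact ⟨a, b, a', b', 1, Or.inr rfl, hw ▸ h1, hw ▸ h2, by rw [mul_comm, h3]⟩

theorem pl_map {O O' : Type*} [CommRing O] [CommRing O'] (m : ℕ) (φ : O →+* O')
    (k) : map φ (plG O m k) = plG O' m k := by
  simp [plG, plC, plD, map_sum]

theorem pl_sum_mem {O M : Type*} [CommRing O] {m : ℕ} [AddCommMonoid M]
    (f : MvPolynomial (Fin (m + 2) ⊕ Fin (m + 2)) O →+ M) (S : AddSubmonoid M)
    (h : ∀ k, f (plG O m k) ∈ S) (k : ℕ)
    (s : Finset (PlJ m)) (hs : ∀ j, j ∈ s ↔ plWt m j = k) :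
    f (∑ j ∈ s, plC O m j) ∈ S := by
  by_cases hk : 1 ≤ k ∧ k < 2 * m + 2
  · have := h ⟨k - 1, by omega⟩
    have e : s = Finset.univ.filter fun j => plWt m j = k - 1 + 1 := by
      ext j; simp only [hs, Finset.mem_filter, Finset.mem_univ, true_and]; omega
    rw [e]
    exact this
  · have e : s = ∅ := by
      ext j
      rw [hs]
      have := j.2
      have := j.1.2.2
      simp only [plWt, Finset.notMem_empty, iff_false, Fin.lt_def] at *
      omega
    simp [e, S.zero_mem]

theorem plC_val {O : Type*} [CommRing O] [IsDomain O] {m : ℕ} (i)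
    (V : ValuationSubring (FractionRing (MvPolynomial (Fin (m + 2) ⊕ Fin (m + 2)) O)))
    (hV : ∀ k, algebraMap _ _ (plG O m k) ∈ V) : algebraMap _ _ (plC O m i) ∈ V := by
  refine ((plRel O m).map (algebraMap _ _)).mem_val V ?_ i
  intro k s hs
  have := pl_sum_mem (algebraMap _ (FractionRing
    (MvPolynomial (Fin (m + 2) ⊕ Fin (m + 2)) O))).toAddMonoidHom
    V.toSubring.toAddSubmonoid hV k s hs
  simp only [RingHom.toAddMonoidHom_eq_coe, map_sum] at this
  exact this

theorem plD_mem {O F : Type*} [CommRing O] [CommRing F] {m : ℕ}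
    (f : MvPolynomial (Fin (m + 2) ⊕ Fin (m + 2)) O →+* F) (S : Subring F)
    (h : ∀ j, f (plC O m j) ∈ S) (p q) : f (plD O p q) ∈ S := by
  rcases lt_trichotomy p q with hpq | hpq | hpq
  · exact h ⟨(p, q), hpq⟩
  · subst hpq
    simp [plD, S.zero_mem]
  · have := S.neg_mem (h ⟨(q, p), hpq⟩)
    rw [← map_neg] at this
    convert this using 2
    simp only [plC, plD]; ring

theorem plD_ne (O : Type*) [CommRing O] [IsDomain O] {N : Type*} (p q : N) (h : p ≠ q) :
    plD O p q ≠ 0 := by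
  intro h0
  classical
  have := congrArg (eval (Sum.elim (fun k => if k = p then 1 else 0)
    (fun k => if k = q then 1 else 0) : N ⊕ N → O)) h0
  simp [plD, h.symm] at this

theorem plρ_mem {O Ω : Type*} [CommRing O] [IsDomain O] {m : ℕ} [Field Ω] [CharZero Ω]
    [Algebra O Ω] (f : MvPolynomial (Fin (m + 2) ⊕ Fin (m + 2)) O →+* Ω)
    (hf : Function.Injective f)
    (S : Subring Ω) (hO : ∀ a : O, algebraMap O Ω a ∈ S) (i j : Fin (m + 2)) (hij : i ≠ j)
    (hS : ∀ p q, f (plD O p q) ∈ S)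
    (hS2 : ∀ k, f (plD O i k) / f (plD O i j) ∈ S)
    (D : ℕ) (h : MvPolynomial (Fin (m + 2) ⊕ Fin (m + 2)) O)
    (hD : h.totalDegree ≤ D) :
    (araL D : Ω) * hH Ω (hSub O (fun k => f (X (Sum.inl k))) (fun k => f (X (Sum.inr k))) h) ∈ S := by
  rw [hF_inv _ _ i j]
  · refine hF_mem _ _ S hO ?_ ?_ D h hD
    · intro k
      have := hS k j
      simpa only [plD, map_sub, map_mul] using this
    · intro k
      have := hS2 k
      simpa only [plD, map_sub, map_mul] using this
  · exact (map_ne_zero_iff f hf).mpr (X_ne_zero _)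
  · have := (map_ne_zero_iff f hf).mpr (plD_ne O i j hij)
    simpa only [plD, map_sub, map_mul] using this

theorem pl_charZero (O : Type*) [CommRing O] [IsDomain O] [CharZero O] (m : ℕ) :
    CharZero (FractionRing (MvPolynomial (Fin (m + 2) ⊕ Fin (m + 2)) O)) :=
  charZero_of_injective_algebraMap (IsFractionRing.injective
    (MvPolynomial (Fin (m + 2) ⊕ Fin (m + 2)) O)
    (FractionRing (MvPolynomial (Fin (m + 2) ⊕ Fin (m + 2)) O)))

theorem plX_mem {O Ω : Type*} [CommRing O] [IsDomain O] {m : ℕ} [Field Ω]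
    (f : MvPolynomial (Fin (m + 2) ⊕ Fin (m + 2)) O →+* Ω)
    (hf : Function.Injective f) (L : Subfield Ω)
    (hS : ∀ p q, f (plD O p q) ∈ L) (hx0 : f (X (Sum.inl 0)) ∈ L) (hy0 : f (X (Sum.inr 0)) ∈ L)
    (hx1 : f (X (Sum.inl 1)) ∈ L) (v) : f (X v) ∈ L := by
  have h01 := (map_ne_zero_iff f hf).mpr (plD_ne O (0 : Fin (m + 2)) 1 (by simp))
  have hx0' : f (X (Sum.inl 0)) ≠ 0 := (map_ne_zero_iff f hf).mpr (X_ne_zero _)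
  have hy1 : f (X (Sum.inr 1)) ∈ L := by
    have := L.div_mem (L.add_mem (hS 0 1) (L.mul_mem hx1 hy0)) hx0
    convert this using 1
    rw [eq_div_iff hx0', plD]
    simp only [map_sub, map_mul]
    ring
  rcases v with k | k
  · have := L.div_mem (L.sub_mem (L.mul_mem hx1 (hS 0 k)) (L.mul_mem hx0 (hS 1 k))) (hS 0 1)
    convert this using 1
    rw [eq_div_iff h01]
    simp only [plD, map_sub, map_mul]
    ring
  · have := L.div_mem (L.sub_mem (L.mul_mem hy1 (hS 0 k)) (L.mul_mem hy0 (hS 1 k))) (hS 0 1)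
    convert this using 1
    rw [eq_div_iff h01]
    simp only [plD, map_sub, map_mul]
    ring

/-- The functional ρ. -/
def plRho (O : Type*) [CommRing O] [IsDomain O] (m D : ℕ) :
    MvPolynomial (Fin (m + 2) ⊕ Fin (m + 2)) O →ₗ[O]
      FractionRing (MvPolynomial (Fin (m + 2) ⊕ Fin (m + 2)) O) :=
  (araL D : O) • (((hH (FractionRing (MvPolynomial (Fin (m + 2) ⊕ Fin (m + 2)) O))).restrictScalars O)
    ∘ₗ (hSub O (fun k => algebraMap _ (FractionRing (MvPolynomial (Fin (m + 2) ⊕ Fin (m + 2)) O))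
        (X (Sum.inl k) : MvPolynomial (Fin (m + 2) ⊕ Fin (m + 2)) O))
      (fun k => algebraMap _ (FractionRing (MvPolynomial (Fin (m + 2) ⊕ Fin (m + 2)) O))
        (X (Sum.inr k) : MvPolynomial (Fin (m + 2) ⊕ Fin (m + 2)) O))).toLinearMap)

theorem plRho_apply (O : Type*) [CommRing O] [IsDomain O] (m D : ℕ) (f) :
    plRho O m D f = (araL D : FractionRing (MvPolynomial (Fin (m + 2) ⊕ Fin (m + 2)) O)) *
      hH _ (hSub O (fun k => algebraMap _ (FractionRing (MvPolynomial (Fin (m + 2) ⊕ Fin (m + 2)) O))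
        (X (Sum.inl k) : MvPolynomial (Fin (m + 2) ⊕ Fin (m + 2)) O))
      (fun k => algebraMap _ (FractionRing (MvPolynomial (Fin (m + 2) ⊕ Fin (m + 2)) O))
        (X (Sum.inr k) : MvPolynomial (Fin (m + 2) ⊕ Fin (m + 2)) O)) f) := by
  rw [plRho, LinearMap.smul_apply, Algebra.smul_def, map_natCast]
  rfl

/-- The Plücker data. -/
def plData (O : Type*) [CommRing O] [IsDomain O] [CharZero O] (m : ℕ) :
    AraData O (Fin (m + 2) ⊕ Fin (m + 2)) (Fin (2 * m + 1)) (Fin 3) (PlJ m) where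
  g := plG O m
  e := ![X (Sum.inl 0), X (Sum.inr 0), X (Sum.inl 1)]
  t := plC O m
  d := fun _ => 2
  hd := by
    intro k
    exact IsHomogeneous.sum _ _ _ fun ij _ => ((isHomogeneous_X _ _).mul (isHomogeneous_X _ _)).sub
      ((isHomogeneous_X _ _).mul (isHomogeneous_X _ _))
  hcard := by simp; omega
  ht := fun i V _ hV => plC_val i V hV
  hX := by
    intro L _ ht he v
    exact plX_mem (algebraMap _ _) (IsFractionRing.injective
      (MvPolynomial (Fin (m + 2) ⊕ Fin (m + 2)) O) _) L
      (plD_mem (algebraMap _ _) L.toSubring ht) (he 0) (he 1) (he 2) v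
  ρ := plRho O m
  hρg := by
    have := pl_charZero O m
    intro D k f
    simp only [plRho_apply]
    rw [plG, Finset.sum_mul, map_sum, map_sum, map_sum, mul_left_comm, Finset.sum_mul]
    congr 1
    refine Finset.sum_congr rfl fun j _ => ?_
    rw [plC, plD, hF_det]
    simp only [map_sub, map_mul]
  hρ1 := by
    intro D
    rw [plRho_apply, map_one]
    have : hH (FractionRing (MvPolynomial (Fin (m + 2) ⊕ Fin (m + 2)) O)) 1 = 1 := by
      have := hH_apply (F := FractionRing (MvPolynomial (Fin (m + 2) ⊕ Fin (m + 2)) O)) 0 0 0 0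
      simpa [hVal, hBeta] using this
    rw [this, mul_one]
  hρV := by
    have := pl_charZero O m
    intro D f hf V hO hV
    rw [plRho_apply]
    have : Nonempty (PlJ m) := ⟨⟨(0, 1), by simp⟩⟩
    obtain ⟨j0, hj0⟩ := Finite.exists_max (fun j : PlJ m => V.valuation (algebraMap _
      (FractionRing (MvPolynomial (Fin (m + 2) ⊕ Fin (m + 2)) O)) (plC O m j)))
    have hinj := IsFractionRing.injective (MvPolynomial (Fin (m + 2) ⊕ Fin (m + 2)) O)
      (FractionRing (MvPolynomial (Fin (m + 2) ⊕ Fin (m + 2)) O))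
    have hD := plD_mem (algebraMap _ _) V.toSubring (fun i => plC_val i V hV)
    refine plρ_mem (algebraMap _ _) hinj V.toSubring hO j0.1.1 j0.1.2 (ne_of_lt j0.2) hD ?_ D f hf
    intro k
    change _ ∈ V
    rw [← V.valuation_le_one_iff, map_div₀]
    refine div_le_one_of_le₀ ?_ zero_le
    rcases lt_trichotomy j0.1.1 k with h | h | h
    · exact hj0 ⟨(_, k), h⟩
    · rw [← h]; simp [plD]
    · have := hj0 ⟨(k, _), h⟩
      have e : - plD O j0.1.1 k = plC O m ⟨(k, j0.1.1), h⟩ := by simp only [plC, plD]; ring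
      rw [← Valuation.map_neg, ← map_neg, e]
      exact this
  hρL := by
    have := pl_charZero O m
    intro D f hf L hO hL
    rw [plRho_apply]
    have hinj := IsFractionRing.injective (MvPolynomial (Fin (m + 2) ⊕ Fin (m + 2)) O)
      (FractionRing (MvPolynomial (Fin (m + 2) ⊕ Fin (m + 2)) O))
    have hD := plD_mem (algebraMap _ _) L.toSubring hL
    exact plρ_mem (algebraMap _ _) hinj L.toSubring hO 0 1 (by simp) hD
      (fun k => L.div_mem (hD _ _) (hD _ _)) D f hf

end Pluecker

section Lower

universe u

theorem ara_lower {K : Type u} [Field K] {m : ℕ} (I : Ideal (MvPolynomial (Fin m) K))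
    {σ ι ε τ : Type*} [Fintype σ] [Fintype ι] [Fintype ε] [Finite τ]
    (A : ∀ (O : Type u) [CommRing O] [IsDomain O] [CharZero O], AraData O σ ι ε τ)
    (gK : ι → MvPolynomial σ K)
    (hgK : ∀ (O : Type u) [CommRing O] [IsDomain O] [CharZero O]
      (φ : O →+* AlgebraicClosure K) k, map φ ((A O).g k) =
        map (algebraMap K (AlgebraicClosure K)) (gK k))
    (ψ : MvPolynomial (Fin m) K →+* MvPolynomial σ K)
    (h1 : ∀ k, gK k ∈ (I.map ψ).radical)
    (h2 : ∀ f ∈ I, ψ f ∈ (Ideal.span (Set.range gK)).radical) :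
    Fintype.card ι ≤ ara I := by
  have hne : {s | ∃ F : Fin s → MvPolynomial (Fin m) K,
      (∀ i, F i ∈ I) ∧ (Ideal.span (Set.range F)).radical = I.radical}.Nonempty := by
    obtain ⟨s, F, hF⟩ := Submodule.fg_iff_exists_fin_generating_family.mp
      (IsNoetherian.noetherian I)
    have hF' : Ideal.span (Set.range F) = I := hF
    exact ⟨s, F, fun i => by rw [← hF']; exact Ideal.subset_span ⟨i, rfl⟩, by rw [hF']⟩
  obtain ⟨F, hF1, hF2⟩ := Nat.sInf_mem hne
  refine ara_bound A gK hgK (fun j => ψ (F j)) ?_ (fun j => h2 _ (hF1 j))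
  intro k
  have h3 : I.map ψ ≤ (Ideal.span (Set.range fun j => ψ (F j))).radical := by
    have : I ≤ (Ideal.span (Set.range F)).radical := by rw [hF2]; exact Ideal.le_radical
    refine (Ideal.map_mono this).trans ((Ideal.map_radical_le ψ).trans ?_)
    rw [Ideal.map_span, ← Set.range_comp]
    rfl
  have h4 := Ideal.radical_mono h3 (h1 k)
  rwa [Ideal.radical_idem] at h4

theorem mem_radical_of_prime {R : Type*} [CommRing R] {I : Ideal R} {x : R}
    (h : ∀ P : Ideal R, P.IsPrime → I ≤ P → x ∈ P) : x ∈ I.radical := by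
  rw [Ideal.radical_eq_sInf, Ideal.mem_sInf]
  rintro P ⟨h1, h2⟩
  exact h P h2 h1

theorem ara_complete (K : Type u) [Field K] (m : ℕ) :
    2 * m + 1 ≤ ara (binomialEdgeIdeal K (⊤ : SimpleGraph (Fin (m + 2)))) := by
  have hψ : ∀ p q, rename (finSumFinEquiv (m := m + 2) (n := m + 2)).symm
      (edgeBinomial K (m + 2) p q) = plD K p q := by
    intro p q
    simp only [edgeBinomial, plD, map_sub, map_mul, rename_X, finSumFinEquiv_symm_apply_castAdd,
      finSumFinEquiv_symm_apply_natAdd]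
  have key := ara_lower (binomialEdgeIdeal K (⊤ : SimpleGraph (Fin (m + 2))))
    (fun O _ _ _ => plData O m) (plG K m)
    (fun O _ _ _ φ k => by rw [pl_map]; exact pl_map m φ k)
    (rename (R := K) (finSumFinEquiv (m := m + 2) (n := m + 2)).symm).toRingHom ?_ ?_
  · simpa using key
  · intro k
    refine Ideal.le_radical (Ideal.sum_mem _ fun j _ => ?_)
    rw [plC, ← hψ]
    refine Ideal.mem_map_of_mem _ (Ideal.subset_span ⟨_, _, j.2, ?_, rfl⟩)
    exact ne_of_lt j.2
  · intro f hf
    refine mem_radical_of_prime fun P hP hle => ?_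
    have hc : ∀ j, plC K m j ∈ P := by
      intro j
      refine (plRel K m).mem_prime P ?_ j
      intro k
      exact pl_sum_mem (AddMonoidHom.id _) P.toAddSubmonoid
        (fun k => hle (Ideal.subset_span ⟨k, rfl⟩)) k _ (by simp)
    change f ∈ P.comap _
    refine (Ideal.span_le.mpr ?_) hf
    rintro _ ⟨p, q, hpq, -, rfl⟩
    change rename _ _ ∈ P
    rw [hψ]
    exact hc ⟨(p, q), hpq⟩

end Lower

section Cut

universe u

variable {n : ℕ} (G : SimpleGraph (Fin n)) (S : Finset (Fin n))

/-- The complement of the cut. -/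
abbrev cutH := G.induce ((S : Set (Fin n))ᶜ)

/-- Representatives. -/
def cutRep (C : (cutH G S).ConnectedComponent) : ((S : Set (Fin n))ᶜ : Set (Fin n)) :=
  C.exists_rep.choose

theorem cutRep_spec (C : (cutH G S).ConnectedComponent) :
    (cutH G S).connectedComponentMk (cutRep G S C) = C := C.exists_rep.choose_spec

/-- Non representatives and the cut vertices. -/
abbrev cutA := {v : Fin n // v ∉ S ∧ ∀ C, (cutRep G S C : Fin n) ≠ v} ⊕ S

/-- variables -/
abbrev cutσ (P Q : ℕ) := cutA G S ⊕ (Fin (P + 1) ⊕ Fin (Q + 1))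

variable (K : Type u) [Field K] {P Q : ℕ} (C0 : (cutH G S).ConnectedComponent)
  (ez : {C // C ≠ C0} ≃ Fin (P + 1)) (es : S ≃ Fin (Q + 1))

open Classical in
/-- U -/
def cutU (P Q : ℕ) (v : Fin n) : MvPolynomial (cutσ G S P Q) K :=
  if h : v ∉ S ∧ ∀ C, (cutRep G S C : Fin n) ≠ v then X (Sum.inl (Sum.inl ⟨v, h⟩)) else 0

open Classical in
/-- Z -/
def cutZ (Q : ℕ) (C : (cutH G S).ConnectedComponent) : MvPolynomial (cutσ G S P Q) K :=
  if h : C ≠ C0 then X (Sum.inr (Sum.inl (ez ⟨C, h⟩))) else 0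

open Classical in
/-- x -/
def cutX (P : ℕ) (v : Fin n) : MvPolynomial (cutσ G S P Q) K :=
  if h : v ∈ S then X (Sum.inr (Sum.inr (es ⟨v, h⟩))) else 1

open Classical in
/-- y -/
def cutY (Q : ℕ) (v : Fin n) : MvPolynomial (cutσ G S P Q) K :=
  if h : v ∈ S then X (Sum.inl (Sum.inr ⟨v, h⟩)) else
    cutU G S K P Q v + cutZ G S K C0 ez Q ((cutH G S).connectedComponentMk ⟨v, h⟩)

/-- the substitution -/
def cutψ : MvPolynomial (Fin (n + n)) K →ₐ[K] MvPolynomial (cutσ G S P Q) K :=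
  aeval (Fin.append (cutX G S K es P) (cutY G S K C0 ez Q))

theorem cutψ_edge (p q : Fin n) : cutψ G S K C0 ez es (edgeBinomial K n p q) =
    cutX G S K es P p * cutY G S K C0 ez Q q - cutX G S K es P q * cutY G S K C0 ez Q p := by
  simp only [cutψ, edgeBinomial, map_sub, map_mul, aeval_X, Fin.append_left, Fin.append_right]

theorem cutU_rep (C) : cutU G S K P Q (cutRep G S C) = 0 := by
  rw [cutU, dif_neg]
  intro h
  exact h.2 C rfl

theorem cutY_rep (C) : cutY G S K C0 ez Q (cutRep G S C) = cutZ G S K C0 ez Q C := by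
  rw [cutY, dif_neg (show (cutRep G S C : Fin n) ∉ S from (cutRep G S C).2), cutU_rep, zero_add]
  congr 1
  exact cutRep_spec G S C

theorem cut_reach {V : Type*} {H : SimpleGraph V} (r : V → V → Prop) (hr : ∀ a, r a a)
    (hs : ∀ a b c, r a b → H.Adj b c → r a c) {a b : V} (h : H.Reachable a b) : r a b := by
  rw [SimpleGraph.reachable_iff_reflTransGen] at h
  induction h with
  | refl => exact hr a
  | tail _ h2 ih => exact hs _ _ _ ih h2

theorem cut_h2 (f) (hf : f ∈ binomialEdgeIdeal K G) :
    cutψ G S K C0 ez es f ∈ (Ideal.span (Set.range (segG K (cutA G S) P Q))).radical := by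
  refine mem_radical_of_prime fun I hI hle => ?_
  have hc : ∀ j, segC K (cutA G S) P Q j ∈ I := by
    intro j
    refine (segRel K (cutA G S) P Q).mem_prime I ?_ j
    intro k
    exact seg_sum_mem (AddMonoidHom.id _) I.toAddSubmonoid
      (fun k => hle (Ideal.subset_span ⟨k, rfl⟩)) k _ (by simp)
  have ha : ∀ a, (X (Sum.inl a) : MvPolynomial (cutσ G S P Q) K) ∈ I :=
    fun a => hle (Ideal.subset_span ⟨Sum.inl a, rfl⟩)
  have hU : ∀ v, cutU G S K P Q v ∈ I := by
    intro v
    rw [cutU]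
    split_ifs
    · exact ha _
    · exact I.zero_mem
  have hyS : ∀ v ∈ S, cutY G S K C0 ez Q v ∈ I := by
    intro v hv
    rw [cutY, dif_pos hv]
    exact ha _
  have hZ : ∀ v ∈ S, ∀ C, cutX G S K es P v * cutZ G S K C0 ez Q C ∈ I := by
    intro v hv C
    rw [cutX, dif_pos hv, cutZ]
    split_ifs
    · rw [mul_comm]; exact hc (_, _)
    · rw [mul_zero]; exact I.zero_mem
  have hmix : ∀ p q, p ∈ S → q ∉ S → cutX G S K es P p * cutY G S K C0 ez Q q ∈ I := by
    intro p q hp hq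
    rw [cutY, dif_neg hq, mul_add]
    exact I.add_mem (I.mul_mem_left _ (hU _)) (hZ p hp _)
  change f ∈ I.comap (cutψ G S K C0 ez es).toRingHom
  refine (Ideal.span_le.mpr ?_) hf
  rintro _ ⟨p, q, hpq, hadj, rfl⟩
  change cutψ G S K C0 ez es _ ∈ I
  rw [cutψ_edge]
  by_cases hp : p ∈ S <;> by_cases hq : q ∈ S
  · exact I.sub_mem (I.mul_mem_left _ (hyS _ hq)) (I.mul_mem_left _ (hyS _ hp))
  · exact I.sub_mem (hmix p q hp hq) (I.mul_mem_left _ (hyS _ hp))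
  · exact I.sub_mem (I.mul_mem_left _ (hyS _ hq)) (hmix q p hq hp)
  · have hC : (cutH G S).connectedComponentMk ⟨p, hp⟩ = (cutH G S).connectedComponentMk ⟨q, hq⟩ :=
      SimpleGraph.ConnectedComponent.sound (SimpleGraph.Adj.reachable (by exact hadj))
    rw [cutX, cutX, dif_neg hp, dif_neg hq, cutY, cutY, dif_neg hp, dif_neg hq, hC]
    have : (1 : MvPolynomial (cutσ G S P Q) K) * (cutU G S K P Q q +
        cutZ G S K C0 ez Q ((cutH G S).connectedComponentMk ⟨q, hq⟩)) -
        1 * (cutU G S K P Q p + cutZ G S K C0 ez Q ((cutH G S).connectedComponentMk ⟨q, hq⟩)) =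
        cutU G S K P Q q - cutU G S K P Q p := by ring
    rw [this]
    exact I.sub_mem (hU _) (hU _)

theorem cut_h1 (hmin : ∀ T, T ⊂ S → (G.induce ((T : Set (Fin n))ᶜ)).Preconnected) (k) :
    segG K (cutA G S) P Q k ∈
      ((binomialEdgeIdeal K G).map (cutψ G S K C0 ez es).toRingHom).radical := by
  classical
  refine mem_radical_of_prime fun I hI hle => ?_
  have hlt : ∀ p q, p < q → G.Adj p q → cutX G S K es P p * cutY G S K C0 ez Q q -
      cutX G S K es P q * cutY G S K C0 ez Q p ∈ I := by
    intro p q hpq hadj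
    rw [← cutψ_edge]
    exact hle (Ideal.mem_map_of_mem (cutψ G S K C0 ez es).toRingHom
      (Ideal.subset_span ⟨p, q, hpq, hadj, rfl⟩))
  have hadj : ∀ p q, G.Adj p q → cutX G S K es P p * cutY G S K C0 ez Q q -
      cutX G S K es P q * cutY G S K C0 ez Q p ∈ I := by
    intro p q h
    rcases lt_trichotomy p q with h1 | h1 | h1
    · exact hlt p q h1 h
    · exact absurd h1 h.ne
    · rw [← neg_sub]; exact I.neg_mem (hlt q p h1 h.symm)
  have h1I : (1 : MvPolynomial (cutσ G S P Q) K) ∉ I := fun h => hI.ne_top ((Ideal.eq_top_iff_one I).mpr h)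
  -- it suffices to have the following three facts
  suffices hmain : (∀ v, cutU G S K P Q v ∈ I) ∧ (∀ v ∈ S, cutY G S K C0 ez Q v ∈ I) ∧
      ((∀ v ∈ S, cutX G S K es P v ∈ I) ∨ (∀ C, cutZ G S K C0 ez Q C ∈ I)) by
    obtain ⟨hU, hY, hXZ⟩ := hmain
    rcases k with (⟨v, hv⟩ | ⟨v, hv⟩) | k
    · have := hU v
      rw [cutU, dif_pos hv] at this
      exact this
    · have := hY v hv
      rw [cutY, dif_pos hv] at this
      exact this
    · refine I.sum_mem fun ij _ => ?_
      rcases hXZ with h | h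
      · have := h (es.symm ij.2) (es.symm ij.2).2
        rw [cutX, dif_pos (es.symm ij.2).2, Subtype.coe_eta, Equiv.apply_symm_apply] at this
        exact I.mul_mem_left _ this
      · have := h (ez.symm ij.1).1
        rw [cutZ, dif_pos (ez.symm ij.1).2, Subtype.coe_eta, Equiv.apply_symm_apply] at this
        exact I.mul_mem_right _ this
  let T := S.filter fun v => cutX G S K es P v ∈ I ∧ cutY G S K C0 ez Q v ∈ I
  have hTS : T ⊆ S := Finset.filter_subset _ _
  have hT : ∀ v, v ∉ T → ¬ (cutX G S K es P v ∈ I ∧ cutY G S K C0 ez Q v ∈ I) := by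
    intro v hv h
    by_cases hvS : v ∈ S
    · exact hv (Finset.mem_filter.mpr ⟨hvS, h⟩)
    · have := h.1
      rw [cutX, dif_neg hvS] at this
      exact h1I this
  by_cases hTe : T = S
  · have hS : ∀ v ∈ S, cutX G S K es P v ∈ I ∧ cutY G S K C0 ez Q v ∈ I := by
      intro v hv
      rw [← hTe] at hv
      exact (Finset.mem_filter.mp hv).2
    refine ⟨?_, fun v hv => (hS v hv).2, Or.inl fun v hv => (hS v hv).1⟩
    intro v
    by_cases hv : v ∈ S
    · rw [cutU, dif_neg (by tauto)]; exact I.zero_mem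
    have hre : (cutH G S).Reachable
        (cutRep G S ((cutH G S).connectedComponentMk ⟨v, hv⟩)) ⟨v, hv⟩ :=
      SimpleGraph.ConnectedComponent.exact (cutRep_spec G S _)
    have h3 := cut_reach (H := cutH G S)
      (fun a b => cutY G S K C0 ez Q b - cutY G S K C0 ez Q a ∈ I)
      (fun a => by rw [sub_self]; exact I.zero_mem) (fun a b c hab hbc => by
        have h4 := hadj b c hbc
        rw [cutX, cutX, dif_neg (show (b : Fin n) ∉ S from b.2),
          dif_neg (show (c : Fin n) ∉ S from c.2), one_mul, one_mul] at h4
        have h5 := I.add_mem h4 hab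
        rwa [sub_add_sub_cancel] at h5) hre
    rw [cutY_rep] at h3
    rw [cutY, dif_neg hv, add_sub_cancel_right] at h3
    exact h3
  · have hpre := hmin T (hTS.ssubset_of_ne hTe)
    have hC0 : (cutRep G S C0 : Fin n) ∉ S := (cutRep G S C0).2
    have hYall : ∀ v, cutY G S K C0 ez Q v ∈ I := by
      intro v
      by_cases hv : v ∈ T
      · exact (Finset.mem_filter.mp hv).2.2
      have hre := hpre ⟨cutRep G S C0, fun h => hC0 (hTS h)⟩ ⟨v, hv⟩
      have h3 := cut_reach (H := G.induce ((T : Set (Fin n))ᶜ))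
        (fun a b => cutX G S K es P a * cutY G S K C0 ez Q b -
          cutX G S K es P b * cutY G S K C0 ez Q a ∈ I)
        (fun a => by rw [sub_self]; exact I.zero_mem) (fun a b c hab hbc => by
          have h4 := hadj b c hbc
          have hb := hT b b.2
          by_cases hxb : cutX G S K es P b ∈ I
          · have hyb : cutY G S K C0 ez Q b ∉ I := fun h => hb ⟨hxb, h⟩
            refine (hI.mem_or_mem (x := cutY G S K C0 ez Q b) ?_).resolve_left hyb
            have := I.add_mem (I.mul_mem_left (cutY G S K C0 ez Q c) hab)
              (I.mul_mem_left (cutY G S K C0 ez Q a) h4)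
            convert this using 1
            ring
          · refine (hI.mem_or_mem (x := cutX G S K es P b) ?_).resolve_left hxb
            have := I.add_mem (I.mul_mem_left (cutX G S K es P c) hab)
              (I.mul_mem_left (cutX G S K es P a) h4)
            convert this using 1
            ring) hre
      dsimp only at h3
      rw [cutY_rep, cutZ, dif_neg (by simp), mul_zero, sub_zero, cutX, dif_neg hC0, one_mul] at h3
      exact h3
    have hZ : ∀ C, cutZ G S K C0 ez Q C ∈ I := fun C => by
      rw [← cutY_rep]; exact hYall _
    refine ⟨?_, fun v _ => hYall v, Or.inr hZ⟩
    intro v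
    by_cases hv : v ∈ S
    · rw [cutU, dif_neg (by tauto)]; exact I.zero_mem
    have h4 := hYall v
    rw [cutY, dif_neg hv] at h4
    exact (I.add_mem_iff_left (hZ _)).mp h4

theorem ara_cut (hS0 : S.Nonempty) (hS : ¬ (cutH G S).Preconnected)
    (hmin : ∀ T, T ⊂ S → (G.induce ((T : Set (Fin n))ᶜ)).Preconnected) :
    n + S.card - 2 ≤ ara (binomialEdgeIdeal K G) := by
  classical
  have hfin : Fintype (cutH G S).ConnectedComponent := Fintype.ofFinite _
  obtain ⟨a, b, hab⟩ : ∃ a b, ¬ (cutH G S).Reachable a b := by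
    by_contra! h
    exact hS h
  let C0 := (cutH G S).connectedComponentMk a
  have hc1 : (cutH G S).connectedComponentMk b ≠ C0 := fun h =>
    hab (SimpleGraph.ConnectedComponent.exact h.symm)
  have hcard : Fintype.card {C // C ≠ C0} = Fintype.card (cutH G S).ConnectedComponent - 1 := by
    rw [Fintype.card_subtype_compl, Fintype.card_subtype_eq]
  have hpos : 0 < Fintype.card {C // C ≠ C0} := Fintype.card_pos_iff.mpr ⟨⟨_, hc1⟩⟩
  obtain ⟨P, hP⟩ := Nat.exists_eq_succ_of_ne_zero hpos.ne'
  obtain ⟨Q, hQ⟩ := Nat.exists_eq_succ_of_ne_zero hS0.card_pos.ne'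
  let ez : {C // C ≠ C0} ≃ Fin (P + 1) := Fintype.equivFinOfCardEq hP
  let es : S ≃ Fin (Q + 1) := Fintype.equivFinOfCardEq (by rw [Fintype.card_coe, hQ])
  have key := ara_lower (binomialEdgeIdeal K G)
    (fun O _ _ _ => segData O (cutA G S) P Q) (segG K (cutA G S) P Q)
    (fun O _ _ _ φ k => by rw [seg_map]; exact seg_map _ P Q φ k)
    (cutψ G S K C0 ez es).toRingHom (cut_h1 G S K C0 ez es hmin) (cut_h2 G S K C0 ez es)
  refine le_trans ?_ key
  rw [Fintype.card_sum, Fintype.card_sum, Fintype.card_coe, Fintype.card_fin]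
  have hn : n ≤ Fintype.card {v : Fin n // v ∉ S ∧ ∀ C, (cutRep G S C : Fin n) ≠ v} +
      (Fintype.card (cutH G S).ConnectedComponent + S.card) := by
    have hcov : (Finset.univ : Finset (Fin n)) ⊆
        (Finset.univ.filter fun v => v ∉ S ∧ ∀ C, (cutRep G S C : Fin n) ≠ v) ∪
        ((Finset.univ.image fun C => (cutRep G S C : Fin n)) ∪ S) := by
      intro v _
      simp only [Finset.mem_union, Finset.mem_filter, Finset.mem_univ, true_and, Finset.mem_image]
      by_contra! h
      exact (h.1 h.2.2).elim fun C hC => h.2.1 C hC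
    have h1 := Finset.card_le_card hcov
    rw [Finset.card_univ, Fintype.card_fin] at h1
    refine h1.trans ((Finset.card_union_le _ _).trans ?_)
    rw [Fintype.card_subtype]
    gcongr
    refine (Finset.card_union_le _ _).trans ?_
    gcongr
    exact Finset.card_image_le
  omega

end Cut

theorem stmt_8 (K : Type*) [Field K] (n l : ℕ) (hn : 0 < n)
    (G : SimpleGraph (Fin n)) (hconn : G.Connected)
    (hl : 0 < l) (hln : l < n)
    (hvc : ∀ S : Finset (Fin n), S.card < l →
      (G.induce ((S : Set (Fin n))ᶜ)).Connected) :
    n + l - 2 ≤ ara (binomialEdgeIdeal K G) := by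
  classical
  by_cases hG : G = ⊤
  · subst hG
    obtain ⟨m, rfl⟩ : ∃ m, n = m + 2 := ⟨n - 2, by omega⟩
    have := ara_complete K m
    omega
  · obtain ⟨a, b, hne, hab⟩ : ∃ a b, a ≠ b ∧ ¬ G.Adj a b := by
      by_contra! h
      apply hG
      ext a b
      simp only [SimpleGraph.top_adj]
      exact ⟨fun h => h.ne, h a b⟩
    have hex : ∃ S : Finset (Fin n), ¬ (G.induce ((S : Set (Fin n))ᶜ)).Preconnected := by
      refine ⟨{a, b}ᶜ, fun h => ?_⟩
      have ha : a ∈ (((({a, b} : Finset (Fin n))ᶜ : Finset (Fin n)) : Set (Fin n))ᶜ) := by simp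
      have hb : b ∈ (((({a, b} : Finset (Fin n))ᶜ : Finset (Fin n)) : Set (Fin n))ᶜ) := by simp
      have h1 := cut_reach (fun x y => y = x) (fun _ => rfl) (fun x y z hxy hyz => by
        subst hxy
        exfalso
        have hadj : G.Adj y z := hyz
        have hy := y.2
        have hz := z.2
        simp only [Set.mem_compl_iff, Finset.mem_coe, Finset.mem_compl, Finset.mem_insert,
          Finset.mem_singleton, not_not] at hy hz
        rcases hy with hy | hy <;> rcases hz with hz | hz <;> rw [hy, hz] at hadj
        · exact hadj.ne rfl
        · exact hab hadj
        · exact hab hadj.symm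
        · exact hadj.ne rfl) (h ⟨a, ha⟩ ⟨b, hb⟩)
      exact hne (congrArg Subtype.val h1).symm
    obtain ⟨S, hS, hmin⟩ : ∃ S : Finset (Fin n), ¬ (G.induce ((S : Set (Fin n))ᶜ)).Preconnected ∧
        ∀ T, T ⊂ S → (G.induce ((T : Set (Fin n))ᶜ)).Preconnected := by
      obtain ⟨S, hS, hm⟩ := (wellFounded_lt (α := Finset (Fin n))).has_min
        {S | ¬ (G.induce ((S : Set (Fin n))ᶜ)).Preconnected} hex
      exact ⟨S, hS, fun T hT => by
        by_contra h
        exact hm T h hT⟩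
    have hlS : l ≤ S.card := by
      by_contra! h
      exact hS (hvc S h).preconnected
    have := ara_cut G S K (Finset.card_pos.mp (by omega)) hS hmin
    omega
end
end

section
/- Let n ≥ 3 and let G be the cycle graph on the vertex set {1,…,n} (with edges {i, i+1} for 1 ≤ i ≤ n−1 and the edge {1, n}). Then ara(J_G) = n and bar(J_G) = n. -/
open MvPolynomial

noncomputable section

theorem bei_det_aux {R : Type*} [CommRing R] {n : ℕ} (C C' : Matrix (Fin n) (Fin n) R)
    (y z : Fin n → R) (h : C.mulVec y = z) (h' : C'.mulVec y = z) :
    (C.det - C'.det) * ∏ i, z i ∈ Ideal.span (Set.range fun i => z i ^ 2) := by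
  classical
  have key : ∀ s : Finset (Fin n),
      ((Matrix.of fun i => if i ∈ s then C i else C' i).det - C'.det) * ∏ i, z i ∈
        Ideal.span (Set.range fun i => z i ^ 2) := by
    intro s
    induction s using Finset.induction_on with
    | empty =>
      have : (Matrix.of fun i => if i ∈ (∅ : Finset (Fin n)) then C i else C' i) = C' := by
        ext i j; simp
      rw [this]; simp
    | insert a s ha ih =>
      set M := (Matrix.of fun i => if i ∈ s then C i else C' i) with hM
      have e1 : (Matrix.of fun i => if i ∈ insert a s then C i else C' i)
          = M.updateRow a (C a) := by
        ext i j
        by_cases hi : i = a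
        · subst hi; simp
        · simp [hi, hM, Matrix.updateRow_apply]
      have e2 : M = M.updateRow a (C' a) := by
        ext i j
        by_cases hi : i = a
        · subst hi; simp [hM, ha]
        · simp [hi, hM, Matrix.updateRow_apply]
      have hMy : ∀ i, M.mulVec y i = z i := by
        intro i
        by_cases hi : i ∈ s
        · rw [← h]; simp [Matrix.mulVec, hM, hi]
        · rw [← h']; simp [Matrix.mulVec, hM, hi]
      set D := M.updateRow a (C a - C' a) with hD
      have e3 : (M.updateRow a (C a)).det = M.det + D.det := by
        have : C a = C' a + (C a - C' a) := by simp
        rw [this, Matrix.det_updateRow_add, ← e2]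
      have hDy : D.mulVec y = fun i => if i = a then 0 else z i := by
        funext i
        by_cases hi : i = a
        · subst hi
          have h1 := congrFun h i
          have h2 := congrFun h' i
          simp only [Matrix.mulVec, dotProduct] at h1 h2 ⊢
          simp [hD, sub_mul, h1, h2]
        · rw [if_neg hi, ← hMy i]
          simp [Matrix.mulVec, hD, hi, Matrix.updateRow_apply]
          
      have hk : ∀ k, D.det * y k = ∑ j, D.adjugate k j * (if j = a then 0 else z j) := by
        intro k
        have : (D.adjugate * D).mulVec y = D.adjugate.mulVec (D.mulVec y) := by
          rw [Matrix.mulVec_mulVec]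
        rw [Matrix.adjugate_mul, hDy] at this
        have := congrFun this k
        rw [Matrix.smul_mulVec, Matrix.one_mulVec] at this
        simpa [Matrix.mulVec, dotProduct] using this
      have hmem : D.det * ∏ i, z i ∈ Ideal.span (Set.range fun i => z i ^ 2) := by
        rw [← Finset.mul_prod_erase Finset.univ z (Finset.mem_univ a), ← congrFun h a]
        simp only [Matrix.mulVec, dotProduct]
        rw [← mul_assoc, Finset.mul_sum, Finset.sum_mul]
        refine Ideal.sum_mem _ fun k _ => ?_
        rw [mul_left_comm, hk k, Finset.mul_sum, Finset.sum_mul]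
        refine Ideal.sum_mem _ fun j _ => ?_
        by_cases hj : j = a
        · simp [hj]
        · rw [if_neg hj, ← Finset.mul_prod_erase (Finset.univ.erase a) z (a := j) (by simp [hj])]
          have : C a k * (D.adjugate k j * z j) * (z j * ∏ x ∈ (Finset.univ.erase a).erase j, z x)
            = (C a k * D.adjugate k j * ∏ x ∈ (Finset.univ.erase a).erase j, z x) * z j ^ 2 := by
            ring
          rw [this]
          exact Ideal.mul_mem_left _ _ (Ideal.subset_span ⟨j, rfl⟩)
      rw [e1, e3]
      have := Ideal.add_mem _ ih hmem
      convert this using 1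
      ring
  have := key Finset.univ
  have e : (Matrix.of fun i => if i ∈ Finset.univ then C i else C' i) = C := by
    ext i j; simp
  rwa [e] at this

theorem bei_mono {R : Type*} [CommRing R] {n s N : ℕ} (hs : s < n) (y : Fin n → R) (F : Fin s → R)
    (hF : ∀ i, F i ∈ Ideal.span (Set.range y))
    (hy : ∀ j, y j ^ (N + 1) ∈ Ideal.span (Set.range F)) :
    (∏ j, y j) ^ (2 * N + 1) ∈ Ideal.span (Set.range fun j => y j ^ (2 * N + 2)) := by
  classical
  set F' : Fin n → R := fun k => if h : k.1 < s then F ⟨k, h⟩ else 0 with hF'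
  have hle : Ideal.span (Set.range F) ≤ Ideal.span (Set.range F') := by
    apply Ideal.span_mono
    rintro _ ⟨i, rfl⟩
    exact ⟨⟨i, i.2.trans hs⟩, by simp [hF']⟩
  have hA' : ∀ i : Fin n, ∃ c : Fin n → R, ∑ j, c j * y j = F' i ∧ (i.1 = s → c = 0) := by
    intro i
    by_cases h : i.1 < s
    · obtain ⟨c, hc⟩ := (Ideal.mem_span_range_iff_exists_fun).1 (hF ⟨i, h⟩)
      exact ⟨c, by simp [hF', h, hc], fun h' => by omega⟩
    · exact ⟨0, by simp [hF', h], fun _ => rfl⟩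
  have hy' : ∀ i, ∃ c : Fin n → R, ∑ j, c j * F' j = y i ^ (N + 1) := fun i =>
    (Ideal.mem_span_range_iff_exists_fun).1 (hle (hy i))
  choose A hA hA0 using hA'
  choose B hB using hy'
  have hdet : (Matrix.of B * Matrix.of A).det = 0 := by
    rw [Matrix.det_mul, Matrix.det_eq_zero_of_row_eq_zero (A := Matrix.of A) ⟨s, hs⟩, mul_zero]
    intro j
    simp [hA0 ⟨s, hs⟩ rfl]
  have := bei_det_aux (Matrix.diagonal fun j => y j ^ N) (Matrix.of B * Matrix.of A) y
    (fun j => y j ^ (N + 1)) (by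
      ext i; simp [Matrix.mulVec_diagonal, pow_succ]) (by
      rw [← Matrix.mulVec_mulVec]
      have : (Matrix.of A).mulVec y = F' := by
        ext i; simpa [Matrix.mulVec, dotProduct] using hA i
      rw [this]
      ext i; simpa [Matrix.mulVec, dotProduct] using hB i)
  rw [hdet, sub_zero, Matrix.det_diagonal, Finset.prod_pow, Finset.prod_pow, ← pow_add] at this
  have e1 : 2 * N + 1 = N + (N + 1) := by ring
  have e2 : (fun j => y j ^ (2 * N + 2)) = fun j => (y j ^ (N + 1)) ^ 2 := by
    funext j; ring
  rw [e1, e2]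
  exact this

abbrev beiS := Fin 3 × Fin 2

section
variable (V : Type*) [CommRing V]

def beiU (i : Fin 3) : MvPolynomial beiS V :=
  X (i + 1, 0) * X (i + 2, 1) - X (i + 2, 0) * X (i + 1, 1)

def beiD (i : Fin 3) (f : MvPolynomial beiS V) : MvPolynomial beiS V :=
  pderiv (i + 2, 1) (pderiv (i + 1, 0) f) - pderiv (i + 1, 1) (pderiv (i + 2, 0) f)

def beiQ (i : Fin 3) (a b c : ℕ) : MvPolynomial beiS V :=
  beiU V i ^ a * (beiU V (i + 1) ^ b * beiU V (i + 2) ^ c)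

/-- Euler operator on columns `i+1`, `i+2`. -/
def beiE (i : Fin 3) : Derivation V (MvPolynomial beiS V) (MvPolynomial beiS V) :=
  (X (i + 1, 0) : MvPolynomial beiS V) • pderiv (i + 1, 0) +
  (X (i + 1, 1) : MvPolynomial beiS V) • pderiv (i + 1, 1) +
  (X (i + 2, 0) : MvPolynomial beiS V) • pderiv (i + 2, 0) +
  (X (i + 2, 1) : MvPolynomial beiS V) • pderiv (i + 2, 1)

/-- Polarization: replaces column `j` by column `i`. -/
def beiT (i j : Fin 3) : Derivation V (MvPolynomial beiS V) (MvPolynomial beiS V) :=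
  (X (i, 0) : MvPolynomial beiS V) • pderiv (j, 0) +
  (X (i, 1) : MvPolynomial beiS V) • pderiv (j, 1)

theorem beiD_mul0 (i : Fin 3) (f : MvPolynomial beiS V) :
    beiD V i (beiU V i * f) = beiU V i * beiD V i f + beiE V i f + 2 * f := by
  fin_cases i <;>
  · simp [beiD, beiU, beiE, Derivation.leibniz, pderiv_X]
    ring

theorem beiD_mul1 (i : Fin 3) (f : MvPolynomial beiS V) :
    beiD V i (beiU V (i + 1) * f) = beiU V (i + 1) * beiD V i f - beiT V i (i + 1) f := by
  fin_cases i <;>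
  · simp [beiD, beiU, beiT, Derivation.leibniz, pderiv_X]
    ring

theorem beiD_mul2 (i : Fin 3) (f : MvPolynomial beiS V) :
    beiD V i (beiU V (i + 2) * f) = beiU V (i + 2) * beiD V i f - beiT V i (i + 2) f := by
  fin_cases i <;>
  · simp [beiD, beiU, beiT, Derivation.leibniz, pderiv_X]
    ring

theorem beiE_U (i : Fin 3) : beiE V i (beiU V i) = 2 * beiU V i ∧
    beiE V i (beiU V (i + 1)) = beiU V (i + 1) ∧ beiE V i (beiU V (i + 2)) = beiU V (i + 2) := by
  fin_cases i <;>
  · simp [beiU, beiE, Derivation.leibniz, pderiv_X]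
    ring_nf
    simp

theorem beiT_U (i : Fin 3) : beiT V i (i + 1) (beiU V (i + 1)) = 0 ∧
    beiT V i (i + 1) (beiU V (i + 2)) = 0 ∧ beiT V i (i + 2) (beiU V (i + 2)) = 0 := by
  fin_cases i <;>
  · simp [beiU, beiT, Derivation.leibniz, pderiv_X]
    try ring_nf
    try simp

theorem beiD_Q_zero (i : Fin 3) (b c : ℕ) : beiD V i (beiQ V i 0 b c) = 0 := by
  have h2 : ∀ c, beiD V i (beiU V (i + 2) ^ c) = 0 := by
    intro c
    induction c with
    | zero => simp [beiD]
    | succ c ih =>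
      rw [pow_succ', beiD_mul2, ih, Derivation.leibniz_pow, (beiT_U V i).2.2]
      simp
  simp only [beiQ, pow_zero, one_mul]
  induction b with
  | zero => simp [h2]
  | succ b ih =>
    rw [pow_succ', mul_assoc, beiD_mul1, ih, Derivation.leibniz, Derivation.leibniz_pow,
      Derivation.leibniz_pow, (beiT_U V i).1, (beiT_U V i).2.1]
    simp

theorem beiE_Q (i : Fin 3) (a b c : ℕ) :
    beiE V i (beiQ V i a b c) = ((2 * a + b + c : ℕ) : MvPolynomial beiS V) * beiQ V i a b c := by
  have hp : ∀ (f : MvPolynomial beiS V) (r : MvPolynomial beiS V) (k : ℕ),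
      beiE V i f = r * f → beiE V i (f ^ k) = k * r * f ^ k := by
    intro f r k h
    rw [Derivation.leibniz_pow, h]
    cases k with
    | zero => simp
    | succ k => simp [pow_succ]; ring
  have h0 := hp _ _ a (beiE_U V i).1
  have h1 := hp _ 1 b (by rw [(beiE_U V i).2.1, one_mul])
  have h2 := hp _ 1 c (by rw [(beiE_U V i).2.2, one_mul])
  simp only [beiQ]
  rw [Derivation.leibniz, Derivation.leibniz, h0, h1, h2]
  simp only [smul_eq_mul]
  push_cast
  ring

theorem beiD_Q_succ (i : Fin 3) (a b c : ℕ) :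
    beiD V i (beiQ V i (a + 1) b c) =
      (((a + 1) * (a + b + c + 2) : ℕ) : MvPolynomial beiS V) * beiQ V i a b c := by
  have hs : ∀ a, beiQ V i (a + 1) b c = beiU V i * beiQ V i a b c := by
    intro a; simp only [beiQ]; ring
  induction a with
  | zero =>
    rw [hs, beiD_mul0, beiD_Q_zero, beiE_Q]
    push_cast; ring
  | succ a ih =>
    rw [hs (a + 1), beiD_mul0, ih, beiE_Q, hs]
    push_cast; ring

/-- factorial of a multi-index -/
def beiFac (α : beiS →₀ ℕ) : ℕ := ∏ i, (α i).factorial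

def beiP : MvPolynomial beiS V →ₗ[V] MvPolynomial beiS V →ₗ[V] V :=
  (basisMonomials beiS V).constr V (fun α => (beiFac α : V) • lcoeff V α)

variable {V}

theorem beiP_monomial (α : beiS →₀ ℕ) (c : V) (g : MvPolynomial beiS V) :
    beiP V (monomial α c) g = c * (beiFac α * coeff α g) := by
  have : monomial α c = c • (basisMonomials beiS V) α := by
    simp [smul_monomial]
  rw [this, map_smul, beiP, Module.Basis.constr_basis]
  simp

theorem beiP_adj (i : beiS) (f g : MvPolynomial beiS V) :
    beiP V f (X i * g) = beiP V (pderiv i f) g := by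
  classical
  induction f using MvPolynomial.induction_on' with
  | add p q hp hq => simp [hp, hq]
  | monomial α c =>
    rw [pderiv_monomial, beiP_monomial, beiP_monomial, coeff_X_mul']
    by_cases h : α i = 0
    · simp [h]
    · rw [if_pos (by simpa using h)]
      have : beiFac α = α i * beiFac (α - Finsupp.single i 1) := by
        unfold beiFac
        rw [← Finset.mul_prod_erase _ _ (Finset.mem_univ i),
          ← Finset.mul_prod_erase _ (fun j => ((α - Finsupp.single i 1 : beiS →₀ ℕ) j).factorial)
            (Finset.mem_univ i), ← mul_assoc]
        congr 1
        · simp [Nat.mul_factorial_pred h]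
        · refine Finset.prod_congr rfl fun j hj => ?_
          have : i ≠ j := fun h => by simp [h] at hj
          simp [this]
      rw [this]; push_cast; ring

theorem beiP_adjU (i : Fin 3) (f g : MvPolynomial beiS V) :
    beiP V f (beiU V i * g) = beiP V (beiD V i f) g := by
  simp only [beiU, beiD, sub_mul, mul_assoc, map_sub, beiP_adj, LinearMap.sub_apply]

theorem beiP_kill (i : Fin 3) (m : ℕ) : ∀ (a b c : ℕ) (_ : a < m) (g : MvPolynomial beiS V),
    beiP V (beiQ V i a b c) (beiU V i ^ m * g) = 0 := by
  induction m with
  | zero => intro a b c h; omega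
  | succ m ih =>
    intro a b c h g
    rw [pow_succ', mul_assoc, beiP_adjU]
    cases a with
    | zero => simp [beiD_Q_zero]
    | succ a =>
      rw [beiD_Q_succ, ← nsmul_eq_mul, map_nsmul, LinearMap.smul_apply, ih a b c (by omega),
        smul_zero]

theorem beiP_norm_step (i : Fin 3) (a b c : ℕ) :
    beiP V (beiQ V i (a + 1) b c) (beiQ V i (a + 1) b c) = ((a + 1) * (a + b + c + 2) : ℕ) *
      beiP V (beiQ V i a b c) (beiQ V i a b c) := by
  have hs : beiQ V i (a + 1) b c = beiU V i * beiQ V i a b c := by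
    simp only [beiQ]; ring
  conv_lhs => enter [2]; rw [hs]
  rw [beiP_adjU, beiD_Q_succ, ← nsmul_eq_mul, map_nsmul, LinearMap.smul_apply, nsmul_eq_mul]

theorem beiQ_rot (i : Fin 3) (a b c : ℕ) : beiQ V i a b c = beiQ V (i + 1) b c a := by
  have : i + 1 + 2 = i := by fin_cases i <;> rfl
  have h2 : i + 1 + 1 = i + 2 := by fin_cases i <;> rfl
  simp only [beiQ, this, h2]; ring

theorem beiP_norm (i : Fin 3) (a b c : ℕ) :
    beiP V (beiQ V i a b c) (beiQ V i a b c) =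
      (a.factorial * b.factorial * c.factorial * (a + b + c + 1).factorial : ℕ) := by
  induction a with
  | succ a ih =>
    rw [beiP_norm_step, ih, ← Nat.cast_mul]
    congr 1
    rw [show a + 1 + b + c + 1 = (a + b + c + 1) + 1 by ring, Nat.factorial_succ (a + b + c + 1),
      Nat.factorial_succ a]
    ring
  | zero =>
    induction b with
    | succ b ih =>
      rw [beiQ_rot] at ih ⊢
      rw [beiP_norm_step, ih, ← Nat.cast_mul]
      congr 1
      rw [show 0 + (b + 1) + c + 1 = (0 + b + c + 1) + 1 by ring,
        Nat.factorial_succ (0 + b + c + 1), Nat.factorial_succ b]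
      ring
    | zero =>
      rw [beiQ_rot, beiQ_rot]
      induction c with
      | succ c ih =>
        rw [beiP_norm_step, ih, ← Nat.cast_mul]
        congr 1
        rw [show 0 + 0 + (c + 1) + 1 = (0 + 0 + c + 1) + 1 by ring,
          Nat.factorial_succ (0 + 0 + c + 1), Nat.factorial_succ c]
        ring
      | zero =>
        have : beiQ V (i + 1 + 1) 0 0 0 = monomial 0 1 := by simp [beiQ]
        rw [this, beiP_monomial]
        simp [beiFac]

theorem beiQ_hom (i : Fin 3) (a b c : ℕ) : (beiQ V i a b c).IsHomogeneous (2 * (a + b + c)) := by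
  have hU : ∀ j, (beiU V j).IsHomogeneous 2 := fun j =>
    ((isHomogeneous_X _ _).mul (isHomogeneous_X _ _)).sub
      ((isHomogeneous_X _ _).mul (isHomogeneous_X _ _))
  have := ((hU i).pow a).mul (((hU (i + 1)).pow b).mul ((hU (i + 2)).pow c))
  rw [show 2 * (a + b + c) = 2 * a + (2 * b + 2 * c) by ring]
  exact this

theorem beiP_dvd (f h : MvPolynomial beiS V) (d q : ℕ) (hf : f.IsHomogeneous d)
    (hq : ∀ α : beiS →₀ ℕ, ∑ i, α i = d → q ∣ beiFac α) : (q : V) ∣ beiP V f h := by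
  rw [f.as_sum, map_sum, LinearMap.sum_apply]
  refine Finset.dvd_sum fun α hα => ?_
  rw [beiP_monomial]
  have h1 : ∑ i, α i = d := by
    rw [← hf (mem_support_iff.1 hα)]
    rw [Finsupp.weight_apply, Finsupp.sum_fintype _ _ (by simp)]
    simp
  exact Dvd.dvd.mul_left (Dvd.dvd.mul_right (by exact_mod_cast Nat.cast_dvd_cast (hq α h1)) _) _

end

theorem bei_fac_log (p : ℕ) {ι : Type*} (s : Finset ι) (α : ι → ℕ) :
    (Nat.factorial (∑ i ∈ s, α i)).factorization p ≤
      (∏ i ∈ s, (α i).factorial).factorization p + s.card * Nat.log p (∑ i ∈ s, α i) := by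
  classical
  induction s using Finset.induction_on with
  | empty => simp
  | insert a s ha ih =>
    rw [Finset.sum_insert ha, Finset.prod_insert ha, Finset.card_insert_of_notMem ha]
    set y := ∑ i ∈ s, α i
    rw [← Nat.add_choose_mul_factorial_mul_factorial, Nat.factorization_mul, Nat.factorization_mul,
      Nat.factorization_mul]
    · simp only [Finsupp.add_apply]
      have h1 : ((α a + y).choose y).factorization p ≤ Nat.log p (α a + y) :=
        Nat.factorization_choose_le_log
      have h2 : Nat.log p y ≤ Nat.log p (α a + y) := Nat.log_mono_right (by omega)
      have h3 : s.card * Nat.log p y ≤ s.card * Nat.log p (α a + y) := Nat.mul_le_mul_left _ h2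
      rw [add_mul]
      omega
    all_goals first
      | exact Nat.factorial_ne_zero _
      | exact Finset.prod_ne_zero_iff.2 fun _ _ => Nat.factorial_ne_zero _
      | exact (Nat.choose_pos (by omega)).ne'
      | exact mul_ne_zero (Nat.choose_pos (by omega)).ne' (Nat.factorial_ne_zero _)

def beiC (r : ℕ) : ℕ :=
  r.factorial * r.factorial * r.factorial * (r + r + r + 1).factorial

theorem beiC_ne (r : ℕ) : beiC r ≠ 0 := by
  simp [beiC, Nat.factorial_ne_zero]

theorem beiC_fac (p r : ℕ) (α : beiS →₀ ℕ) (hα : ∑ i, α i = 2 * (r + r + r)) :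
    (beiC r).factorization p ≤ (beiFac α).factorization p + 7 * Nat.log p (6 * r + 1) := by
  have h1 : beiC r ∣ (6 * r + 1).factorial := by
    have a1 := Nat.factorial_mul_factorial_dvd_factorial_add r r
    have a2 := Nat.factorial_mul_factorial_dvd_factorial_add (r + r) r
    have a3 := Nat.factorial_mul_factorial_dvd_factorial_add (r + r + r) (r + r + r + 1)
    rw [show 6 * r + 1 = r + r + r + (r + r + r + 1) by ring]
    exact (mul_dvd_mul_right ((mul_dvd_mul_right a1 _).trans a2) _).trans a3
  have h2 := (Nat.factorization_le_iff_dvd (beiC_ne r) (Nat.factorial_ne_zero _)).2 h1 p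
  have h3 := bei_fac_log p Finset.univ α
  rw [hα, show 2 * (r + r + r) = 6 * r by ring] at h3
  rw [Nat.factorial_succ, Nat.factorization_mul (by omega) (Nat.factorial_ne_zero _),
    Finsupp.add_apply] at h2
  have h4 : (6 * r + 1).factorization p ≤ Nat.log p (6 * r + 1) := by
    have := @Nat.factorization_choose_le_log p (6 * r + 1) 1
    simpa using this
  have h5 : Nat.log p (6 * r) ≤ Nat.log p (6 * r + 1) := Nat.log_mono_right (by omega)
  simp only [Finset.card_univ, Fintype.card_prod, Fintype.card_fin] at h3
  unfold beiFac
  omega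

theorem bei_pair_sum {V : Type*} [CommRing V] (r : ℕ) (g : Fin 3 → MvPolynomial beiS V) :
    beiP V (beiQ V 0 r r r) (∑ j, g j * beiU V j ^ (r + 1)) = 0 := by
  rw [map_sum]
  refine Finset.sum_eq_zero fun j _ => ?_
  have : beiQ V 0 r r r = beiQ V j r r r := by
    fin_cases j
    · rfl
    · exact beiQ_rot 0 r r r
    · exact (beiQ_rot 0 r r r).trans (beiQ_rot 1 r r r)
  rw [this, mul_comm]
  exact beiP_kill j (r + 1) r r r (by omega) _

theorem beiQ_eq {V : Type*} [CommRing V] (r : ℕ) :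
    beiQ V 0 r r r = (∏ j, beiU V j) ^ r := by
  simp [beiQ, Fin.prod_univ_three, mul_pow, mul_assoc]

theorem bei_char_zero {V : Type*} [CommRing V] [CharZero V] (r : ℕ)
    (h : (∏ j, beiU V j) ^ r ∈ Ideal.span (Set.range fun j => beiU V j ^ (r + 1))) : False := by
  obtain ⟨g, hg⟩ := Ideal.mem_span_range_iff_exists_fun.1 h
  have h1 := bei_pair_sum r g
  rw [hg, ← beiQ_eq, beiP_norm] at h1
  exact beiC_ne r (by exact_mod_cast h1)

theorem bei_char_p {V : Type*} [CommRing V] [IsDomain V] (p : ℕ) [hp : Fact p.Prime]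
    (hp0 : (p : V) ≠ 0) (hpu : ¬ IsUnit (p : V)) (r k : ℕ) 
    (h : (∏ j, beiU V j) ^ r ∈ Ideal.span (Set.range fun j => beiU V j ^ (r + 1)) ⊔
      Ideal.span {(p : MvPolynomial beiS V) ^ k}) : k ≤ 7 * Nat.log p (6 * r + 1) := by
  obtain ⟨x, hx, y, hy, hxy⟩ := Submodule.mem_sup.1 h
  obtain ⟨g, hg⟩ := Ideal.mem_span_range_iff_exists_fun.1 hx
  obtain ⟨w, hw⟩ := Ideal.mem_span_singleton.1 hy
  have h1 := bei_pair_sum r g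
  set t := (beiC r).factorization p - 7 * Nat.log p (6 * r + 1) with ht
  have h2 : ((p ^ t : ℕ) : V) ∣ beiP V (beiQ V 0 r r r) w := by
    refine beiP_dvd _ _ _ _ (beiQ_hom 0 r r r) fun α hα => ?_
    refine (pow_dvd_pow p ?_).trans (Nat.ordProj_dvd _ p)
    have := beiC_fac p r α hα
    omega
  have h3 : beiP V (beiQ V 0 r r r) (beiQ V 0 r r r) = (beiC r : V) := beiP_norm 0 r r r
  have h4 : (beiC r : V) = (p : V) ^ k * beiP V (beiQ V 0 r r r) w := by
    rw [← h3]
    conv_lhs => enter [2]; rw [beiQ_eq, ← hxy, hw, ← hg]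
    rw [map_add, h1, zero_add, ← Nat.cast_pow, ← nsmul_eq_mul, map_nsmul, nsmul_eq_mul]
    push_cast; rfl
  obtain ⟨z, hz⟩ := h2
  set v := (beiC r).factorization p with hv
  by_contra hk
  have hlt : v + 1 ≤ k + t := by omega
  obtain ⟨e, he⟩ := Nat.exists_eq_add_of_le hlt
  have h5 : (beiC r : V) = (p : V) ^ v * ((beiC r / p ^ v : ℕ) : V) := by
    rw [← Nat.cast_pow, ← Nat.cast_mul, hv, Nat.ordProj_mul_ordCompl_eq_self]
  have h6 : (p : V) ^ v * ((beiC r / p ^ v : ℕ) : V) = (p : V) ^ v * (p * (p ^ e * z)) := by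
    rw [← h5, h4, hz]; push_cast
    rw [← mul_assoc, ← pow_add, he]; ring
  have h7 := mul_left_cancel₀ (pow_ne_zero _ hp0) h6
  have hcop : Nat.Coprime (beiC r / p ^ v) p :=
    (Nat.coprime_ordCompl hp.out (beiC_ne r)).symm
  have h8 := (Nat.isCoprime_iff_coprime.2 hcop)
  obtain ⟨a, b, hab⟩ := h8
  have h9 := congrArg (Int.cast : ℤ → V) hab
  simp only [Int.cast_add, Int.cast_mul, Int.cast_natCast, Int.cast_one] at h9
  apply hpu
  rw [h7] at h9
  exact isUnit_of_dvd_one ⟨a * (p ^ e * z) + b, by rw [← h9]; ring⟩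

theorem bei_growth (p N : ℕ) (hp : p.Prime) :
    ∃ k, 0 < k ∧ 7 * Nat.log p (N * k) < k := by
  set r := 14 * (N + 1) with hr
  refine ⟨7 * (2 * r), by omega, ?_⟩
  have h1 : r < 2 ^ r := Nat.lt_two_pow_self
  have h2 : N * (7 * (2 * r)) < p ^ (2 * r) := by
    calc N * (7 * (2 * r)) ≤ r * r := by rw [hr]; nlinarith
      _ < 2 ^ r * 2 ^ r := by nlinarith
      _ = 2 ^ (2 * r) := by ring
      _ ≤ p ^ (2 * r) := Nat.pow_le_pow_left hp.two_le _
  have h3 := Nat.log_lt_of_lt_pow' (b := p) (x := 2 * r) (y := N * (7 * (2 * r))) (by omega) h2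
  omega

theorem bei_three_aux_p {L : Type*} [Field L] (p : ℕ) [hp : Fact p.Prime] [CharP L p] [PerfectRing L p]
    {s N : ℕ} (hs : s < 3) (F : Fin s → MvPolynomial beiS L)
    (hF : ∀ i, F i ∈ Ideal.span (Set.range (beiU L)))
    (hy : ∀ j, beiU L j ^ (N + 1) ∈ Ideal.span (Set.range F)) : False := by
  classical
  let V := WittVector p L
  let π : MvPolynomial beiS V →+* MvPolynomial beiS L := MvPolynomial.map WittVector.constantCoeff
  have hsurj : Function.Surjective π :=
    MvPolynomial.map_surjective _ (WittVector.constantCoeff_surjective p)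
  have hU : ∀ j, π (beiU V j) = beiU L j := by intro j; simp [π, beiU]
  have hker : ∀ f, π f = 0 → (p : MvPolynomial beiS V) ∣ f := by
    intro f hf
    have := (C_dvd_iff_map_hom_eq_zero (WittVector.constantCoeff : V →+* L) (p : V) (by
      intro x
      rw [← RingHom.mem_ker, WittVector.ker_constantCoeff, Ideal.mem_span_singleton]) f).2 hf
    simpa using this
  have hF' : ∀ i, ∃ f ∈ Ideal.span (Set.range (beiU V)), π f = F i := by
    intro i
    obtain ⟨c, hc⟩ := Ideal.mem_span_range_iff_exists_fun.1 (hF i)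
    choose d hd using fun j => hsurj (c j)
    refine ⟨∑ j, d j * beiU V j, Ideal.mem_span_range_iff_exists_fun.2 ⟨d, rfl⟩, ?_⟩
    rw [map_sum, ← hc]
    simp [hd, hU]
  choose F' hF'1 hF'2 using hF'
  have hy' : ∀ j, ∃ x ∈ Ideal.span (Set.range F'), ∃ b, beiU V j ^ (N + 1) = x + p * b := by
    intro j
    obtain ⟨c, hc⟩ := Ideal.mem_span_range_iff_exists_fun.1 (hy j)
    choose d hd using fun j => hsurj (c j)
    obtain ⟨b, hb⟩ := hker (beiU V j ^ (N + 1) - ∑ i, d i * F' i) (by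
      rw [map_sub, map_pow, map_sum, hU, ← hc]; simp [hd, hF'2])
    exact ⟨∑ i, d i * F' i, Ideal.mem_span_range_iff_exists_fun.2 ⟨d, rfl⟩, b, by
      rw [← hb]; ring⟩
  obtain ⟨k, hk0, hk⟩ := bei_growth p (12 * (N + 1)) hp.out
  obtain ⟨M, hM⟩ : ∃ M, (N + 1) * k = M + 1 :=
    ⟨(N + 1) * k - 1, by have : 0 < (N + 1) * k := by positivity
                         omega⟩
  set I : Ideal (MvPolynomial beiS V) := Ideal.span {(p : MvPolynomial beiS V) ^ k} with hI
  have hmono := bei_mono (N := M) hs (fun j => Ideal.Quotient.mk I (beiU V j))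
    (fun i => Ideal.Quotient.mk I (F' i)) (by
      intro i
      have := Ideal.mem_map_of_mem (Ideal.Quotient.mk I) (hF'1 i)
      rw [Ideal.map_span, ← Set.range_comp] at this
      exact this) (by
      intro j
      obtain ⟨x, hx, b, hb⟩ := hy' j
      have h1 : beiU V j ^ (M + 1) - (p * b) ^ k ∈ Ideal.span (Set.range F') := by
        rw [← hM, pow_mul, hb]
        have := sub_dvd_pow_sub_pow (x + p * b) (p * b) k
        rw [add_sub_cancel_right] at this
        exact Ideal.mem_of_dvd _ this hx
      have h2 := Ideal.mem_map_of_mem (Ideal.Quotient.mk I) h1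
      have h3 : Ideal.Quotient.mk I ((p * b) ^ k) = 0 := by
        rw [Ideal.Quotient.eq_zero_iff_mem, mul_pow]
        exact Ideal.mul_mem_right _ _ (Ideal.subset_span rfl)
      rw [Ideal.map_span, ← Set.range_comp, map_sub, h3, sub_zero, map_pow] at h2
      exact h2)
  have hmem : (∏ j, beiU V j) ^ (2 * M + 1) ∈
      Ideal.span (Set.range fun j => beiU V j ^ (2 * M + 1 + 1)) ⊔ I := by
    rw [← Ideal.mem_quotient_iff_mem_sup, Ideal.map_span, ← Set.range_comp]
    rw [map_pow, map_prod]
    have e : (⇑(Ideal.Quotient.mk I) ∘ fun j => beiU V j ^ (2 * M + 1 + 1)) = fun j =>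
        (Ideal.Quotient.mk I) (beiU V j) ^ (2 * M + 2) := by
      funext j; simp
    rw [e]
    exact hmono
  have := bei_char_p p (WittVector.p_nonzero p L) (WittVector.irreducible p).not_isUnit _ _ hmem
  have h2 : Nat.log p (6 * (2 * M + 1) + 1) ≤ Nat.log p (12 * (N + 1) * k) :=
    Nat.log_mono_right (by rw [mul_assoc, hM]; omega)
  omega

theorem bei_three {K : Type*} [Field K]
    {s N : ℕ} (hs : s < 3) (F : Fin s → MvPolynomial beiS K)
    (hF : ∀ i, F i ∈ Ideal.span (Set.range (beiU K)))
    (hy : ∀ j, beiU K j ^ (N + 1) ∈ Ideal.span (Set.range F)) : False := by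
  obtain ⟨p, hp⟩ := CharP.exists K
  rcases CharP.char_is_prime_or_zero K p with h | h
  · have : Fact p.Prime := ⟨h⟩
    let L := AlgebraicClosure K
    have : CharP L p := charP_of_injective_algebraMap (algebraMap K L).injective p
    let π : MvPolynomial beiS K →+* MvPolynomial beiS L := MvPolynomial.map (algebraMap K L)
    have hU : ∀ j, π (beiU K j) = beiU L j := by intro j; simp [π, beiU]
    refine bei_three_aux_p p hs (N := N) (fun i => π (F i)) ?_ ?_
    · intro i
      have := Ideal.mem_map_of_mem π (hF i)
      rw [Ideal.map_span, ← Set.range_comp] at this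
      rwa [show π ∘ beiU K = beiU L from funext hU] at this
    · intro j
      have := Ideal.mem_map_of_mem π (hy j)
      rw [Ideal.map_span, ← Set.range_comp, map_pow, hU] at this
      exact this
  · subst h
    have : CharZero K := CharP.charP_to_charZero K
    exact bei_char_zero (V := K) (2 * N + 1) (bei_mono hs (beiU K) F hF hy)

theorem bei_transfer {R R' : Type*} [CommRing R] [CommRing R'] (ψ : R →+* R') (J : Ideal R)
    {n s : ℕ} (y : Fin n → R') (F : Fin s → R) (hFJ : ∀ i, F i ∈ J)
    (hrad : (Ideal.span (Set.range F)).radical = J.radical)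
    (h1 : J.map ψ ≤ Ideal.span (Set.range y)) (h2 : ∀ j, y j ∈ J.map ψ) :
    ∃ N : ℕ, (∀ i, ψ (F i) ∈ Ideal.span (Set.range y)) ∧
      ∀ j, y j ^ (N + 1) ∈ Ideal.span (Set.range fun i => ψ (F i)) := by
  have h3 : ∀ j, y j ∈ (Ideal.span (Set.range fun i => ψ (F i))).radical := by
    intro j
    have e : (Ideal.span (Set.range F)).map ψ = Ideal.span (Set.range fun i => ψ (F i)) := by
      rw [Ideal.map_span, ← Set.range_comp]; rfl
    rw [← e]
    apply Ideal.map_radical_le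
    rw [hrad]
    exact Ideal.map_mono Ideal.le_radical (h2 j)
  choose k hk using h3
  refine ⟨∑ j, k j, fun i => h1 (Ideal.mem_map_of_mem _ (hFJ i)), fun j => ?_⟩
  refine Ideal.pow_mem_of_pow_mem _ (hk j) ?_
  have := Finset.single_le_sum (f := k) (fun _ _ => Nat.zero_le _) (Finset.mem_univ j)
  omega

theorem bei_X_not {K : Type*} [Field K] {n N : ℕ}
    (h : (∏ j : Fin n, (X j : MvPolynomial (Fin n) K)) ^ (2 * N + 1) ∈
      Ideal.span (Set.range fun j : Fin n => (X j : MvPolynomial (Fin n) K) ^ (2 * N + 2))) :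
    False := by
  classical
  obtain ⟨g, hg⟩ := Ideal.mem_span_range_iff_exists_fun.1 h
  have e : (∏ j : Fin n, (X j : MvPolynomial (Fin n) K)) ^ (2 * N + 1) =
      monomial (Finsupp.equivFunOnFinite.symm fun _ => 2 * N + 1) 1 := by
    rw [monomial_eq, Finsupp.prod_fintype _ _ (by simp), ← Finset.prod_pow]
    simp
  have h1 := congrArg (coeff (Finsupp.equivFunOnFinite.symm fun _ : Fin n => 2 * N + 1)) hg
  rw [e, coeff_monomial, if_pos rfl, coeff_sum, Finset.sum_eq_zero] at h1
  · exact zero_ne_one h1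
  · intro j _
    rw [X_pow_eq_monomial, coeff_mul_monomial', if_neg]
    intro hle
    have := hle j
    simp at this

theorem bei_four (K : Type*) [Field K] (n : ℕ) (hn : 4 ≤ n)
    (G : SimpleGraph (Fin n))
    (hadj : ∀ a b : Fin n, G.Adj a b ↔
      (a.1 + 1 = b.1 ∨ b.1 + 1 = a.1 ∨ (a.1 = 0 ∧ b.1 = n - 1) ∨ (b.1 = 0 ∧ a.1 = n - 1)))
    {s : ℕ} (F : Fin s → MvPolynomial (Fin (n + n)) K)
    (hF : ∀ i, F i ∈ binomialEdgeIdeal K G)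
    (hrad : (Ideal.span (Set.range F)).radical = (binomialEdgeIdeal K G).radical) : n ≤ s := by
  by_contra hs
  push Not at hs
  let cx : Fin n → MvPolynomial (Fin n) K := fun i =>
    if i.1 = 1 then 1 else if i.1 = 3 then 0 else X i
  let cy : Fin n → MvPolynomial (Fin n) K := fun i =>
    if i.1 = 0 then X ⟨1, by omega⟩ else if i.1 = 1 then 0 else
      if i.1 = 2 then X ⟨3, by omega⟩ else 1
  let ψ : MvPolynomial (Fin (n + n)) K →+* MvPolynomial (Fin n) K :=
    (aeval (Fin.append cx cy)).toRingHom
  have hψ : ∀ p q, ψ (edgeBinomial K n p q) = cx p * cy q - cx q * cy p := by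
    intro p q
    simp only [ψ, edgeBinomial, AlgHom.toRingHom_eq_coe, RingHom.coe_coe, map_sub, map_mul, aeval_X,
      Fin.append_left, Fin.append_right]
  have cx0 : ∀ i : Fin n, i.1 = 0 → cx i = X i := fun i h => by simp [cx, h]
  have cx1 : ∀ i : Fin n, i.1 = 1 → cx i = 1 := fun i h => by simp [cx, h]
  have cx2 : ∀ i : Fin n, i.1 = 2 → cx i = X i := fun i h => by simp [cx, h]
  have cx3 : ∀ i : Fin n, i.1 = 3 → cx i = 0 := fun i h => by simp [cx, h]
  have cx4 : ∀ i : Fin n, 4 ≤ i.1 → cx i = X i := fun i h => by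
    have h1 : i.1 ≠ 1 := by omega
    have h2 : i.1 ≠ 3 := by omega
    simp [cx, h1, h2]
  have cy0 : ∀ i : Fin n, i.1 = 0 → cy i = X ⟨1, by omega⟩ := fun i h => by simp [cy, h]
  have cy1 : ∀ i : Fin n, i.1 = 1 → cy i = 0 := fun i h => by simp [cy, h]
  have cy2 : ∀ i : Fin n, i.1 = 2 → cy i = X ⟨3, by omega⟩ := fun i h => by simp [cy, h]
  have cy3 : ∀ i : Fin n, 3 ≤ i.1 → cy i = 1 := fun i h => by
    have h0 : i.1 ≠ 0 := by omega
    have h1 : i.1 ≠ 1 := by omega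
    have h2 : i.1 ≠ 2 := by omega
    simp [cy, h0, h1, h2]
  have hX : ∀ i, (X i : MvPolynomial (Fin n) K) ∈ Ideal.span (Set.range X) := fun i =>
    Ideal.subset_span ⟨i, rfl⟩
  have hcx : ∀ i : Fin n, 3 ≤ i.1 → cx i ∈ Ideal.span (Set.range (X : _ → MvPolynomial (Fin n) K)) := by
    intro i hi
    rcases Nat.eq_or_lt_of_le hi with h | h
    · rw [cx3 i h.symm]; exact Ideal.zero_mem _
    · rw [cx4 i h]; exact hX i
  set J := binomialEdgeIdeal K G with hJ
  have hE : ∀ p q : Fin n, p.1 < q.1 → (p.1 + 1 = q.1 ∨ (p.1 = 0 ∧ q.1 = n - 1)) →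
      cx p * cy q - cx q * cy p ∈ J.map ψ := by
    intro p q hpq h
    rw [← hψ]
    refine Ideal.mem_map_of_mem _ (Ideal.subset_span ⟨p, q, hpq, ?_, rfl⟩)
    rw [hadj]; tauto
  have h1 : J.map ψ ≤ Ideal.span (Set.range (X : _ → MvPolynomial (Fin n) K)) := by
    rw [hJ, binomialEdgeIdeal, Ideal.map_span, Ideal.span_le]
    rintro _ ⟨_, ⟨p, q, hpq, ha, rfl⟩, rfl⟩
    rw [SetLike.mem_coe, hψ]
    have hpq' : p.1 < q.1 := hpq
    rw [hadj] at ha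
    have ha' : (p.1 + 1 = q.1 ∨ (p.1 = 0 ∧ q.1 = n - 1)) := by omega
    rcases ha' with h | ⟨h, h'⟩
    · rcases (show p.1 = 0 ∨ p.1 = 1 ∨ p.1 = 2 ∨ 3 ≤ p.1 by omega) with h0 | h0 | h0 | h0
      · rw [cy1 q (by omega), cx1 q (by omega), cy0 p h0, mul_zero, zero_sub, one_mul]
        exact neg_mem (hX _)
      · rw [cx1 p h0, cy2 q (by omega), cy1 p h0, one_mul, mul_zero, sub_zero]
        exact hX _
      · rw [cx2 p h0, cx3 q (by omega), cy3 q (by omega), mul_one, zero_mul, sub_zero]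
        exact hX _
      · rw [cy3 p h0, cy3 q (by omega), mul_one, mul_one]
        exact sub_mem (hcx _ h0) (hcx _ (by omega))
    · rw [cx0 p h, cy3 q (by omega), cy0 p h, mul_one]
      exact sub_mem (hX _) (Ideal.mul_mem_left _ _ (hX _))
  have m1 : (X ⟨1, by omega⟩ : MvPolynomial (Fin n) K) ∈ J.map ψ := by
    have := hE ⟨0, by omega⟩ ⟨1, by omega⟩ (by simp) (by simp)
    rw [cx1 ⟨1, by omega⟩ rfl, cy0 ⟨0, by omega⟩ rfl, cy1 ⟨1, by omega⟩ rfl, mul_zero, zero_sub,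
      one_mul] at this
    simpa using neg_mem this
  have m3 : (X ⟨3, by omega⟩ : MvPolynomial (Fin n) K) ∈ J.map ψ := by
    have := hE ⟨1, by omega⟩ ⟨2, by omega⟩ (by simp) (by simp)
    rw [cx1 ⟨1, by omega⟩ rfl, cy2 ⟨2, by omega⟩ rfl, cy1 ⟨1, by omega⟩ rfl, mul_zero, sub_zero,
      one_mul] at this
    exact this
  have m2 : (X ⟨2, by omega⟩ : MvPolynomial (Fin n) K) ∈ J.map ψ := by
    have := hE ⟨2, by omega⟩ ⟨3, by omega⟩ (by simp) (by simp)
    rw [cx2 ⟨2, by omega⟩ rfl, cx3 ⟨3, by omega⟩ rfl, cy3 ⟨3, by omega⟩ le_rfl, mul_one, zero_mul,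
      sub_zero] at this
    exact this
  have m4 : ∀ i : ℕ, 3 ≤ i → ∀ h : i < n, cx ⟨i, h⟩ ∈ J.map ψ := by
    intro i hi
    induction i, hi using Nat.le_induction with
    | base => intro h; rw [cx3 _ rfl]; exact Ideal.zero_mem _
    | succ i hi ih =>
      intro h
      have h1 := ih (by omega)
      have := hE ⟨i, by omega⟩ ⟨i + 1, h⟩ (by simp) (by simp)
      rw [cy3 ⟨i, by omega⟩ hi, cy3 ⟨i + 1, h⟩ (by simp; omega), mul_one, mul_one] at this
      simpa using sub_mem h1 this
  have m0 : (X ⟨0, by omega⟩ : MvPolynomial (Fin n) K) ∈ J.map ψ := by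
    have := hE ⟨0, by omega⟩ ⟨n - 1, by omega⟩ (by simp; omega) (by simp)
    rw [cx0 ⟨0, by omega⟩ rfl, cy0 ⟨0, by omega⟩ rfl, cy3 ⟨n - 1, by omega⟩ (by simp; omega),
      mul_one] at this
    simpa using add_mem this (Ideal.mul_mem_left _ (cx ⟨n - 1, by omega⟩) m1)
  have h2 : ∀ j, (X j : MvPolynomial (Fin n) K) ∈ J.map ψ := by
    rintro ⟨j, hj⟩
    rcases (show j = 0 ∨ j = 1 ∨ j = 2 ∨ j = 3 ∨ 4 ≤ j by omega) with h | h | h | h | h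
    · subst h; exact m0
    · subst h; exact m1
    · subst h; exact m2
    · subst h; exact m3
    · rw [← cx4 ⟨j, hj⟩ h]; exact m4 j (by omega) hj
  obtain ⟨N, hN1, hN2⟩ := bei_transfer ψ J X F hF hrad h1 h2
  exact bei_X_not (bei_mono hs X _ hN1 hN2)

theorem bei_lower_three (K : Type*) [Field K]
    (G : SimpleGraph (Fin 3))
    (hadj : ∀ a b : Fin 3, G.Adj a b ↔ a ≠ b)
    {s : ℕ} (F : Fin s → MvPolynomial (Fin (3 + 3)) K)
    (hF : ∀ i, F i ∈ binomialEdgeIdeal K G)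
    (hrad : (Ideal.span (Set.range F)).radical = (binomialEdgeIdeal K G).radical) : 3 ≤ s := by
  by_contra hs
  push Not at hs
  let ψ : MvPolynomial (Fin (3 + 3)) K →+* MvPolynomial beiS K :=
    (aeval (Fin.append (fun i : Fin 3 => (X (i, 0) : MvPolynomial beiS K))
      (fun i : Fin 3 => X (i, 1)))).toRingHom
  have hψ : ∀ p q, ψ (edgeBinomial K 3 p q) = X (p, 0) * X (q, 1) - X (q, 0) * X (p, 1) := by
    intro p q
    simp only [ψ, edgeBinomial, AlgHom.toRingHom_eq_coe, RingHom.coe_coe, map_sub, map_mul, aeval_X,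
      Fin.append_left, Fin.append_right]
  set J := binomialEdgeIdeal K G with hJ
  have hE : ∀ p q : Fin 3, p < q → ψ (edgeBinomial K 3 p q) ∈ J.map ψ := by
    intro p q hpq
    exact Ideal.mem_map_of_mem _ (Ideal.subset_span ⟨p, q, hpq, (hadj p q).2 hpq.ne, rfl⟩)
  have e0 : beiU K 0 = ψ (edgeBinomial K 3 1 2) := by rw [hψ]; simp [beiU]
  have e1 : beiU K 1 = - ψ (edgeBinomial K 3 0 2) := by
    rw [hψ]
    have h1 : (1 + 1 : Fin 3) = 2 := rfl
    have h2 : (1 + 2 : Fin 3) = 0 := rfl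
    simp only [beiU, h1, h2]; ring
  have e2 : beiU K 2 = ψ (edgeBinomial K 3 0 1) := by
    rw [hψ]
    have h1 : (2 + 1 : Fin 3) = 0 := rfl
    have h2 : (2 + 2 : Fin 3) = 1 := rfl
    simp only [beiU, h1, h2]
  have hU : ∀ i, beiU K i ∈ Ideal.span (Set.range (beiU K)) := fun i =>
    Ideal.subset_span ⟨i, rfl⟩
  have h1 : J.map ψ ≤ Ideal.span (Set.range (beiU K)) := by
    rw [hJ, binomialEdgeIdeal, Ideal.map_span, Ideal.span_le]
    rintro _ ⟨_, ⟨p, q, hpq, ha, rfl⟩, rfl⟩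
    rw [SetLike.mem_coe]
    have : (p = 0 ∧ q = 1) ∨ (p = 0 ∧ q = 2) ∨ (p = 1 ∧ q = 2) := by omega
    rcases this with ⟨rfl, rfl⟩ | ⟨rfl, rfl⟩ | ⟨rfl, rfl⟩
    · rw [← e2]; exact hU _
    · have := neg_mem (hU 1)
      rw [e1, neg_neg] at this
      convert this
    · rw [← e0]; exact hU _
  have h2 : ∀ j, beiU K j ∈ J.map ψ := by
    intro j
    have : j = 0 ∨ j = 1 ∨ j = 2 := by omega
    rcases this with rfl | rfl | rfl
    · rw [e0]; exact hE _ _ (by decide)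
    · rw [e1]; exact neg_mem (hE _ _ (by decide))
    · rw [e2]; exact hE _ _ (by decide)
  obtain ⟨N, hN1, hN2⟩ := bei_transfer ψ J (beiU K) F hF hrad h1 h2
  exact bei_three hs _ hN1 hN2

theorem bei_lower (K : Type*) [Field K] (n : ℕ) (hn : 3 ≤ n)
    (G : SimpleGraph (Fin n))
    (hadj : ∀ a b : Fin n, G.Adj a b ↔
      (a.1 + 1 = b.1 ∨ b.1 + 1 = a.1 ∨ (a.1 = 0 ∧ b.1 = n - 1) ∨ (b.1 = 0 ∧ a.1 = n - 1)))
    {s : ℕ} (F : Fin s → MvPolynomial (Fin (n + n)) K)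
    (hF : ∀ i, F i ∈ binomialEdgeIdeal K G)
    (hrad : (Ideal.span (Set.range F)).radical = (binomialEdgeIdeal K G).radical) : n ≤ s := by
  rcases Nat.eq_or_lt_of_le hn with h | h
  · subst h
    refine bei_lower_three K G (fun a b => ?_) F hF hrad
    rw [hadj]
    omega
  · exact bei_four K n h G hadj F hF hrad

theorem bei_upper (K : Type*) [Field K] (n : ℕ) (hn : 3 ≤ n)
    (G : SimpleGraph (Fin n))
    (hadj : ∀ a b : Fin n, G.Adj a b ↔
      (a.1 + 1 = b.1 ∨ b.1 + 1 = a.1 ∨ (a.1 = 0 ∧ b.1 = n - 1) ∨ (b.1 = 0 ∧ a.1 = n - 1))) :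
    ∃ B : Fin n → MvPolynomial (Fin (n + n)) K, (∀ i, IsBinomial (B i)) ∧
      (∀ i, B i ∈ binomialEdgeIdeal K G) ∧
      (Ideal.span (Set.range B)).radical = (binomialEdgeIdeal K G).radical := by
  let B : Fin n → MvPolynomial (Fin (n + n)) K := fun i =>
    if h : i.1 + 1 < n then edgeBinomial K n i ⟨i + 1, h⟩
    else edgeBinomial K n ⟨0, by omega⟩ ⟨n - 1, by omega⟩
  have hbin : ∀ p q, IsBinomial (edgeBinomial K n p q) := by
    intro p q
    refine ⟨Finsupp.single (Fin.castAdd n p) 1 + Finsupp.single (Fin.natAdd n q) 1,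
      Finsupp.single (Fin.castAdd n q) 1 + Finsupp.single (Fin.natAdd n p) 1, ?_⟩
    simp [edgeBinomial, X, monomial_mul]
  have hmem : ∀ i, B i ∈ binomialEdgeIdeal K G := by
    intro i
    simp only [B]
    split_ifs with h
    · exact Ideal.subset_span ⟨i, ⟨i + 1, h⟩, by simp [Fin.lt_def], by rw [hadj]; simp, rfl⟩
    · exact Ideal.subset_span ⟨_, _, by simp [Fin.lt_def]; omega, by rw [hadj]; simp, rfl⟩
  refine ⟨B, fun i => ?_, hmem, ?_⟩
  · simp only [B]; split_ifs <;> exact hbin _ _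
  · congr 1
    apply le_antisymm
    · rw [Ideal.span_le]
      rintro _ ⟨i, rfl⟩
      exact hmem i
    · rw [binomialEdgeIdeal, Ideal.span_le]
      rintro _ ⟨p, q, hpq, ha, rfl⟩
      have hpq' : p.1 < q.1 := hpq
      rw [hadj] at ha
      have ha' : (p.1 + 1 = q.1 ∨ (p.1 = 0 ∧ q.1 = n - 1)) := by omega
      apply Ideal.subset_span
      rcases ha' with h | ⟨h, h'⟩
      · refine ⟨p, ?_⟩
        have : p.1 + 1 < n := by omega
        simp only [B, dif_pos this]
        congr 1
        ext; exact h
      · refine ⟨⟨n - 1, by omega⟩, ?_⟩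
        have : ¬ (n - 1 + 1 < n) := by omega
        simp only [B, dif_neg this]
        congr 1
        · ext; exact h.symm
        · ext; exact h'.symm

theorem stmt_9 (K : Type*) [Field K] (n : ℕ) (hn : 3 ≤ n)
    (G : SimpleGraph (Fin n))
    (hadj : ∀ a b : Fin n, G.Adj a b ↔
      (a.1 + 1 = b.1 ∨ b.1 + 1 = a.1 ∨ (a.1 = 0 ∧ b.1 = n - 1) ∨ (b.1 = 0 ∧ a.1 = n - 1))) :
    ara (binomialEdgeIdeal K G) = n ∧ bar (binomialEdgeIdeal K G) = n := by
  obtain ⟨B, hB1, hB2, hB3⟩ := bei_upper K n hn G hadj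
  constructor
  · apply le_antisymm
    · exact Nat.sInf_le ⟨B, hB2, hB3⟩
    · refine le_csInf ⟨n, B, hB2, hB3⟩ ?_
      rintro s ⟨F, hF, hrad⟩
      exact bei_lower K n hn G hadj F hF hrad
  · apply le_antisymm
    · exact Nat.sInf_le ⟨B, hB1, hB2, hB3⟩
    · refine le_csInf ⟨n, B, hB1, hB2, hB3⟩ ?_
      rintro s ⟨F, _, hF, hrad⟩
      exact bei_lower K n hn G hadj F hF hrad
end
end

section
/- Let G be a connected finite simple graph on the vertex set {1,…,n} with n ≥ 4, with exactly n edges, and containing three pairwise adjacent vertices (so that G has exactly one cycle, and this cycle has length 3). Then ara(J_G) = n − 1. -/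
open MvPolynomial

noncomputable section

theorem eb_swap (K : Type*) [Field K] (n : ℕ) (p q : Fin n) :
    edgeBinomial K n q p = - edgeBinomial K n p q := by
  unfold edgeBinomial; ring

theorem eb_mem (K : Type*) [Field K] {n : ℕ} (G : SimpleGraph (Fin n)) {p q : Fin n}
    (h : G.Adj p q) : edgeBinomial K n p q ∈ binomialEdgeIdeal K G := by
  rcases lt_trichotomy p q with h1 | h1 | h1
  · exact Ideal.subset_span ⟨p, q, h1, h, rfl⟩
  · exact absurd h1 h.ne
  · rw [eb_swap]
    exact neg_mem (Ideal.subset_span ⟨q, p, h1, h.symm, rfl⟩)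

theorem ub (K : Type*) [Field K] (n : ℕ)
    (G : SimpleGraph (Fin n)) [DecidableRel G.Adj]
    (hm : G.edgeFinset.card = n) (a b c d : Fin n) (hab : G.Adj a b) (hbc : G.Adj b c)
    (hac : G.Adj a c) (hcd : G.Adj c d) (hda : d ≠ a) (hdb : d ≠ b) :
    ∃ F : Fin (n - 1) → MvPolynomial (Fin (n + n)) K,
    (∀ i, F i ∈ binomialEdgeIdeal K G) ∧
      (Ideal.span (Set.range F)).radical = (binomialEdgeIdeal K G).radical := by
  classical
  have hE : (G.edgeFinset.erase s(c, d)).card = n - 1 := by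
    rw [Finset.card_erase_of_mem (by simpa using hcd), hm]
  let e := (G.edgeFinset.erase s(c, d)).equivFinOfCardEq hE
  let F0 : Sym2 (Fin n) → MvPolynomial (Fin (n + n)) K := fun s =>
    if s = s(a, b) then edgeBinomial K n a b + edgeBinomial K n c d
    else edgeBinomial K n s.out.1 s.out.2
  let F : Fin (n - 1) → MvPolynomial (Fin (n + n)) K := fun i => F0 (e.symm i).1
  have hF0 : ∀ p q, G.Adj p q → s(p, q) ≠ s(c, d) → F0 s(p, q) ∈ Ideal.span (Set.range F) := by
    intro p q h1 h2
    refine Ideal.subset_span ⟨e ⟨s(p, q), by simp only [Finset.mem_erase]; exact ⟨h2, by simpa using h1⟩⟩, ?_⟩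
    simp [F]
  have hout : ∀ p q : Fin n, edgeBinomial K n (s(p, q)).out.1 (s(p, q)).out.2 = edgeBinomial K n p q
      ∨ edgeBinomial K n (s(p, q)).out.1 (s(p, q)).out.2 = - edgeBinomial K n p q := by
    intro p q
    have h : s((s(p, q)).out.1, (s(p, q)).out.2) = s(p, q) := Quot.out_eq _
    rcases Sym2.eq_iff.1 h with ⟨h1, h2⟩ | ⟨h1, h2⟩
    · left; rw [h1, h2]
    · right; rw [h1, h2, eb_swap]
  have key : ∀ p q, G.Adj p q → s(p, q) ≠ s(c, d) → s(p, q) ≠ s(a, b) →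
      edgeBinomial K n p q ∈ Ideal.span (Set.range F) := by
    intro p q h1 h2 h3
    have := hF0 p q h1 h2
    simp only [F0, if_neg h3] at this
    rcases hout p q with h | h
    · rwa [h] at this
    · rw [h] at this; simpa using neg_mem this
  have hmem : ∀ i, F i ∈ binomialEdgeIdeal K G := by
    intro i
    have h := (e.symm i).2
    simp only [F]
    generalize (e.symm i).1 = s at h
    induction s using Sym2.ind with | _ p q
    have hpq : G.Adj p q := by
      have := Finset.mem_of_mem_erase h
      simpa using this
    simp only [F0]
    split_ifs with h1
    · exact add_mem (eb_mem K G hab) (eb_mem K G hcd)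
    · rcases hout p q with h | h
      · rw [h]; exact eb_mem K G hpq
      · rw [h]; exact neg_mem (eb_mem K G hpq)
  have hsum : edgeBinomial K n a b + edgeBinomial K n c d ∈ Ideal.span (Set.range F) := by
    have := hF0 a b hab (by
      rw [Ne, Sym2.eq_iff]; rintro (⟨h, -⟩ | ⟨h, -⟩)
      · exact hac.ne h
      · exact hda h.symm)
    simpa [F0] using this
  have hacF := key a c hac (by
      rw [Ne, Sym2.eq_iff]; rintro (⟨h, -⟩ | ⟨h, -⟩)
      · exact hac.ne h
      · exact hda h.symm) (by
      rw [Ne, Sym2.eq_iff]; rintro (⟨-, h⟩ | ⟨-, h⟩)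
      · exact hbc.ne h.symm
      · exact hac.ne h.symm)
  have hbcF := key b c hbc (by
      rw [Ne, Sym2.eq_iff]; rintro (⟨h, -⟩ | ⟨h, -⟩)
      · exact hbc.ne h
      · exact hdb h.symm) (by
      rw [Ne, Sym2.eq_iff]; rintro (⟨-, h⟩ | ⟨-, h⟩)
      · exact hbc.ne h.symm
      · exact hac.ne h.symm)
  have habR : edgeBinomial K n a b ∈ (Ideal.span (Set.range F)).radical := by
    refine ⟨2, ?_⟩
    have h : edgeBinomial K n a b ^ 2 = edgeBinomial K n a b *
        (edgeBinomial K n a b + edgeBinomial K n c d)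
        - edgeBinomial K n b d * edgeBinomial K n a c
        + edgeBinomial K n a d * edgeBinomial K n b c := by
      unfold edgeBinomial; ring
    rw [h]
    exact add_mem (sub_mem (Ideal.mul_mem_left _ _ hsum) (Ideal.mul_mem_left _ _ hacF))
      (Ideal.mul_mem_left _ _ hbcF)
  have hcdR : edgeBinomial K n c d ∈ (Ideal.span (Set.range F)).radical := by
    have := sub_mem (Ideal.le_radical hsum) habR
    simpa using this
  refine ⟨F, hmem, le_antisymm (Ideal.radical_mono ?_) ?_⟩
  · rw [Ideal.span_le]; rintro _ ⟨i, rfl⟩; exact hmem i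
  · rw [Ideal.radical_le_radical_iff]
    unfold binomialEdgeIdeal
    rw [Ideal.span_le]
    rintro _ ⟨p, q, -, hpq, rfl⟩
    by_cases h1 : s(p, q) = s(c, d)
    · rcases Sym2.eq_iff.1 h1 with ⟨rfl, rfl⟩ | ⟨rfl, rfl⟩
      · exact hcdR
      · rw [eb_swap]; exact neg_mem hcdR
    by_cases h2 : s(p, q) = s(a, b)
    · rcases Sym2.eq_iff.1 h2 with ⟨rfl, rfl⟩ | ⟨rfl, rfl⟩
      · exact habR
      · rw [eb_swap]; exact neg_mem habR
    exact Ideal.le_radical (key p q hpq h1 h2)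

/-- The map `x_i ↦ x_i`, `y_i ↦ x_i t` for `i < k` and `y_i ↦ y_i` otherwise. -/
def phi (K : Type*) [Field K] (n k : ℕ) :
    MvPolynomial (Fin (n + n)) K →ₐ[K] Polynomial (MvPolynomial (Fin (n + n)) K) :=
  aeval (Fin.addCases (fun i => Polynomial.C (X (Fin.castAdd n i)))
    (fun i => if i.1 < k then Polynomial.C (X (Fin.castAdd n i)) * Polynomial.X
      else Polynomial.C (X (Fin.natAdd n i))))

theorem phi_x (K : Type*) [Field K] (n k : ℕ) (i : Fin n) :
    phi K n k (X (Fin.castAdd n i)) = Polynomial.C (X (Fin.castAdd n i)) := by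
  simp [phi]

theorem phi_y (K : Type*) [Field K] (n k : ℕ) (i : Fin n) :
    phi K n k (X (Fin.natAdd n i)) = if i.1 < k then
      Polynomial.C (X (Fin.castAdd n i)) * Polynomial.X
      else Polynomial.C (X (Fin.natAdd n i)) := by
  simp [phi, -Fin.natAdd_eq_addNat]

/-- The kernel of `phi`. -/
def PP (K : Type*) [Field K] (n k : ℕ) : Ideal (MvPolynomial (Fin (n + n)) K) :=
  RingHom.ker (phi K n k)

theorem PP_prime (K : Type*) [Field K] (n k : ℕ) : (PP K n k).IsPrime :=
  RingHom.ker_isPrime _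

theorem PP_le (K : Type*) [Field K] (n k : ℕ) : PP K n k ≤ PP K n (k + 1) := by
  let psi : Polynomial (MvPolynomial (Fin (n + n)) K) →+*
      Polynomial (MvPolynomial (Fin (n + n)) K) :=
    Polynomial.eval₂RingHom (phi K n (k + 1)).toRingHom Polynomial.X
  have h : psi.comp (phi K n k).toRingHom = (phi K n (k + 1)).toRingHom := by
    apply MvPolynomial.ringHom_ext
    · intro r
      have h1 : ∀ j, phi K n j (C r) = Polynomial.C (C r) := fun j => by simp [phi]
      simp [psi, h1]
    · intro i
      induction i using Fin.addCases with
      | left i => simp [psi, phi_x]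
      | right i =>
        by_cases hi : i.1 < k
        · simp [-Fin.natAdd_eq_addNat, psi, phi_y, phi_x, hi, Nat.lt_succ_of_lt hi]
        · simp [-Fin.natAdd_eq_addNat, psi, phi_y, hi]
  intro f hf
  have h2 : phi K n k f = 0 := hf
  have h3 := congrArg (fun g => g f) h
  simp [h2] at h3
  exact h3.symm

theorem PP_lt (K : Type*) [Field K] (n k : ℕ) (hk : 0 < k) (hkn : k < n) :
    PP K n k < PP K n (k + 1) := by
  refine lt_of_le_of_ne (PP_le K n k) ?_
  intro h
  have h1 : edgeBinomial K n ⟨0, by omega⟩ ⟨k, hkn⟩ ∈ PP K n (k + 1) := by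
    simp only [PP, RingHom.mem_ker, edgeBinomial, map_sub, map_mul, phi_x, phi_y]
    simp; ring
  rw [← h] at h1
  simp only [PP, RingHom.mem_ker, edgeBinomial, map_sub, map_mul, phi_x, phi_y] at h1
  simp only [hk, lt_irrefl, if_true, if_false] at h1
  have h2 := congrArg (fun p => Polynomial.coeff p 1) h1
  rw [← mul_assoc, ← Polynomial.C_mul, ← Polynomial.C_mul] at h2
  simp [Polynomial.coeff_C] at h2

theorem PP_height (K : Type*) [Field K] (n k : ℕ) (hkn : k + 1 ≤ n) :
    (k : ℕ∞) ≤ (PP K n (k + 1)).height := by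
  induction k with
  | zero => simp
  | succ k ih =>
    have := PP_prime K n (k + 1)
    have := PP_prime K n (k + 1 + 1)
    have h := Ideal.height_add_one_le_of_lt_of_isPrime (PP_lt K n (k + 1) (by omega) (by omega))
    push_cast
    exact le_trans (add_le_add_left (ih (by omega)) 1) h

theorem PP_min (K : Type*) [Field K] (n : ℕ) (G : SimpleGraph (Fin n)) (hconn : G.Connected) :
    PP K n n ∈ (binomialEdgeIdeal K G).minimalPrimes := by
  have hx : ∀ i : Fin n, X (Fin.castAdd n i) ∉ PP K n n := by
    intro i hi
    simp [PP, RingHom.mem_ker, phi_x] at hi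
  refine ⟨⟨PP_prime K n n, ?_⟩, ?_⟩
  · unfold binomialEdgeIdeal
    rw [Ideal.span_le]
    rintro _ ⟨p, q, -, -, rfl⟩
    simp only [SetLike.mem_coe, PP, RingHom.mem_ker, edgeBinomial, map_sub, map_mul, phi_x, phi_y]
    simp; ring
  · rintro Q ⟨hQ, hJ⟩ hQP
    have hxQ : ∀ i : Fin n, X (Fin.castAdd n i) ∉ Q := fun i hi => hx i (hQP hi)
    have hall : ∀ i j : Fin n, edgeBinomial K n i j ∈ Q := by
      intro i j
      obtain ⟨w⟩ := hconn.preconnected i j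
      induction w with
      | nil => simp [edgeBinomial]
      | @cons u v w h p ih =>
        have h1 : edgeBinomial K n u v ∈ Q := hJ (eb_mem K G h)
        have h2 : X (Fin.castAdd n v) * edgeBinomial K n u w =
            X (Fin.castAdd n u) * edgeBinomial K n v w +
            X (Fin.castAdd n w) * edgeBinomial K n u v := by
          unfold edgeBinomial; ring
        have h3 : X (Fin.castAdd n v) * edgeBinomial K n u w ∈ Q := by
          rw [h2]; exact add_mem (Ideal.mul_mem_left _ _ ih) (Ideal.mul_mem_left _ _ h1)
        exact (hQ.mem_or_mem h3).resolve_left (hxQ v)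
    obtain ⟨i0⟩ := hconn.nonempty
    let L := FractionRing (MvPolynomial (Fin (n + n)) K ⧸ Q)
    let π : MvPolynomial (Fin (n + n)) K →+* L :=
      (algebraMap (MvPolynomial (Fin (n + n)) K ⧸ Q) L).comp (Ideal.Quotient.mk Q)
    have hπ : ∀ f, π f = 0 ↔ f ∈ Q := by
      intro f
      simp only [π, RingHom.comp_apply]
      rw [FaithfulSMul.algebraMap_eq_zero_iff, Ideal.Quotient.eq_zero_iff_mem]
    let psi : Polynomial (MvPolynomial (Fin (n + n)) K) →+* L :=
      Polynomial.eval₂RingHom π (π (X (Fin.natAdd n i0)) / π (X (Fin.castAdd n i0)))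
    have hcomp : psi.comp (phi K n n).toRingHom = π := by
      apply MvPolynomial.ringHom_ext
      · intro r
        have h1 : phi K n n (C r) = Polynomial.C (C r) := by simp [phi]
        simp [psi, h1]
      · intro i
        induction i using Fin.addCases with
        | left i => simp [psi, phi_x]
        | right i =>
          have h0 : π (X (Fin.castAdd n i0)) ≠ 0 := fun h => hxQ i0 ((hπ _).1 h)
          have h1 := (hπ _).2 (hall i i0)
          simp only [edgeBinomial, map_sub, map_mul] at h1
          simp [-Fin.natAdd_eq_addNat, psi, phi_y]
          rw [← mul_div_assoc, div_eq_iff h0]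
          linear_combination h1
    intro f hf
    have h2 : phi K n n f = 0 := hf
    have h3 := congrArg (fun g => g f) hcomp
    simp [h2] at h3
    exact (hπ f).1 h3.symm

theorem lb (K : Type*) [Field K] (n : ℕ) (hn : 4 ≤ n) (G : SimpleGraph (Fin n))
    (hconn : G.Connected) (s : ℕ) (F : Fin s → MvPolynomial (Fin (n + n)) K)
    (hF : (Ideal.span (Set.range F)).radical = (binomialEdgeIdeal K G).radical) : n - 1 ≤ s := by
  have h := PP_min K n G hconn
  rw [← Ideal.radical_minimalPrimes, ← hF, Ideal.radical_minimalPrimes] at h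
  have h1 := Ideal.height_le_card_of_mem_minimalPrimes_span (Set.finite_range F) h
  have h2 := PP_height K n (n - 1) (by omega)
  rw [show n - 1 + 1 = n by omega] at h2
  have h3 : n - 1 ≤ (Set.range F).ncard := by exact_mod_cast h2.trans h1
  refine h3.trans ?_
  rw [← Set.image_univ]
  exact (Set.ncard_image_le).trans (by simp)

theorem stmt_11 (K : Type*) [Field K] (n : ℕ) (hn : 4 ≤ n)
    (G : SimpleGraph (Fin n)) [DecidableRel G.Adj] (hconn : G.Connected)
    (hm : G.edgeFinset.card = n)
    (htri : ∃ a b c : Fin n, G.Adj a b ∧ G.Adj b c ∧ G.Adj a c) :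
    ara (binomialEdgeIdeal K G) = n - 1 := by
  obtain ⟨a, b, c, hab, hbc, hac⟩ := htri
  have hub : ∃ F : Fin (n - 1) → MvPolynomial (Fin (n + n)) K,
    (∀ i, F i ∈ binomialEdgeIdeal K G) ∧
      (Ideal.span (Set.range F)).radical = (binomialEdgeIdeal K G).radical := by
    classical
    obtain ⟨v, hv⟩ : ∃ v, v ∉ ({a, b, c} : Finset (Fin n)) := by
      by_contra! h
      have h1 : (Finset.univ : Finset (Fin n)) ⊆ {a, b, c} := fun x _ => h x
      have h2 := Finset.card_le_card h1
      have h3 := Finset.card_le_three (a := a) (b := b) (c := c)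
      simp only [Finset.card_univ, Fintype.card_fin] at h2
      omega
    obtain ⟨w⟩ := hconn.preconnected a v
    obtain ⟨d, -, hd1, hd2⟩ := w.exists_boundary_dart (({a, b, c} : Finset (Fin n)) : Set (Fin n))
      (by simp) (by simpa using hv)
    have hadj := d.adj
    simp only [Finset.coe_insert, Finset.coe_singleton, Set.mem_insert_iff,
      Set.mem_singleton_iff, not_or] at hd1 hd2
    obtain ⟨h1, h2, h3⟩ := hd2
    rcases hd1 with h | h | h <;> rw [h] at hadj
    · exact ub K n G hm b c a d.snd hbc hac.symm hab.symm hadj h2 h3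
    · exact ub K n G hm a c b d.snd hac hbc.symm hab hadj h1 h3
    · exact ub K n G hm a b c d.snd hab hbc hac hadj h1 h2
  apply le_antisymm
  · exact Nat.sInf_le hub
  · refine le_csInf ⟨_, hub⟩ ?_
    rintro s ⟨F, -, hF⟩
    exact lb K n hn G hconn s F hF
end
end
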